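/- arXiv:math/0006227 — 3 statements merged into one kernel-verified Lean document; each statement's English description precedes it below -/
import Mathlib

section
/- Let n ≥ 1 and let λ = (λ_1, …, λ_n) be a partition with at most n parts. Let s be a nonzero complex number such that s^{2m} ≠ 1 for all integers m with 1 ≤ m ≤ max(2n, λ_1 + λ^∨_1 − 1), and set α = −s^{2n+1}. Then Wenzl's quantum dimension satisfies ⟨λ⟩_{α,s} = (−1)^{|λ|} ∏_{j=1}^{n} [2n+2+2λ_j−2j]/[2n+2−2j] · ∏_{1≤i<j≤n} [2n+2+λ_i−i+λ_j−j]·[λ_i−i−λ_j+j] / ([2n+2−i−j]·[j−i]), where |λ| = λ_1 + … + λ_n. -/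
open Finset

/-- Quantum integer `[m] = (s^m - s^{-m})/(s - s⁻¹)`. -/
noncomputable def qint (s : ℂ) (m : ℤ) : ℂ := (s ^ m - s ^ (-m)) / (s - s⁻¹)

/-- Quantum integer `[m]_α = (α s^m - α⁻¹ s^{-m})/(s - s⁻¹)`. -/
noncomputable def qintA (α s : ℂ) (m : ℤ) : ℂ := (α * s ^ m - α⁻¹ * s ^ (-m)) / (s - s⁻¹)

/-- The cells `(i,j)` (row `i`, column `j`, both 1-based) of the Young diagram of
the partition `lam`, assuming all parts of index `> N` vanish. -/
def cells (lam : ℕ → ℕ) (N : ℕ) : Finset (ℕ × ℕ) :=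
  (Finset.Icc 1 N ×ˢ Finset.Icc 1 (lam 1)).filter (fun p => p.2 ≤ lam p.1)

/-- Hook length `hl(i,j) = λ_i + λ^∨_j - i - j + 1`. -/
def hookl (lam lamV : ℕ → ℕ) (p : ℕ × ℕ) : ℤ :=
  (lam p.1 : ℤ) + (lamV p.2 : ℤ) - p.1 - p.2 + 1

/-- `d_λ(i,j)`: equals `λ_i + λ_j - i - j + 1` if `i ≤ j`, and
`-λ^∨_i - λ^∨_j + i + j - 1` if `i > j`. -/
def dcell (lam lamV : ℕ → ℕ) (p : ℕ × ℕ) : ℤ :=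
  if p.1 ≤ p.2 then (lam p.1 : ℤ) + (lam p.2 : ℤ) - p.1 - p.2 + 1
  else -(lamV p.1 : ℤ) - (lamV p.2 : ℤ) + p.1 + p.2 - 1

/-- `d'_λ(i,j)`: equals `λ_i + λ_j - i - j + 1` if `i < j`, and
`-λ^∨_i - λ^∨_j + i + j - 1` if `i ≥ j`. -/
def dcell' (lam lamV : ℕ → ℕ) (p : ℕ × ℕ) : ℤ :=
  if p.1 < p.2 then (lam p.1 : ℤ) + (lam p.2 : ℤ) - p.1 - p.2 + 1
  else -(lamV p.1 : ℤ) - (lamV p.2 : ℤ) + p.1 + p.2 - 1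

/-- Wenzl's quantum dimension
`⟨λ⟩_{α,s} = ∏_{(j,j)∈λ} ([λ_j - λ^∨_j]_α + [hl(j,j)])/[hl(j,j)] ·
∏_{(i,j)∈λ, i≠j} [d_λ(i,j)]_α/[hl(i,j)]`. -/
noncomputable def wenzl (α s : ℂ) (lam lamV : ℕ → ℕ) (N : ℕ) : ℂ :=
  (∏ p ∈ (cells lam N).filter (fun p => p.1 = p.2),
      (qintA α s ((lam p.1 : ℤ) - (lamV p.1 : ℤ)) + qint s (hookl lam lamV p)) /
        qint s (hookl lam lamV p)) *
  ∏ p ∈ (cells lam N).filter (fun p => p.1 ≠ p.2),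
      qintA α s (dcell lam lamV p) / qint s (hookl lam lamV p)



@[to_additive]
lemma z_prod_split {M : Type*} [CommMonoid M] (h : ℤ → M) (a b c : ℤ) (h1 : a ≤ b) (h2 : b ≤ c) :
    ∏ t ∈ Ico a c, h t = (∏ t ∈ Ico a b, h t) * ∏ t ∈ Ico b c, h t := by
  rw [← prod_union (Finset.Ico_disjoint_Ico_consecutive a b c), Finset.Ico_union_Ico_eq_Ico h1 h2]

@[to_additive]
lemma z_prod_single {M : Type*} [CommMonoid M] (h : ℤ → M) (a : ℤ) :
    ∏ t ∈ Ico a (a+1), h t = h a := by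
  have : Ico a (a+1) = {a} := by ext x; simp; omega
  rw [this, prod_singleton]

@[to_additive]
lemma n_prod_split {M : Type*} [CommMonoid M] (h : ℕ → M) (a b c : ℕ) (h1 : a ≤ b) (h2 : b ≤ c) :
    ∏ t ∈ Ioc a c, h t = (∏ t ∈ Ioc a b, h t) * ∏ t ∈ Ioc b c, h t := by
  rw [← prod_union (Finset.Ioc_disjoint_Ioc_of_le (le_refl b)), Finset.Ioc_union_Ioc_eq_Ioc h1 h2]

@[to_additive]
lemma n_prod_single {M : Type*} [CommMonoid M] (h : ℕ → M) (a : ℕ) :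
    ∏ t ∈ Ioc a (a+1), h t = h (a+1) := by
  have : Ioc a (a+1) = {a+1} := by ext x; simp
  rw [this, prod_singleton]

@[to_additive]
lemma z_prod_up {M : Type*} [CommMonoid M] (h : ℤ → M) (e : ℤ) (a b : ℕ) (hab : a ≤ b) :
    ∏ j ∈ Ioc a b, h (e + j) = ∏ t ∈ Ico (e + a + 1) (e + b + 1), h t := by
  induction b, hab using Nat.le_induction with
  | base => simp
  | succ b hb ih =>
    rw [n_prod_split _ a b (b+1) hb (by omega), ih, n_prod_single,
      z_prod_split h (e+a+1) (e+b+1) (e+(b+1:ℕ)+1) (by omega) (by push_cast; omega)]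
    congr 1
    have := z_prod_single h (e+b+1)
    push_cast
    rw [show e + ((b:ℤ)+1) + 1 = e+b+1+1 by ring, this, add_assoc]

@[to_additive]
lemma z_prod_down {M : Type*} [CommMonoid M] (h : ℤ → M) (e : ℤ) (a b : ℕ) (hab : a ≤ b) :
    ∏ j ∈ Ioc a b, h (e - j) = ∏ t ∈ Ico (e - b) (e - a), h t := by
  induction b, hab using Nat.le_induction with
  | base => simp
  | succ b hb ih =>
    rw [n_prod_split _ a b (b+1) hb (by omega), ih, n_prod_single,
      z_prod_split h (e-(b+1:ℕ)) (e-b) (e-a) (by push_cast; omega) (by omega), mul_comm]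
    congr 1
    have := z_prod_single h (e-(b+1:ℕ))
    rw [show e - (b:ℤ) = e-(b+1:ℕ)+1 by push_cast; ring, this]

lemma tele (f : ℤ → ℤ) (x a b : ℤ) (hab : a ≤ b) :
    ∑ t ∈ Ico a b, (f (x + 1 + t) - f (x + t)) = f (x + b) - f (x + a) := by
  induction b, hab using Int.leInduction with
  | base => simp
  | succ b hb ih =>
    rw [z_sum_split _ a b (b+1) hb (by omega), z_sum_single, ih, show x + 1 + b = x + (b + 1) by ring]; ring

/-- A partition with at most `n` rows together with its conjugate. -/
structure Pt (n : ℕ) (lam lamV : ℕ → ℕ) : Prop where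
  mono : ∀ i j : ℕ, 1 ≤ i → i ≤ j → lam j ≤ lam i
  zero : ∀ i, n < i → lam i = 0
  conj : ∀ i j : ℕ, 1 ≤ i → 1 ≤ j → (j ≤ lam i ↔ i ≤ lamV j)

def lf (n : ℕ) (lam : ℕ → ℕ) (i : ℕ) : ℤ := n + 1 + lam i - i
def mf (n : ℕ) (lamV : ℕ → ℕ) (j : ℕ) : ℤ := n + j - lamV j

/-- if `lam (i+1) < j ≤ lam i` then `lamV j = i`. -/
lemma Pt.V_eq {n lam lamV} (H : Pt n lam lamV) (i j : ℕ) (hi : 1 ≤ i) (h1 : lam (i+1) < j)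
    (h2 : j ≤ lam i) : lamV j = i := by
  have a := (H.conj i j hi (by omega)).1 h2
  have b := (H.conj (i+1) j (by omega) (by omega)).not.1 (by omega)
  omega

lemma Pt.L_eq {n lam lamV} (H : Pt n lam lamV) (i j : ℕ) (hj : 1 ≤ j) (h1 : lamV (j+1) < i)
    (h2 : i ≤ lamV j) : lam i = j := by
  have a := (H.conj i j (by omega) hj).2 h2
  have b := (H.conj i (j+1) (by omega) (by omega)).not.2 (by omega)
  omega

lemma Pt.monoV {n lam lamV} (H : Pt n lam lamV) (i j : ℕ) (hi : 1 ≤ i) (hij : i ≤ j) :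
    lamV j ≤ lamV i := by
  rcases Nat.eq_zero_or_pos (lamV j) with h | h
  · omega
  · have := (H.conj (lamV j) j h (by omega)).2 le_rfl
    exact (H.conj (lamV j) i h (by omega)).1 (by omega)

lemma Pt.V_le {n lam lamV} (H : Pt n lam lamV) (j : ℕ) (hj : 1 ≤ j) : lamV j ≤ n := by
  by_contra hc
  have := (H.conj (lamV j) j (by omega) hj).2 le_rfl
  have := H.zero (lamV j) (by omega)
  omega

lemma Pt.hookprod {n lam lamV} (H : Pt n lam lamV) {M : Type*} [CommMonoid M] (h : ℤ → M)
    (i : ℕ) (hi : 1 ≤ i) (hin : i ≤ n) :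
    (∏ j ∈ Ioc 0 (lam i), h (mf n lamV j)) * ∏ j ∈ Ioc i n, h (lf n lam j)
      = ∏ t ∈ Ico 1 (lf n lam i), h t := by
  induction hin using Nat.decreasingInduction with
  | self =>
    have : ∀ j ∈ Ioc 0 (lam n), h (mf n lamV j) = h ((0:ℤ) + j) := by
      intro j hj
      rw [mem_Ioc] at hj
      have := H.V_eq n j hi (by rw [H.zero (n+1) (by omega)]; omega) hj.2
      rw [mf, this]; congr 1; ring
    rw [prod_congr rfl this, z_prod_up _ _ _ _ (by omega)]
    simp [lf]
    congr 2; ring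
  | of_succ i hin ih =>
    have ih := ih (by omega)
    have hm := H.mono i (i+1) hi (by omega)
    have : ∀ j ∈ Ioc (lam (i+1)) (lam i), h (mf n lamV j) = h (((n:ℤ)-i) + j) := by
      intro j hj
      rw [mem_Ioc] at hj
      have := H.V_eq i j hi (by omega) hj.2
      rw [mf, this]; congr 1; ring
    have e : lf n lam (i+1) = (n:ℤ)-i + lam (i+1) := by simp [lf]; ring
    have e' : lf n lam i = (n:ℤ)-i + lam i + 1 := by simp [lf]; ring
    rw [n_prod_split _ 0 (lam (i+1)) (lam i) (by omega) hm, n_prod_split _ i (i+1) n (by omega) (by omega),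
      n_prod_single, prod_congr rfl this, z_prod_up _ _ _ _ hm,
      z_prod_split h 1 (lf n lam (i+1)) (lf n lam i) (by omega) (by omega),
      z_prod_split h (lf n lam (i+1)) (lf n lam (i+1) + 1) (lf n lam i) (by omega) (by omega),
      z_prod_single, ← ih, ← e, ← e']
    simp only [mul_assoc, mul_comm, mul_left_comm]

@[to_additive]
lemma Pt.prod_window {n lam lamV} (H : Pt n lam lamV) {M : Type*} [CommMonoid M] (h : ℤ → M)
    (c b : ℕ) (hc : 1 ≤ c) (hcb : c ≤ b) :
    (∏ j ∈ Ico c b, h (mf n lamV j)) * ∏ i ∈ Ioc (lamV b) (lamV c), h (lf n lam i)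
      = ∏ t ∈ Ico (mf n lamV c) (mf n lamV b), h t := by
  induction b, hcb using Nat.le_induction with
  | base => simp
  | succ b hb ih =>
    have hm := H.monoV b (b+1) (by omega) (by omega)
    have hm' := H.monoV c b (by omega) (by omega)
    have : ∀ i ∈ Ioc (lamV (b+1)) (lamV b), h (lf n lam i) = h (((n:ℤ)+1+b) - i) := by
      intro i hi
      rw [mem_Ioc] at hi
      have := H.L_eq i b (by omega) (by omega) hi.2
      rw [lf, this]
    have e : mf n lamV b + 1 = (n:ℤ)+1+b - lamV b := by simp [mf]; ring
    have e' : mf n lamV (b+1) = (n:ℤ)+1+b - lamV (b+1) := by simp [mf]; ring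
    have e'' : mf n lamV c ≤ mf n lamV b := by simp [mf]; omega
    rw [n_prod_split _ _ _ _ hm hm', prod_Ico_succ_top hb, prod_congr rfl this, z_prod_down _ _ _ _ hm,
      z_prod_split h (mf n lamV c) (mf n lamV b) _ e'' (by omega),
      z_prod_split h (mf n lamV b) (mf n lamV b + 1) _ (by omega) (by omega), z_prod_single, ← ih, e, e']
    simp only [mul_assoc, mul_comm, mul_left_comm]

def AA (f : ℤ → ℤ) (n : ℕ) (lam : ℕ → ℕ) : ℤ :=
  ∑ i ∈ Ioc 0 n, ∑ j ∈ Ioc i (lam i), f (lf n lam i + lf n lam j)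
def BB (f : ℤ → ℤ) (n L : ℕ) (lamV : ℕ → ℕ) : ℤ :=
  ∑ j ∈ Ioc 0 L, ∑ i ∈ Icc j (lamV j), f (mf n lamV i + mf n lamV j)
def CC (f : ℤ → ℤ) (n : ℕ) (lam : ℕ → ℕ) : ℤ :=
  ∑ i ∈ Ioc 0 n, ∑ x ∈ Ioc 0 (lam i), f (n + 1 - i + x)
def DD (f : ℤ → ℤ) (n : ℕ) (lam : ℕ → ℕ) : ℤ :=
  ∑ i ∈ Ioc 0 n, ∑ j ∈ Ioc i n, f (lf n lam i + lf n lam j)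

/-- `b` is obtained from `a` by adding the box `(ρ+1, γ+1)` in the last row. -/
structure Stp (n L : ℕ) (a aV b bV : ℕ → ℕ) (ρ γ : ℕ) : Prop where
  pa : Pt n a aV
  pb : Pt n b bV
  hr : ρ + 1 ≤ n
  hc : γ + 1 ≤ L
  br : b (ρ+1) = γ + 1
  ar : a (ρ+1) = γ
  ne : ∀ i, i ≠ ρ + 1 → b i = a i
  lt : ∀ i, ρ + 1 < i → a i = 0
  hbV : bV (γ+1) = ρ + 1
  haV : aV (γ+1) = ρ
  neV : ∀ j, j ≠ γ + 1 → bV j = aV j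

lemma n_split3 (G : ℕ → ℤ) (ρ n : ℕ) (h : ρ + 1 ≤ n) :
    ∑ i ∈ Ioc 0 n, G i = ∑ i ∈ Ioc 0 ρ, G i + G (ρ+1) + ∑ i ∈ Ioc (ρ+1) n, G i := by
  rw [n_sum_split G 0 ρ n (by omega) (by omega), n_sum_split G ρ (ρ+1) n (by omega) h,
    n_sum_single]; ring

lemma Stp.lr {n L : ℕ} {a aV b bV : ℕ → ℕ} {ρ γ : ℕ} (S : Stp n L a aV b bV ρ γ) : lf n a (ρ+1) = n + γ - ρ := by simp [lf, S.ar]; ring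
lemma Stp.lr' {n L : ℕ} {a aV b bV : ℕ → ℕ} {ρ γ : ℕ} (S : Stp n L a aV b bV ρ γ) : lf n b (ρ+1) = n + γ - ρ + 1 := by simp [lf, S.br]; ring
lemma Stp.mc {n L : ℕ} {a aV b bV : ℕ → ℕ} {ρ γ : ℕ} (S : Stp n L a aV b bV ρ γ) : mf n aV (γ+1) = n + γ - ρ + 1 := by simp [mf, S.haV]; ring
lemma Stp.mc' {n L : ℕ} {a aV b bV : ℕ → ℕ} {ρ γ : ℕ} (S : Stp n L a aV b bV ρ γ) : mf n bV (γ+1) = n + γ - ρ := by simp [mf, S.hbV]; ring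
lemma Stp.ln {n L : ℕ} {a aV b bV : ℕ → ℕ} {ρ γ : ℕ} (S : Stp n L a aV b bV ρ γ) (i : ℕ) (h : i ≠ ρ + 1) : lf n b i = lf n a i := by simp [lf, S.ne i h]
lemma Stp.mn {n L : ℕ} {a aV b bV : ℕ → ℕ} {ρ γ : ℕ} (S : Stp n L a aV b bV ρ γ) (i : ℕ) (h : i ≠ γ + 1) : mf n bV i = mf n aV i := by simp [mf, S.neV i h]
lemma Stp.llast {n L : ℕ} {a aV b bV : ℕ → ℕ} {ρ γ : ℕ} (S : Stp n L a aV b bV ρ γ) (i : ℕ) (h : ρ + 1 < i) : lf n a i = n + 1 - i := by simp [lf, S.lt i h]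
lemma Stp.aVlow {n L : ℕ} {a aV b bV : ℕ → ℕ} {ρ γ : ℕ} (S : Stp n L a aV b bV ρ γ) (j : ℕ) (h1 : 1 ≤ j) (h : j < γ + 1) : aV j = ρ + 1 := by
  have h1 := (S.pa.conj (ρ+1) j (by omega) h1).1 (by rw [S.ar]; omega)
  by_contra hc
  have h2 := (S.pa.conj (aV j) j (by omega) (by omega)).2 le_rfl
  have h3 := S.lt (aV j) (by omega)
  omega

lemma Stp.C {n L : ℕ} {a aV b bV : ℕ → ℕ} {ρ γ : ℕ} (S : Stp n L a aV b bV ρ γ) (f : ℤ → ℤ) : CC f n b - CC f n a = f (n + γ - ρ + 1) := by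
  unfold CC
  rw [n_split3 _ ρ n S.hr, n_split3 _ ρ n S.hr]
  have h1 : ∀ i ∈ Ioc 0 ρ, ∑ x ∈ Ioc 0 (b i), f (n + 1 - i + x) = ∑ x ∈ Ioc 0 (a i), f (n + 1 - i + x) := by
    intro i hi; rw [mem_Ioc] at hi; rw [S.ne i (by omega)]
  have h2 : ∀ i ∈ Ioc (ρ+1) n, ∑ x ∈ Ioc 0 (b i), f (n + 1 - i + x) = ∑ x ∈ Ioc 0 (a i), f (n + 1 - i + x) := by
    intro i hi; rw [mem_Ioc] at hi; rw [S.ne i (by omega)]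
  rw [sum_congr rfl h1, sum_congr rfl h2, S.ar, S.br, n_sum_split _ 0 γ (γ+1) (by omega) (by omega),
    n_sum_single]
  have : (n:ℤ) + 1 - (ρ + 1 : ℕ) + (γ + 1 : ℕ) = n + γ - ρ + 1 := by push_cast; ring
  rw [this]; ring

lemma Stp.D {n L : ℕ} {a aV b bV : ℕ → ℕ} {ρ γ : ℕ} (S : Stp n L a aV b bV ρ γ) (f : ℤ → ℤ) : DD f n b - DD f n a =
    ∑ i ∈ Ioc 0 ρ, (f (n + γ - ρ + 1 + lf n a i) - f (n + γ - ρ + lf n a i))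
     + (f (n + γ - ρ + (n - ρ)) - f (n + γ - ρ + 1)) := by
  unfold DD
  rw [n_split3 _ ρ n S.hr, n_split3 _ ρ n S.hr]
  have h1 : ∀ i ∈ Ioc 0 ρ, ∑ j ∈ Ioc i n, f (lf n b i + lf n b j) = ∑ j ∈ Ioc i n, f (lf n a i + lf n a j) + (f (n + γ - ρ + 1 + lf n a i) - f (n + γ - ρ + lf n a i)) := by
    intro i hi
    rw [mem_Ioc] at hi
    have : ∀ j ∈ Ioc i n, f (lf n b i + lf n b j) = f (lf n a i + lf n a j) +
      if ρ + 1 = j then (f (n + γ - ρ + 1 + lf n a i) - f (n + γ - ρ + lf n a i)) else 0 := by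
      intro j hj
      rw [S.ln i (by omega)]
      split_ifs with h
      · subst h
        rw [S.lr, S.lr', add_comm (lf n a i), add_comm (lf n a i)]; ring
      · rw [S.ln j (by omega)]; ring
    rw [sum_congr rfl this, sum_add_distrib, sum_ite_eq, if_pos]
    have := S.hr
    rw [mem_Ioc]; omega
  have h2 : ∀ i ∈ Ioc (ρ+1) n, ∑ j ∈ Ioc i n, f (lf n b i + lf n b j) = ∑ j ∈ Ioc i n, f (lf n a i + lf n a j) := by
    intro i hi
    rw [mem_Ioc] at hi
    refine sum_congr rfl fun j hj => ?_
    rw [mem_Ioc] at hj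
    rw [S.ln i (by omega), S.ln j (by omega)]
  have h3 : ∑ j ∈ Ioc (ρ+1) n, f (lf n b (ρ+1) + lf n b j) = ∑ j ∈ Ioc (ρ+1) n, f (lf n a (ρ+1) + lf n a j) + (f (n + γ - ρ + (n - ρ)) - f (n + γ - ρ + 1)) := by
    have e : ∀ j ∈ Ioc (ρ+1) n, f (lf n b (ρ+1) + lf n b j) - f (lf n a (ρ+1) + lf n a j) = (fun t => f (n + γ - ρ + 1 + t) - f (n + γ - ρ + t)) (n + 1 - j : ℤ) := by
      intro j hj
      rw [mem_Ioc] at hj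
      rw [S.ln j (by omega), S.lr, S.lr', S.llast j (by omega)]
    rw [← sub_eq_iff_eq_add', ← sum_sub_distrib, sum_congr rfl e]
    refine (z_sum_down (fun t : ℤ => f (n + γ - ρ + 1 + t) - f (n + γ - ρ + t)) _ _ _ S.hr).trans ?_
    rw [tele]
    · congr 2 <;> push_cast <;> ring
    · have := S.hr
      push_cast; omega
  rw [sum_congr rfl h1, sum_congr rfl h2, sum_add_distrib, h3]; ring

lemma Stp.A {n L : ℕ} {a aV b bV : ℕ → ℕ} {ρ γ : ℕ} (S : Stp n L a aV b bV ρ γ) (f : ℤ → ℤ) : AA f n b - AA f n a =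
    ∑ i ∈ Ioc 0 ρ, (if ρ + 1 ≤ a i then (f (n + γ - ρ + 1 + lf n a i) - f (n + γ - ρ + lf n a i)) else 0)
     + (if ρ < γ then f (n + γ - ρ + (n - ρ)) else 0) := by
  unfold AA
  rw [n_split3 _ ρ n S.hr, n_split3 _ ρ n S.hr]
  have h1 : ∀ i ∈ Ioc 0 ρ, ∑ j ∈ Ioc i (b i), f (lf n b i + lf n b j) = ∑ j ∈ Ioc i (a i), f (lf n a i + lf n a j) + (if ρ + 1 ≤ a i then (f (n + γ - ρ + 1 + lf n a i) - f (n + γ - ρ + lf n a i)) else 0) := by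
    intro i hi
    rw [mem_Ioc] at hi
    rw [S.ne i (by omega)]
    have : ∀ j ∈ Ioc i (a i), f (lf n b i + lf n b j) = f (lf n a i + lf n a j) +
      if ρ + 1 = j then (f (n + γ - ρ + 1 + lf n a i) - f (n + γ - ρ + lf n a i)) else 0 := by
      intro j hj
      rw [S.ln i (by omega)]
      split_ifs with h
      · subst h
        rw [S.lr, S.lr', add_comm (lf n a i), add_comm (lf n a i)]; ring
      · rw [S.ln j (by omega)]; ring
    rw [sum_congr rfl this, sum_add_distrib, sum_ite_eq]
    congr 1
    have : ρ + 1 ∈ Ioc i (a i) ↔ ρ + 1 ≤ a i := by rw [mem_Ioc]; omega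
    simp only [this]
  have h2 : ∀ i ∈ Ioc (ρ+1) n, ∑ j ∈ Ioc i (b i), f (lf n b i + lf n b j) = ∑ j ∈ Ioc i (a i), f (lf n a i + lf n a j) := by
    intro i hi
    rw [mem_Ioc] at hi
    rw [S.ne i (by omega), S.lt i (by omega)]; simp
  have h3 : ∑ j ∈ Ioc (ρ+1) (b (ρ+1)), f (lf n b (ρ+1) + lf n b j) = ∑ j ∈ Ioc (ρ+1) (a (ρ+1)), f (lf n a (ρ+1) + lf n a j) + (if ρ < γ then f (n + γ - ρ + (n - ρ)) else 0) := by
    rw [S.ar, S.br]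
    split_ifs with h
    · rw [n_sum_split _ (ρ+1) γ (γ+1) (by omega) (by omega), n_sum_single]
      have e : ∀ j ∈ Ioc (ρ+1) γ, f (lf n b (ρ+1) + lf n b j) - f (lf n a (ρ+1) + lf n a j) = (fun t => f (n + γ - ρ + 1 + t) - f (n + γ - ρ + t)) (n + 1 - j : ℤ) := by
        intro j hj
        rw [mem_Ioc] at hj
        rw [S.ln j (by omega), S.lr, S.lr', S.llast j (by omega)]
      rw [S.ln (γ+1) (by omega), S.lr', S.llast (γ+1) (by omega)]
      have e2 : ∑ j ∈ Ioc (ρ+1) γ, f (lf n b (ρ+1) + lf n b j) - ∑ j ∈ Ioc (ρ+1) γ, f (lf n a (ρ+1) + lf n a j) = f (n + γ - ρ + (n - ρ)) - f (n + γ - ρ + 1 + (n + 1 - (γ + 1 : ℕ))) := by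
        rw [← sum_sub_distrib, sum_congr rfl e]
        refine (z_sum_down (fun t : ℤ => f (n + γ - ρ + 1 + t) - f (n + γ - ρ + t)) _ _ _ h).trans ?_
        rw [tele]
        · congr 2 <;> push_cast <;> ring
        · push_cast; omega
      simp only [S.lr'] at e2
      linarith
    · rw [Ioc_eq_empty (by omega), Ioc_eq_empty (by omega)]; simp
  rw [sum_congr rfl h1, sum_congr rfl h2, sum_add_distrib, h3]; ring

lemma Stp.B {n L : ℕ} {a aV b bV : ℕ → ℕ} {ρ γ : ℕ} (S : Stp n L a aV b bV ρ γ) (f : ℤ → ℤ) : BB f n L bV - BB f n L aV =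
    (if γ ≤ ρ then f (n + γ - ρ + (n - ρ)) - f (n + γ - ρ + (n + γ - ρ)) else 0) +
    (if γ = ρ then f (n + γ - ρ + (n + γ - ρ)) else 0) +
    (if γ < ρ then f (n + γ - ρ + (n + γ - ρ)) - f (n + γ - ρ + 1 + (n + γ - ρ + 1))
      - ∑ i ∈ Ico (γ+2) (ρ + 1), (f (n + γ - ρ + 1 + mf n aV i) - f (n + γ - ρ + mf n aV i))
      + f (n + γ - ρ + mf n aV (ρ + 1)) else 0) := by
  unfold BB
  rw [n_split3 _ γ L S.hc, n_split3 _ γ L S.hc]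
  have h1 : ∀ j ∈ Ioc 0 γ, ∑ i ∈ Icc j (bV j), f (mf n bV i + mf n bV j) = ∑ i ∈ Icc j (aV j), f (mf n aV i + mf n aV j) - (if γ ≤ ρ then (fun t => f (n + γ - ρ + 1 + t) - f (n + γ - ρ + t)) (n - ρ - 1 + j : ℤ) else 0) := by
    intro j hj
    rw [mem_Ioc] at hj
    have hV := S.aVlow j (by omega) (by omega)
    have hm : mf n aV j = n - ρ - 1 + j := by rw [mf, hV]; push_cast; ring
    rw [S.neV j (by omega)]
    have : ∀ i ∈ Icc j (aV j), f (mf n bV i + mf n bV j) = f (mf n aV i + mf n aV j) -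
      if γ + 1 = i then (fun t => f (n + γ - ρ + 1 + t) - f (n + γ - ρ + t)) (n - ρ - 1 + j : ℤ) else 0 := by
      intro i hi
      rw [S.mn j (by omega)]
      split_ifs with h
      · subst h
        rw [S.mc, S.mc', hm]; ring
      · rw [S.mn i (by omega)]; ring
    rw [sum_congr rfl this, sum_sub_distrib, sum_ite_eq]
    congr 1
    have : γ + 1 ∈ Icc j (aV j) ↔ γ ≤ ρ := by rw [mem_Icc, hV]; omega
    simp only [this]
  have h2 : ∀ j ∈ Ioc (γ+1) L, ∑ i ∈ Icc j (bV j), f (mf n bV i + mf n bV j) = ∑ i ∈ Icc j (aV j), f (mf n aV i + mf n aV j) := by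
    intro j hj
    rw [mem_Ioc] at hj
    rw [S.neV j (by omega)]
    refine sum_congr rfl fun i hi => ?_
    rw [mem_Icc] at hi
    rw [S.mn i (by omega), S.mn j (by omega)]
  have h1' : ∑ j ∈ Ioc 0 γ, (if γ ≤ ρ then (fun t => f (n + γ - ρ + 1 + t) - f (n + γ - ρ + t)) (n - ρ - 1 + j : ℤ) else 0) = - (if γ ≤ ρ then f (n + γ - ρ + (n - ρ)) - f (n + γ - ρ + (n + γ - ρ)) else 0) := by
    split_ifs with h
    · refine (z_sum_up (fun t : ℤ => f (n + γ - ρ + 1 + t) - f (n + γ - ρ + t)) _ _ _ (by omega)).trans ?_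
      rw [tele _ _ _ _ (by omega), neg_sub]
      congr 2 <;> push_cast <;> ring
    · simp
  have h3 : ∑ i ∈ Icc (γ+1) (bV (γ+1)), f (mf n bV i + mf n bV (γ+1)) = ∑ i ∈ Icc (γ+1) (aV (γ+1)), f (mf n aV i + mf n aV (γ+1)) + ((if γ = ρ then f (n + γ - ρ + (n + γ - ρ)) else 0) +
    (if γ < ρ then f (n + γ - ρ + (n + γ - ρ)) - f (n + γ - ρ + 1 + (n + γ - ρ + 1))
      - ∑ i ∈ Ico (γ+2) (ρ + 1), (f (n + γ - ρ + 1 + mf n aV i) - f (n + γ - ρ + mf n aV i))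
      + f (n + γ - ρ + mf n aV (ρ + 1)) else 0)) := by
    rw [S.haV, S.hbV]
    rcases lt_trichotomy γ ρ with h | h | h
    · rw [if_neg (by omega), if_pos h]
      rw [show Icc (γ+1) (ρ+1) = Ico (γ+1) (ρ+1+1) by ext; simp,
        show Icc (γ+1) ρ = Ico (γ+1) (ρ+1) by ext; simp,
        sum_Ico_succ_top (by omega), sum_eq_sum_Ico_succ_bot (by omega),
        sum_eq_sum_Ico_succ_bot (a := γ+1) (b := ρ+1) (by omega), S.mc, S.mc',
        S.mn (ρ+1) (by omega), add_comm (mf n aV (ρ+1))]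
      have e : ∀ i ∈ Ico (γ+1+1) (ρ+1), f (mf n bV i + (n+γ-ρ)) = f (mf n aV i + (n+γ-ρ+1)) - (f (n + γ - ρ + 1 + mf n aV i) - f (n + γ - ρ + mf n aV i)) := by
        intro i hi
        rw [mem_Ico] at hi
        rw [S.mn i (by omega), add_comm (mf n aV i), add_comm (mf n aV i)]; ring
      rw [sum_congr rfl e, sum_sub_distrib]
      ring
    · subst h
      simp [S.mc']
    · rw [if_neg (by omega), if_neg (by omega), Icc_eq_empty (by omega), Icc_eq_empty (by omega)]; simp
  rw [sum_congr rfl h1, sum_congr rfl h2, sum_sub_distrib, h3, h1']; ring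

lemma Stp.main {n L : ℕ} {a aV b bV : ℕ → ℕ} {ρ γ : ℕ} (S : Stp n L a aV b bV ρ γ) (f : ℤ → ℤ) : AA f n b + BB f n L bV - (AA f n a + BB f n L aV) =
    CC f n b + DD f n b - (CC f n a + DD f n a) := by
  have hA := S.A f
  have hB := S.B f
  have hC := S.C f
  have hD := S.D f
  rcases lt_trichotomy γ ρ with h | h | h
  · rw [if_neg (by omega)] at hA
    rw [if_pos (by omega), if_neg (by omega), if_pos h] at hB
    have hW := S.pa.sum_window (fun t => f (n + γ - ρ + 1 + t) - f (n + γ - ρ + t)) (γ+1) (ρ+1) (by omega) (by omega)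
    have hle : aV (ρ+1) ≤ ρ := by
      have := S.pa.monoV (γ+1) (ρ+1) (by omega) (by omega)
      rw [S.haV] at this; exact this
    rw [sum_eq_sum_Ico_succ_bot (by omega), S.haV, S.mc, tele] at hW
    · rw [n_sum_split _ 0 (aV (ρ+1)) ρ (by omega) hle] at hA hD
      have e1 : ∀ i ∈ Ioc 0 (aV (ρ+1)), (if ρ + 1 ≤ a i then (f (n + γ - ρ + 1 + lf n a i) - f (n + γ - ρ + lf n a i)) else 0) = (f (n + γ - ρ + 1 + lf n a i) - f (n + γ - ρ + lf n a i)) := by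
        intro i hi
        rw [mem_Ioc] at hi
        rw [if_pos ((S.pa.conj i (ρ+1) (by omega) (by omega)).2 hi.2)]
      have e2 : ∀ i ∈ Ioc (aV (ρ+1)) ρ, (if ρ + 1 ≤ a i then (f (n + γ - ρ + 1 + lf n a i) - f (n + γ - ρ + lf n a i)) else 0) = 0 := by
        intro i hi
        rw [mem_Ioc] at hi
        rw [if_neg ((S.pa.conj i (ρ+1) (by omega) (by omega)).not.2 (by omega))]
      rw [sum_congr rfl e1, sum_congr rfl e2, sum_const_zero] at hA
      rw [show γ + 1 + 1 = γ + 2 from rfl] at hW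
      have e3 : (n + γ - ρ + (n + γ - ρ + 1) : ℤ) = n + γ - ρ + 1 + (n + γ - ρ) := by ring
      rw [e3] at hW
      linarith
    · simp [mf]; omega
  · rw [if_neg (by omega)] at hA
    rw [if_pos (by omega), if_pos h, if_neg (by omega)] at hB
    have e1 : ∀ i ∈ Ioc 0 ρ, (if ρ + 1 ≤ a i then (f (n + γ - ρ + 1 + lf n a i) - f (n + γ - ρ + lf n a i)) else 0) = (f (n + γ - ρ + 1 + lf n a i) - f (n + γ - ρ + lf n a i)) := by
      intro i hi
      rw [mem_Ioc] at hi
      have := S.pb.mono i (ρ+1) (by omega) (by omega)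
      rw [S.br, S.ne i (by omega)] at this
      rw [if_pos (by omega)]
    rw [sum_congr rfl e1] at hA
    linarith
  · rw [if_pos (by omega)] at hA
    rw [if_neg (by omega), if_neg (by omega), if_neg (by omega)] at hB
    have e1 : ∀ i ∈ Ioc 0 ρ, (if ρ + 1 ≤ a i then (f (n + γ - ρ + 1 + lf n a i) - f (n + γ - ρ + lf n a i)) else 0) = (f (n + γ - ρ + 1 + lf n a i) - f (n + γ - ρ + lf n a i)) := by
      intro i hi
      rw [mem_Ioc] at hi
      have := S.pb.mono i (ρ+1) (by omega) (by omega)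
      rw [S.br, S.ne i (by omega)] at this
      rw [if_pos (by omega)]
    rw [sum_congr rfl e1] at hA
    linarith


def EE (g : ℤ → ℤ) (n : ℕ) (lam lamV : ℕ → ℕ) : ℤ :=
  ∑ i ∈ Ioc 0 n, if i ≤ lam i then g (mf n lamV i) else g (lf n lam i)

lemma Stp.E {n L : ℕ} {a aV b bV : ℕ → ℕ} {ρ γ : ℕ} (S : Stp n L a aV b bV ρ γ) (g : ℤ → ℤ) :
    EE g n b bV = EE g n a aV := by
  unfold EE
  rcases lt_or_ge γ ρ with h | h
  · have key : ∀ i ∈ Ioc 0 n, (if i ≤ b i then g (mf n bV i) else g (lf n b i)) =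
      (if i ≤ a i then g (mf n aV i) else g (lf n a i)) +
      ((if ρ + 1 = i then g (n + γ - ρ + 1) - g (n + γ - ρ) else 0) -
      (if γ + 1 = i then g (n + γ - ρ + 1) - g (n + γ - ρ) else 0)) := by
      intro i hi
      by_cases h1 : ρ + 1 = i
      · subst h1
        rw [if_neg (by rw [S.br]; omega), if_neg (by rw [S.ar]; omega), if_pos rfl,
          if_neg (by omega), S.lr, S.lr']
        ring
      · by_cases h2 : γ + 1 = i
        · subst h2
          have h3 := S.pb.mono (γ+1) (ρ+1) (by omega) (by omega)
          rw [S.br] at h3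
          have h4 := S.ne (γ+1) (by omega)
          rw [if_pos h3, if_pos (by omega), if_neg h1, if_pos rfl, S.mc, S.mc']
          ring
        · rw [if_neg h1, if_neg h2, S.ne i (by omega), S.ln i (by omega), S.mn i (by omega)]
          ring
    have := S.hr
    rw [sum_congr rfl key, sum_add_distrib, sum_sub_distrib, sum_ite_eq, sum_ite_eq, if_pos, if_pos]
    · ring
    · simp; omega
    · simp; omega
  · refine sum_congr rfl fun i hi => ?_
    by_cases h1 : ρ + 1 = i
    · subst h1
      rw [S.br, S.ar, if_pos (by omega)]
      rcases eq_or_lt_of_le h with h | h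
      · subst h
        rw [if_neg (by omega), S.mc', S.lr]
      · rw [if_pos (by omega), S.mn _ (by omega)]
    · rw [S.ne i (by omega), S.ln i (by omega)]
      by_cases h2 : γ + 1 = i
      · subst h2
        have := S.lt (γ+1) (by omega)
        rw [if_neg (by omega), if_neg (by omega)]
      · rw [S.mn i (by omega)]

lemma Pt.exists_stp {n L : ℕ} {b bV : ℕ → ℕ} (H : Pt n b bV) (hL : b 1 ≤ L) (h0 : 1 ≤ bV 1) :
    ∃ a aV ρ γ, Stp n L a aV b bV ρ γ := by
  obtain ⟨ρ, hρ⟩ : ∃ ρ, bV 1 = ρ + 1 := ⟨bV 1 - 1, by omega⟩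
  have hb : 1 ≤ b (ρ+1) := (H.conj (ρ+1) 1 (by omega) le_rfl).2 (by omega)
  obtain ⟨γ, hγ⟩ : ∃ γ, b (ρ+1) = γ + 1 := ⟨b (ρ+1) - 1, by omega⟩
  have hz : ∀ i, ρ + 1 < i → b i = 0 := by
    intro i hi
    have := (H.conj i 1 (by omega) le_rfl).not.2 (by omega)
    omega
  have hV : bV (γ+1) = ρ + 1 := H.V_eq (ρ+1) (γ+1) (by omega) (by rw [hz _ (by omega)]; omega) (by omega)
  have hn := H.V_le 1 le_rfl
  have h1 := H.mono 1 (ρ+1) le_rfl (by omega)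
  refine ⟨Function.update b (ρ+1) γ, Function.update bV (γ+1) ρ, ρ, γ, ⟨⟨?_, ?_, ?_⟩, H, by omega, by omega, hγ, by simp, ?_, ?_, hV, by simp, ?_⟩⟩
  · intro i j hi hij
    have m1 := H.mono i j hi hij
    simp only [Function.update_apply]
    split_ifs with c1 c2 c2
    · omega
    · subst c1; omega
    · have := hz j (by omega); omega
    · omega
  · intro i hi
    rw [Function.update_of_ne (by omega)]
    exact H.zero i hi
  · intro i j hi hj
    have cj := H.conj i j hi hj
    simp only [Function.update_apply]
    split_ifs with c1 c2 c2
    · omega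
    · subst c1; omega
    · subst c2; omega
    · exact cj
  · intro i hi
    rw [Function.update_of_ne (by omega)]
  · intro i hi
    rw [Function.update_of_ne (by omega)]; exact hz i hi
  · intro i hi
    rw [Function.update_of_ne (by omega)]

lemma Pt.full (n L : ℕ) (f : ℤ → ℤ) : ∀ N : ℕ, ∀ b bV : ℕ → ℕ, Pt n b bV → b 1 ≤ L →
    ∑ i ∈ Ioc 0 n, b i = N →
    AA f n b + BB f n L bV + DD f n (fun _ => 0) = CC f n b + DD f n b ∧
    EE f n b bV = ∑ i ∈ Ioc 0 n, f (n + 1 - i) := by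
  intro N
  induction N with
  | zero =>
    intro b bV H hL h
    have hz : ∀ i, 1 ≤ i → b i = 0 := by
      intro i hi
      rcases le_or_gt i n with h1 | h1
      · exact (sum_eq_zero_iff.1 h) i (by simp; omega)
      · exact H.zero i h1
    have hz' : ∀ i, 1 ≤ i → bV i = 0 := by
      intro i hi
      by_contra hc
      have := (H.conj 1 i le_rfl hi).2 (by omega)
      rw [hz 1 le_rfl] at this; omega
    have hA : AA f n b = 0 := sum_eq_zero fun i hi => by
      rw [mem_Ioc] at hi
      rw [hz i (by omega)]; simp
    have hB : BB f n L bV = 0 := sum_eq_zero fun i hi => by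
      rw [mem_Ioc] at hi
      rw [hz' i (by omega), Icc_eq_empty (by omega)]; simp
    have hC : CC f n b = 0 := sum_eq_zero fun i hi => by
      rw [mem_Ioc] at hi
      rw [hz i (by omega)]; simp
    have hD : DD f n (fun _ => 0) = DD f n b := sum_congr rfl fun i hi => sum_congr rfl fun j hj => by
      rw [mem_Ioc] at hi hj
      simp [lf, hz i (by omega), hz j (by omega)]
    refine ⟨by rw [hA, hB, hC, hD]; ring, sum_congr rfl fun i hi => ?_⟩
    rw [mem_Ioc] at hi
    simp only [lf]
    rw [hz i (by omega), if_neg (by omega)]; simp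
  | succ N ih =>
    intro b bV H hL h
    have h0 : 1 ≤ bV 1 := by
      by_contra hc
      have : ∑ i ∈ Ioc 0 n, b i = 0 := sum_eq_zero fun i hi => by
        rw [mem_Ioc] at hi
        have := (H.conj i 1 (by omega) le_rfl).not.2 (by omega)
        omega
      omega
    obtain ⟨a, aV, ρ, γ, S⟩ := H.exists_stp hL h0
    have hs : ∑ i ∈ Ioc 0 n, b i = ∑ i ∈ Ioc 0 n, a i + 1 := by
      have key : ∀ i ∈ Ioc 0 n, b i = a i + if ρ + 1 = i then 1 else 0 := by
        intro i hi
        split_ifs with h1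
        · subst h1; rw [S.br, S.ar]
        · rw [S.ne i (by omega)]; ring
      have := S.hr
      rw [sum_congr rfl key, sum_add_distrib, sum_ite_eq, if_pos]
      simp; omega
    have h1 : a 1 ≤ L := by
      by_cases h1 : 1 = ρ + 1
      · have := S.ar; have := S.hc
        rw [h1]; omega
      · rw [← S.ne 1 h1]; exact hL
    obtain ⟨i1, i2⟩ := ih a aV S.pa h1 (by omega)
    have := S.main f
    refine ⟨by linarith, by rw [S.E, i2]⟩

/-- transfer from sums to products -/
lemma transfer {ι κ : Type*} (S : Finset ι) (T : Finset κ) (u : ι → ℤ) (v : κ → ℤ)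
    (h : ∀ f : ℤ → ℤ, ∑ x ∈ S, f (u x) = ∑ y ∈ T, f (v y)) (F : ℤ → ℂ) :
    ∏ x ∈ S, F (u x) = ∏ y ∈ T, F (v y) := by
  have hm : S.1.map u = T.1.map v := by
    ext t
    have := h (fun x => if t = x then 1 else 0)
    simp only [Multiset.count_map, Finset.sum_boole] at this ⊢
    exact_mod_cast this
  have : ((S.1.map u).map F).prod = ((T.1.map v).map F).prod := by rw [hm]
  simpa [Multiset.map_map] using this

lemma Pt.prodE {n : ℕ} {b bV : ℕ → ℕ} (H : Pt n b bV) (F : ℤ → ℂ) :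
    ∏ i ∈ Ioc 0 n, (if i ≤ b i then F (mf n bV i) else F (lf n b i)) =
      ∏ i ∈ Ioc 0 n, F (n + 1 - i) := by
  have := transfer (Ioc 0 n) (Ioc 0 n) (fun i => if i ≤ b i then (mf n bV i) else (lf n b i))
    (fun i => n + 1 - i) (fun f => by
      have := (Pt.full n (b 1) f _ b bV H le_rfl rfl).2
      rw [← this, EE]
      exact sum_congr rfl fun i _ => by split_ifs <;> rfl) F
  rw [← this]
  exact prod_congr rfl fun i _ => by split_ifs <;> rfl

lemma Pt.prodA {n L : ℕ} {b bV : ℕ → ℕ} (H : Pt n b bV) (hL : b 1 ≤ L) (F : ℤ → ℂ) :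
    (∏ i ∈ Ioc 0 n, ∏ j ∈ Ioc i (b i), F (lf n b i + lf n b j)) *
    (∏ j ∈ Ioc 0 L, ∏ i ∈ Icc j (bV j), F (mf n bV i + mf n bV j)) *
    (∏ i ∈ Ioc 0 n, ∏ j ∈ Ioc i n, F (lf n (fun _ => 0) i + lf n (fun _ => 0) j)) =
    (∏ i ∈ Ioc 0 n, ∏ x ∈ Ioc 0 (b i), F (n + 1 - i + x)) *
    (∏ i ∈ Ioc 0 n, ∏ j ∈ Ioc i n, F (lf n b i + lf n b j)) := by
  have := transfer
    ((((Ioc 0 n).sigma fun i => Ioc i (b i)).disjSum ((Ioc 0 L).sigma fun j => Icc j (bV j))).disjSum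
      ((Ioc 0 n).sigma fun i => Ioc i n))
    (((Ioc 0 n).sigma fun i => Ioc 0 (b i)).disjSum ((Ioc 0 n).sigma fun i => Ioc i n))
    (Sum.elim (Sum.elim (fun p => lf n b p.1 + lf n b p.2) (fun p => mf n bV p.2 + mf n bV p.1))
      (fun p => lf n (fun _ => 0) p.1 + lf n (fun _ => 0) p.2))
    (Sum.elim (fun p => (n:ℤ) + 1 - p.1 + p.2) (fun p => lf n b p.1 + lf n b p.2))
    (fun f => by
      have := (Pt.full n L f _ b bV H hL rfl).1
      simpa [AA, BB, CC, DD, sum_disjSum, sum_sigma] using this) F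
  simpa [prod_disjSum, prod_sigma] using this

lemma cells_prod (lam : ℕ → ℕ) (n : ℕ) (hmono : ∀ i j : ℕ, 1 ≤ i → i ≤ j → lam j ≤ lam i)
    (G : ℕ × ℕ → ℂ) :
    ∏ p ∈ cells lam n, G p = ∏ i ∈ Ioc 0 n, ∏ j ∈ Ioc 0 (lam i), G (i, j) := by
  rw [cells, prod_filter, prod_product, show Icc 1 n = Ioc 0 n by ext; simp; omega]
  refine prod_congr rfl fun i hi => ?_
  rw [mem_Ioc] at hi
  rw [← prod_filter]
  refine prod_congr ?_ fun _ _ => rfl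
  have := hmono 1 i le_rfl (by omega)
  ext j; simp; omega

lemma pairs_prod (n : ℕ) (G : ℕ × ℕ → ℂ) :
    ∏ p ∈ (Finset.Icc 1 n ×ˢ Finset.Icc 1 n).filter (fun p => p.1 < p.2), G p
      = ∏ i ∈ Ioc 0 n, ∏ j ∈ Ioc i n, G (i, j) := by
  rw [prod_filter, prod_product, show Icc 1 n = Ioc 0 n by ext; simp; omega]
  refine prod_congr rfl fun i hi => ?_
  rw [mem_Ioc] at hi
  rw [← prod_filter]
  refine prod_congr ?_ fun _ _ => rfl
  ext j; simp; omega

noncomputable def cc (s : ℂ) (k : ℤ) : ℂ := s ^ k + s ^ (-k)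

lemma qint_two (s : ℂ) (hs : s ≠ 0) (k : ℤ) : qint s (2 * k) = qint s k * cc s k := by
  have h1 : s ^ (2 * k) = s ^ k * s ^ k := by rw [two_mul, zpow_add₀ hs]
  have h2 : s ^ (-(2 * k)) = s ^ (-k) * s ^ (-k) := by
    rw [← zpow_add₀ hs]; congr 1; ring
  rw [qint, qint, cc, h1, h2]; ring

lemma qintA_eq (s : ℂ) (hs : s ≠ 0) (N m : ℤ) : qintA (-s ^ N) s m = - qint s (N + m) := by
  have h1 : s ^ (N + m) = s ^ N * s ^ m := zpow_add₀ hs _ _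
  have h2 : s ^ (-(N + m)) = (s ^ N)⁻¹ * s ^ (-m) := by
    rw [← zpow_neg, ← zpow_add₀ hs]; congr 1; ring
  rw [qintA, qint, h1, h2, inv_neg]; ring

lemma diag_eq (s : ℂ) (hs : s ≠ 0) (x y : ℤ) :
    - qint s (x + y) + qint s (x - y) = - (qint s y * cc s x) := by
  have h1 : s ^ (x + y) = s ^ x * s ^ y := zpow_add₀ hs _ _
  have h2 : s ^ (-(x + y)) = s ^ (-x) * s ^ (-y) := by
    rw [← zpow_add₀ hs]; congr 1; ring
  have h3 : s ^ (x - y) = s ^ x * s ^ (-y) := by rw [← zpow_add₀ hs]; rfl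
  have h4 : s ^ (-(x - y)) = s ^ (-x) * s ^ y := by
    rw [← zpow_add₀ hs]; congr 1; ring
  rw [qint, qint, qint, cc, h1, h2, h3, h4]; ring

lemma qint_ne (s : ℂ) (hs : s ≠ 0) (h1 : s ^ 2 ≠ 1) (m : ℕ) (hm : s ^ (2 * m) ≠ 1) :
    qint s m ≠ 0 := by
  have key : ∀ k : ℕ, s ^ (2 * k) ≠ 1 → s ^ (k:ℤ) - s ^ (-(k:ℤ)) ≠ 0 := by
    intro k hk h
    apply hk
    have h2 : s ^ (k:ℤ) = s ^ (-(k:ℤ)) := sub_eq_zero.1 h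
    have : s ^ (k:ℤ) * s ^ (k:ℤ) = 1 := by
      nth_rw 2 [h2]
      rw [← zpow_add₀ hs]; simp
    rw [two_mul, pow_add]
    simpa using this
  refine div_ne_zero (key m hm) ?_
  simpa using key 1 (by simpa using h1)

noncomputable def WW (s : ℂ) (n : ℕ) (lam lamV : ℕ → ℕ) (i j : ℕ) : ℂ :=
  if i = j then qint s (mf n lamV j) * cc s (lf n lam j)
  else if i < j then qint s (lf n lam i + lf n lam j) else qint s (mf n lamV i + mf n lamV j)

lemma wenzl_eq (n : ℕ) (s : ℂ) (hs : s ≠ 0) {lam lamV : ℕ → ℕ} (H : Pt n lam lamV) :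
    wenzl (-s ^ (2 * (n : ℤ) + 1)) s lam lamV n = (-1 : ℂ) ^ (∑ i ∈ Ioc 0 n, lam i) *
      ((∏ i ∈ Ioc 0 n, ∏ j ∈ Ioc 0 (lam i), WW s n lam lamV i j) /
      ∏ i ∈ Ioc 0 n, ∏ j ∈ Ioc 0 (lam i), qint s (lf n lam i - mf n lamV j)) := by
  rw [wenzl, ← prod_ite, cells_prod _ _ H.mono, ← prod_div_distrib, ← prod_pow_eq_pow_sum,
    ← prod_mul_distrib]
  refine prod_congr rfl fun i hi => ?_
  rw [← prod_div_distrib]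
  have : (-1 : ℂ) ^ (lam i) = ∏ j ∈ Ioc 0 (lam i), (-1 : ℂ) := by simp
  rw [this, ← prod_mul_distrib]
  refine prod_congr rfl fun j hj => ?_
  have hh : hookl lam lamV (i, j) = lf n lam i - mf n lamV j := by
    simp only [hookl, lf, mf]; ring
  simp only [WW, hh]
  split_ifs with h1 h2
  · subst h1
    have := diag_eq s hs (lf n lam i) (mf n lamV i)
    rw [qintA_eq s hs, show 2 * (n:ℤ) + 1 + (lam i - lamV i) = lf n lam i + mf n lamV i by
      simp only [lf, mf]; ring, this]
    ring
  · rw [qintA_eq s hs, dcell, if_pos (by simp; omega)]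
    rw [show 2 * (n:ℤ) + 1 + ((lam (i,j).1 : ℤ) + lam (i,j).2 - (i,j).1 - (i,j).2 + 1) = lf n lam i + lf n lam j by
      simp only [lf]; ring]
    ring
  · rw [qintA_eq s hs, dcell, if_neg (by simp; omega)]
    rw [show 2 * (n:ℤ) + 1 + (-(lamV (i,j).1 : ℤ) - lamV (i,j).2 + (i,j).1 + (i,j).2 - 1) = mf n lamV i + mf n lamV j by
      simp only [mf]; ring]
    ring

lemma WW_prod (n : ℕ) (s : ℂ) (hs : s ≠ 0) {lam lamV : ℕ → ℕ} (H : Pt n lam lamV) :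
    (∏ i ∈ Ioc 0 n, ∏ j ∈ Ioc 0 (lam i), WW s n lam lamV i j) *
      (∏ i ∈ Ioc 0 n, if i ≤ lam i then cc s (mf n lamV i) else 1) =
    (∏ i ∈ Ioc 0 n, ∏ j ∈ Ioc i (lam i), qint s (lf n lam i + lf n lam j)) *
    (∏ j ∈ Ioc 0 (lam 1), ∏ i ∈ Icc j (lamV j), qint s (mf n lamV i + mf n lamV j)) *
    (∏ i ∈ Ioc 0 n, if i ≤ lam i then cc s (lf n lam i) else 1) := by
  have hB : (∏ j ∈ Ioc 0 (lam 1), ∏ i ∈ Icc j (lamV j), qint s (mf n lamV i + mf n lamV j)) =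
      ∏ i ∈ Ioc 0 n, ∏ j ∈ (Ioc 0 (lam i)).filter (fun j => j ≤ i), qint s (mf n lamV i + mf n lamV j) := by
    refine prod_comm' fun j i => ?_
    simp only [mem_Ioc, mem_Icc, mem_filter]
    constructor
    · rintro ⟨⟨a, b⟩, c, d⟩
      have h1 := (H.conj i j (by omega) (by omega)).2 d
      have h2 := H.V_le j (by omega)
      omega
    · rintro ⟨⟨⟨a, b⟩, c⟩, d, e⟩
      have h1 := (H.conj i j (by omega) (by omega)).1 b
      have h2 := H.mono 1 i le_rfl (by omega)
      omega
  rw [hB, ← prod_mul_distrib, ← prod_mul_distrib, ← prod_mul_distrib]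
  refine prod_congr rfl fun i hi => ?_
  rw [mem_Ioc] at hi
  have e1 : ∀ x : ℂ, (if i ≤ lam i then x else 1) = ∏ j ∈ Ioc 0 (lam i), if i = j then x else 1 := by
    intro x
    rw [prod_ite_eq]
    have : i ∈ Ioc 0 (lam i) ↔ i ≤ lam i := by simp; omega
    simp only [this]
  have e2 : Ioc i (lam i) = (Ioc 0 (lam i)).filter (fun j => i < j) := by ext; simp; omega
  rw [e1, e1, e2, prod_filter, prod_filter, ← prod_mul_distrib, ← prod_mul_distrib, ← prod_mul_distrib]
  refine prod_congr rfl fun j hj => ?_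
  rw [WW]
  rcases lt_trichotomy i j with h | h | h
  · rw [if_neg (by omega), if_pos h, if_neg (by omega), if_pos h, if_neg (by omega), if_neg (by omega)]
    ring
  · subst h
    have := qint_two s hs (mf n lamV i)
    simp only [if_true, lt_irrefl, if_false, le_refl]
    rw [← two_mul, this]; ring
  · rw [if_neg (by omega), if_neg (by omega), if_neg (by omega), if_neg (by omega), if_pos (by omega), if_neg (by omega)]
    ring

lemma reflect (F : ℤ → ℂ) (l : ℤ) : ∏ t ∈ Ico 1 l, F (l - t) = ∏ t ∈ Ico 1 l, F t := by
  refine prod_nbij' (fun t => l - t) (fun t => l - t) ?_ ?_ ?_ ?_ ?_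
  · intro t; simp; omega
  · intro t; simp; omega
  · intro t _; ring
  · intro t _; ring
  · intro t _; rfl

lemma Pt.hookall {n : ℕ} {lam lamV : ℕ → ℕ} (H : Pt n lam lamV) (F : ℤ → ℂ) :
    (∏ i ∈ Ioc 0 n, ∏ j ∈ Ioc 0 (lam i), F (lf n lam i - mf n lamV j)) *
    (∏ i ∈ Ioc 0 n, ∏ j ∈ Ioc i n, F (lf n lam i - lf n lam j)) =
    ∏ i ∈ Ioc 0 n, ∏ t ∈ Ico 1 (lf n lam i), F t := by
  rw [← prod_mul_distrib]
  refine prod_congr rfl fun i hi => ?_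
  rw [mem_Ioc] at hi
  rw [← reflect]
  exact H.hookprod (fun t => F (lf n lam i - t)) i (by omega) hi.2

/-- The symplectic specialization `α = -s^{2n+1}` of
Wenzl's quantum dimension, for a partition `λ = (λ_1,…,λ_n)` with at most `n` parts. -/
theorem wenzl_symplectic (n : ℕ) (hn : 1 ≤ n) (s : ℂ) (hs : s ≠ 0)
    (lam lamV : ℕ → ℕ)
    (hmono : ∀ i j : ℕ, 1 ≤ i → i ≤ j → lam j ≤ lam i)
    (hN : ∀ i, n < i → lam i = 0)
    (hconj : ∀ i j : ℕ, 1 ≤ i → 1 ≤ j → (j ≤ lam i ↔ i ≤ lamV j))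
    (hroot : ∀ m : ℕ, 1 ≤ m → m ≤ max (2 * n) (lam 1 + lamV 1 - 1) → s ^ (2 * m) ≠ 1) :
    wenzl (-s ^ (2 * (n : ℤ) + 1)) s lam lamV n =
      (-1 : ℂ) ^ (∑ i ∈ Finset.Icc 1 n, lam i) *
      (∏ j ∈ Finset.Icc 1 n,
        qint s (2 * n + 2 + 2 * (lam j : ℤ) - 2 * j) / qint s (2 * n + 2 - 2 * (j : ℤ))) *
      ∏ p ∈ (Finset.Icc 1 n ×ˢ Finset.Icc 1 n).filter (fun p => p.1 < p.2),
        qint s (2 * n + 2 + (lam p.1 : ℤ) - p.1 + (lam p.2 : ℤ) - p.2) *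
          qint s ((lam p.1 : ℤ) - p.1 - (lam p.2 : ℤ) + p.2) /
        (qint s (2 * n + 2 - (p.1 : ℤ) - p.2) * qint s ((p.2 : ℤ) - p.1)) := by
  have H : Pt n lam lamV := ⟨hmono, hN, hconj⟩
  have H0 : Pt n (fun _ => 0) (fun _ => 0) := ⟨by simp, by simp, by intros; omega⟩
  have hs2 : s ^ 2 ≠ 1 := by simpa using hroot 1 le_rfl (by omega)
  have ne : ∀ m : ℤ, 1 ≤ m → m ≤ max (2 * n) (lam 1 + lamV 1 - 1) → qint s m ≠ 0 := by
    intro m h1 h2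
    lift m to ℕ using by omega
    exact qint_ne s hs hs2 m (hroot m (by omega) (by omega))
  have cne : ∀ k : ℤ, 1 ≤ k → k ≤ n → cc s k ≠ 0 := by
    intro k h1 h2 h
    apply ne (2 * k) (by omega) (by omega)
    rw [qint_two s hs, h, mul_zero]
  rw [wenzl_eq n s hs H, pairs_prod, show Icc 1 n = Ioc 0 n by ext; simp; omega, mul_assoc]
  congr 1
  have g1 : ∀ j ∈ Ioc 0 n, qint s (2 * n + 2 + 2 * (lam j : ℤ) - 2 * j) / qint s (2 * n + 2 - 2 * (j : ℤ))
      = (qint s (lf n lam j) * cc s (lf n lam j)) / (qint s (n + 1 - j) * cc s (n + 1 - j)) := by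
    intro j _
    rw [← qint_two s hs, ← qint_two s hs]
    congr 2
    · simp only [lf]; ring
    · ring
  have g2 : ∀ i ∈ Ioc 0 n, ∏ j ∈ Ioc i n, qint s (2 * n + 2 + (lam i : ℤ) - i + (lam j : ℤ) - j) *
          qint s ((lam i : ℤ) - i - (lam j : ℤ) + j) /
        (qint s (2 * n + 2 - (i : ℤ) - j) * qint s ((j : ℤ) - i)) =
      ((∏ j ∈ Ioc i n, qint s (lf n lam i + lf n lam j)) * ∏ j ∈ Ioc i n, qint s (lf n lam i - lf n lam j)) /
      ((∏ j ∈ Ioc i n, qint s (lf n (fun _ => 0) i + lf n (fun _ => 0) j)) *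
        ∏ j ∈ Ioc i n, qint s (lf n (fun _ => 0) i - lf n (fun _ => 0) j)) := by
    intro i _
    rw [← prod_mul_distrib, ← prod_mul_distrib, ← prod_div_distrib]
    refine prod_congr rfl fun j _ => ?_
    congr 3 <;> simp only [lf] <;> push_cast <;> ring
  rw [prod_congr rfl g1, prod_congr rfl g2]
  simp only [prod_div_distrib, prod_mul_distrib]
  have hH : (∏ i ∈ Ioc 0 n, ∏ j ∈ Ioc 0 (lam i), qint s (lf n lam i - mf n lamV j)) ≠ 0 := by
    refine prod_ne_zero_iff.2 fun i hi => prod_ne_zero_iff.2 fun j hj => ?_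
    rw [mem_Ioc] at hi hj
    have h1 := (hconj i j (by omega) (by omega)).1 hj.2
    have h2 := hmono 1 i le_rfl (by omega)
    have h3 := H.monoV 1 j le_rfl (by omega)
    exact ne _ (by simp only [lf, mf]; omega) (by simp only [lf, mf]; omega)
  have hD0 : (∏ i ∈ Ioc 0 n, ∏ j ∈ Ioc i n, qint s (lf n (fun _ => 0) i + lf n (fun _ => 0) j)) ≠ 0 := by
    refine prod_ne_zero_iff.2 fun i hi => prod_ne_zero_iff.2 fun j hj => ?_
    rw [mem_Ioc] at hi hj
    exact ne _ (by simp only [lf]; omega) (by simp only [lf]; omega)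
  have hV0 : (∏ i ∈ Ioc 0 n, ∏ j ∈ Ioc i n, qint s (lf n (fun _ => 0) i - lf n (fun _ => 0) j)) ≠ 0 := by
    refine prod_ne_zero_iff.2 fun i hi => prod_ne_zero_iff.2 fun j hj => ?_
    rw [mem_Ioc] at hi hj
    exact ne _ (by simp only [lf]; omega) (by simp only [lf]; omega)
  have hFk : (∏ i ∈ Ioc 0 n, qint s (n + 1 - i)) ≠ 0 := by
    refine prod_ne_zero_iff.2 fun i hi => ?_
    rw [mem_Ioc] at hi
    exact ne _ (by omega) (by omega)
  have hck : (∏ i ∈ Ioc 0 n, cc s (n + 1 - i)) ≠ 0 := by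
    refine prod_ne_zero_iff.2 fun i hi => ?_
    rw [mem_Ioc] at hi
    exact cne _ (by omega) (by omega)
  have hdm : (∏ i ∈ Ioc 0 n, if i ≤ lam i then cc s (mf n lamV i) else 1) ≠ 0 := by
    refine prod_ne_zero_iff.2 fun i hi => ?_
    rw [mem_Ioc] at hi
    split_ifs with h
    · have h1 := (hconj i i (by omega) (by omega)).1 h
      have h2 := H.V_le i (by omega)
      exact cne _ (by simp only [mf]; omega) (by simp only [mf]; omega)
    · exact one_ne_zero
  have i1 := WW_prod n s hs H
  have i2 : (∏ i ∈ Ioc 0 n, if i ≤ lam i then cc s (lf n lam i) else 1) * ∏ i ∈ Ioc 0 n, cc s (n + 1 - i)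
      = (∏ i ∈ Ioc 0 n, if i ≤ lam i then cc s (mf n lamV i) else 1) * ∏ i ∈ Ioc 0 n, cc s (lf n lam i) := by
    rw [← H.prodE (cc s), ← prod_mul_distrib, ← prod_mul_distrib]
    refine prod_congr rfl fun i _ => ?_
    split_ifs <;> ring
  have i3 := H.prodA le_rfl (qint s)
  have i4 := H.hookall (qint s)
  have i5 := H0.hookall (qint s)
  have i6 : (∏ i ∈ Ioc 0 n, ∏ t ∈ Ico 1 (lf n lam i), qint s t) * ∏ i ∈ Ioc 0 n, qint s (lf n lam i) =
      (∏ i ∈ Ioc 0 n, ∏ t ∈ Ico 1 (lf n (fun _ => 0) i), qint s t) * (∏ i ∈ Ioc 0 n, qint s (n + 1 - i)) *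
      ∏ i ∈ Ioc 0 n, ∏ x ∈ Ioc 0 (lam i), qint s (n + 1 - i + x) := by
    rw [← prod_mul_distrib, ← prod_mul_distrib, ← prod_mul_distrib]
    refine prod_congr rfl fun i hi => ?_
    rw [mem_Ioc] at hi
    have e : lf n (fun _ => 0) i = n + 1 - i := by simp [lf]
    have e' : lf n lam i + 1 = n + 1 - i + lam i + 1 := by simp only [lf]; ring
    rw [e, z_prod_up _ _ _ _ (by omega), ← z_prod_single (qint s) (lf n lam i),
      ← z_prod_single (qint s) (n + 1 - i), ← z_prod_split, ← z_prod_split, e', Nat.cast_zero, add_zero,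
      ← z_prod_split]
    all_goals omega
  simp only [Ioc_self, prod_empty, prod_const_one, one_mul] at i5
  rw [← i4, ← i5] at i6
  rw [← mul_div_mul_comm, div_eq_div_iff hH (mul_ne_zero (mul_ne_zero hFk hck) (mul_ne_zero hD0 hV0))]
  generalize (∏ i ∈ Ioc 0 n, ∏ j ∈ Ioc 0 (lam i), WW s n lam lamV i j) = NP at *
  generalize (∏ i ∈ Ioc 0 n, if i ≤ lam i then cc s (mf n lamV i) else 1) = dm at *
  generalize (∏ i ∈ Ioc 0 n, if i ≤ lam i then cc s (lf n lam i) else 1) = dl at *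
  generalize (∏ i ∈ Ioc 0 n, cc s (n + 1 - i)) = ck at *
  generalize (∏ i ∈ Ioc 0 n, cc s (lf n lam i)) = cl at *
  generalize (∏ i ∈ Ioc 0 n, qint s (n + 1 - i)) = Fk at *
  generalize (∏ i ∈ Ioc 0 n, qint s (lf n lam i)) = Fl at *
  generalize (∏ i ∈ Ioc 0 n, ∏ j ∈ Ioc i (lam i), qint s (lf n lam i + lf n lam j)) = AP at *
  generalize (∏ j ∈ Ioc 0 (lam 1), ∏ i ∈ Icc j (lamV j), qint s (mf n lamV i + mf n lamV j)) = BP at *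
  generalize (∏ i ∈ Ioc 0 n, ∏ x ∈ Ioc 0 (lam i), qint s (n + 1 - i + x)) = CP at *
  generalize (∏ i ∈ Ioc 0 n, ∏ j ∈ Ioc i n, qint s (lf n lam i + lf n lam j)) = D at *
  generalize (∏ i ∈ Ioc 0 n, ∏ j ∈ Ioc i n, qint s (lf n lam i - lf n lam j)) = V at *
  generalize (∏ i ∈ Ioc 0 n, ∏ j ∈ Ioc 0 (lam i), qint s (lf n lam i - mf n lamV j)) = Hk at *
  generalize (∏ i ∈ Ioc 0 n, ∏ j ∈ Ioc i n, qint s (lf n (fun _ => 0) i + lf n (fun _ => 0) j)) = D0 at *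
  generalize (∏ i ∈ Ioc 0 n, ∏ j ∈ Ioc i n, qint s (lf n (fun _ => 0) i - lf n (fun _ => 0) j)) = V0 at *
  have k1 : NP * ck = AP * BP * cl := by
    apply mul_right_cancel₀ hdm
    linear_combination ck * i1 + AP * BP * i2
  linear_combination Fk * D0 * V0 * k1 + Fk * V0 * cl * i3 - cl * D * i6
end

section
/- Let n ≥ 1, let t be a complex number that is not a root of unity, set s = t² and α = t^{4n} (so that α = s^{2n}), and let λ = (λ_1, …, λ_n) be a partition with at most n parts. Then Wenzl's quantum dimension satisfies ⟨λ⟩_{α,s} = ∏_{j=1}^{n} (t^{2(n+λ_j−j)+1} − t^{−2(n+λ_j−j)−1})/(t^{2(n−j)+1} − t^{−2(n−j)−1}) · ∏_{1≤i<j≤n} [2n+λ_i−i+λ_j−j+1]·[λ_i−i−λ_j+j] / ([2n−i−j+1]·[j−i]), where the brackets are the quantum integers for s. (The fractions with t are the quantum numbers [n+λ_j−j+1/2]/[n−j+1/2] at half-integer arguments.) -/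
open Finset

/-- A partition with at most `n` parts, together with its conjugate. -/
structure IsPart (n : ℕ) (lam lamV : ℕ → ℕ) : Prop where
  mono : ∀ i j : ℕ, 1 ≤ i → i ≤ j → lam j ≤ lam i
  zero : ∀ i, n < i → lam i = 0
  conj : ∀ i j : ℕ, 1 ≤ i → 1 ≤ j → (j ≤ lam i ↔ i ≤ lamV j)

/-- Shifted parts. -/
def aa (n : ℕ) (lam : ℕ → ℕ) (i : ℕ) : ℤ := (n : ℤ) + lam i - i

/-- Complementary shifted conjugate parts. -/
def bb (n : ℕ) (lamV : ℕ → ℕ) (j : ℕ) : ℤ := (n : ℤ) + j - 1 - lamV j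

theorem Ico_zero_succ {M : Type*} [AddCommGroup M] (φ : ℤ → M) (X : ℤ) (hX : 0 ≤ X) :
    ∑ x ∈ Finset.Ico (0 : ℤ) (X + 1), φ x = ∑ x ∈ Finset.Ico (0 : ℤ) X, φ x + φ X := by
  have : Finset.Ico (0 : ℤ) (X + 1) = insert X (Finset.Ico (0 : ℤ) X) := by
    ext x; simp only [Finset.mem_Ico, Finset.mem_insert]; omega
  rw [this, Finset.sum_insert (by simp), add_comm]

namespace IsPart

variable {n : ℕ} {lam lamV : ℕ → ℕ}

theorem lamV_le (h : IsPart n lam lamV) (j : ℕ) (hj : 1 ≤ j) : lamV j ≤ n := by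
  by_contra hc
  push Not at hc
  have h1 := (h.conj (lamV j) j (by omega) hj).2 le_rfl
  have := h.zero _ hc
  omega

/-- The `b`'s below and the `a`'s below a boundary point fill an interval. -/
theorem fill (h : IsPart n lam lamV) {M : Type*} [AddCommGroup M] (φ : ℤ → M) :
    ∀ (N l m : ℕ), n - l + m = N → l ≤ n → (∀ i, 1 ≤ i → i ≤ l → m ≤ lam i) →
      (∀ i, l < i → lam i ≤ m) →
    ∑ j ∈ Finset.Icc 1 m, φ (bb n lamV j) + ∑ k ∈ Finset.Ioc l n, φ (aa n lam k) =
      ∑ x ∈ Finset.Ico (0 : ℤ) ((n : ℤ) - l + m), φ x := by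
  intro N
  induction N with
  | zero =>
    intro l m hN hl _ _
    have h1 : l = n := by omega
    have h2 : m = 0 := by omega
    subst h1 h2
    simp
  | succ N ih =>
    intro l m hN hl h1 h2
    by_cases hc : l < n ∧ lam (l + 1) = m
    · obtain ⟨hln, hm⟩ := hc
      have := ih (l + 1) m (by omega) (by omega)
        (fun i hi hi' => by
          rcases Nat.lt_or_ge l i with h' | h'
          · have : i = l + 1 := by omega
            subst this; omega
          · exact h1 i hi h')
        (fun i hi => h2 i (by omega))
      have e : Finset.Ioc l n = insert (l + 1) (Finset.Ioc (l + 1) n) := by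
        ext x; simp only [Finset.mem_Ioc, Finset.mem_insert]; omega
      rw [e, Finset.sum_insert (by simp)]
      have e2 : (n : ℤ) - l + m = ((n : ℤ) - (l + 1 : ℕ) + m) + 1 := by push_cast; ring
      rw [e2, Ico_zero_succ _ _ (by push_cast; omega), ← this]
      have e3 : aa n lam (l + 1) = (n : ℤ) - (l + 1 : ℕ) + m := by
        simp only [aa, hm]; push_cast; ring
      rw [e3]; abel
    · have hm : 1 ≤ m := by
        by_contra hm
        have h3 : l < n := by omega
        exact hc ⟨h3, by have := h2 (l + 1) (by omega); omega⟩
      have hlt : lam (l + 1) < m := by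
        have := h2 (l + 1) (by omega)
        rcases Nat.lt_or_ge l n with h' | h'
        · have : lam (l + 1) ≠ m := fun e => hc ⟨h', e⟩
          omega
        · have := h.zero (l + 1) (by omega); omega
      have hV : lamV m = l := by
        apply le_antisymm
        · by_contra hh
          push Not at hh
          have := (h.conj (l + 1) m (by omega) hm).2 hh
          omega
        · rcases Nat.eq_zero_or_pos l with h0 | h0
          · omega
          · exact (h.conj l m h0 hm).1 (h1 l h0 le_rfl)
      obtain ⟨m, rfl⟩ : ∃ k, m = k + 1 := ⟨m - 1, by omega⟩
      have := ih l m (by omega) hl (fun i hi hi' => by have := h1 i hi hi'; omega)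
        (fun i hi => by have := h.mono (l + 1) i (by omega) hi; omega)
      have e : Finset.Icc 1 (m + 1) = insert (m + 1) (Finset.Icc 1 m) := by
        ext x; simp only [Finset.mem_Icc, Finset.mem_insert]; omega
      rw [e, Finset.sum_insert (by simp)]
      have e2 : (n : ℤ) - l + (m + 1 : ℕ) = ((n : ℤ) - l + m) + 1 := by push_cast; ring
      rw [e2, Ico_zero_succ _ _ (by push_cast; omega), ← this]
      have e3 : bb n lamV (m + 1) = (n : ℤ) - l + m := by
        simp only [bb, hV]; push_cast; ring
      rw [e3]; abel

/-- Row version. -/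
theorem fill_row (h : IsPart n lam lamV) {M : Type*} [AddCommGroup M] (φ : ℤ → M)
    (k : ℕ) (hk : 1 ≤ k) (hkn : k ≤ n) :
    ∑ j ∈ Finset.Icc 1 (lam k), φ (bb n lamV j) + ∑ i ∈ Finset.Ioc k n, φ (aa n lam i) =
      ∑ x ∈ Finset.Ico (0 : ℤ) (aa n lam k), φ x := by
  rw [h.fill φ _ k (lam k) rfl hkn (fun i hi hi' => h.mono i k hi hi')
    (fun i hi => h.mono k i hk hi.le)]
  congr 2; simp only [aa]; ring

/-- Column version. -/
theorem fill_col (h : IsPart n lam lamV) {M : Type*} [AddCommGroup M] (φ : ℤ → M)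
    (p : ℕ) (hp : 1 ≤ p) :
    ∑ j ∈ Finset.Ico 1 p, φ (bb n lamV j) + ∑ i ∈ Finset.Ioc (lamV p) n, φ (aa n lam i) =
      ∑ x ∈ Finset.Ico (0 : ℤ) (bb n lamV p), φ x := by
  obtain ⟨p, rfl⟩ : ∃ k, p = k + 1 := ⟨p - 1, by omega⟩
  have := h.fill φ _ (lamV (p + 1)) p rfl (h.lamV_le _ hp)
    (fun i hi hi' => by have := (h.conj i (p + 1) hi hp).2 hi'; omega)
    (fun i hi => by
      by_contra hc
      have := (h.conj i (p + 1) (by omega) hp).1 (by omega)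
      omega)
  have e : Finset.Ico 1 (p + 1) = Finset.Icc 1 p := by
    ext x; simp only [Finset.mem_Icc, Finset.mem_Ico]; omega
  rw [e, this]
  congr 2; simp only [bb]; push_cast; ring

/-- Existence of the Durfee square. -/
theorem durfee (h : IsPart n lam lamV) : ∃ r, r ≤ n ∧ (∀ i, 1 ≤ i → i ≤ r → r ≤ lam i) ∧
    (∀ i, r < i → lam i ≤ r) := by
  classical
  refine ⟨Nat.findGreatest (fun i => i ≤ lam i) n, Nat.findGreatest_le n, ?_, ?_⟩
  · intro i hi hir
    have h1 : (fun i => i ≤ lam i) (Nat.findGreatest (fun i => i ≤ lam i) n) :=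
      Nat.findGreatest_of_ne_zero (P := fun i => i ≤ lam i) (n := n) rfl (by omega)
    exact le_trans h1 (h.mono _ _ hi hir)
  · intro i hi
    have h2 := h.mono (Nat.findGreatest (fun i => i ≤ lam i) n + 1) i (by omega) hi
    by_cases hn : Nat.findGreatest (fun i => i ≤ lam i) n + 1 ≤ n
    · have := Nat.findGreatest_is_greatest (P := fun i => i ≤ lam i) (n := n)
        (k := Nat.findGreatest (fun i => i ≤ lam i) n + 1) (by omega) hn
      simp only [not_le] at this
      omega
    · have := h.zero (Nat.findGreatest (fun i => i ≤ lam i) n + 1) (by omega)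
      omega

end IsPart

theorem exists_antidiff {M : Type*} [AddCommGroup M] (F : ℤ → M) :
    ∃ P : ℤ → M, ∀ m, F m = P m - P (m - 1) := by
  refine ⟨fun m => match m with
    | Int.ofNat k => ∑ x ∈ Finset.range k, F (x + 1)
    | Int.negSucc k => - ∑ x ∈ Finset.range (k + 1), F (-x), ?_⟩
  intro m
  match m with
  | Int.ofNat 0 =>
    have : Int.ofNat 0 - 1 = Int.negSucc 0 := rfl
    rw [this]; simp
  | Int.ofNat (k + 1) =>
    have : Int.ofNat (k + 1) - 1 = Int.ofNat k := by simp
    rw [this]; simp [Finset.sum_range_succ]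
  | Int.negSucc k =>
    have : Int.negSucc k - 1 = Int.negSucc (k + 1) := rfl
    rw [this]; simp only [Finset.sum_range_succ _ (k + 1)]
    have : Int.negSucc k = -((k + 1 : ℕ) : ℤ) := rfl
    rw [this]; abel

theorem sum_tele {M : Type*} [AddCommGroup M] {F P : ℤ → M} (hP : ∀ m, F m = P m - P (m - 1))
    (c p q : ℤ) (hpq : p ≤ q) :
    ∑ x ∈ Finset.Ico p q, F (c + x + 1) = P (c + q) - P (c + p) := by
  obtain ⟨d, rfl⟩ : ∃ d : ℕ, q = p + d := ⟨(q - p).toNat, by omega⟩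
  clear hpq
  induction d with
  | zero => simp
  | succ d ih =>
    have : Finset.Ico p (p + (d + 1 : ℕ)) = insert (p + d) (Finset.Ico p (p + d)) := by
      ext x; simp only [Finset.mem_Ico, Finset.mem_insert]; omega
    rw [this, Finset.sum_insert (by simp), ih, hP]
    have e1 : c + (p + d) + 1 = c + (p + (d + 1 : ℕ)) := by push_cast; ring
    have e2 : c + (p + (d + 1 : ℕ)) - 1 = c + (p + d) := by push_cast; ring
    rw [e1, e2]; abel

theorem sum_tele_neg {M : Type*} [AddCommGroup M] {F P : ℤ → M}
    (hP : ∀ m, F m = P m - P (m - 1)) (c p q : ℤ) (hpq : p ≤ q) :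
    ∑ x ∈ Finset.Ico p q, F (c - x) = P (c - p) - P (c - q) := by
  obtain ⟨d, rfl⟩ : ∃ d : ℕ, q = p + d := ⟨(q - p).toNat, by omega⟩
  clear hpq
  induction d with
  | zero => simp
  | succ d ih =>
    have : Finset.Ico p (p + (d + 1 : ℕ)) = insert (p + d) (Finset.Ico p (p + d)) := by
      ext x; simp only [Finset.mem_Ico, Finset.mem_insert]; omega
    rw [this, Finset.sum_insert (by simp), ih, hP]
    have e1 : c - (p + d) - 1 = c - (p + (d + 1 : ℕ)) := by push_cast; ring
    rw [e1]; abel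

theorem sum_Ioc_add {M : Type*} [AddCommGroup M] (f : ℕ → M) (a b c : ℕ) (h1 : a ≤ b)
    (h2 : b ≤ c) : ∑ i ∈ Finset.Ioc a b, f i + ∑ i ∈ Finset.Ioc b c, f i =
      ∑ i ∈ Finset.Ioc a c, f i := by
  rw [← Finset.sum_union]
  · congr 1; ext x; simp only [Finset.mem_union, Finset.mem_Ioc]; omega
  · rw [Finset.disjoint_left]; intro x; simp only [Finset.mem_Ioc]; omega

theorem sum_Ico_add {M : Type*} [AddCommGroup M] (f : ℤ → M) (a b c : ℤ) (h1 : a ≤ b)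
    (h2 : b ≤ c) : ∑ i ∈ Finset.Ico a b, f i + ∑ i ∈ Finset.Ico b c, f i =
      ∑ i ∈ Finset.Ico a c, f i := by
  rw [← Finset.sum_union]
  · congr 1; ext x; simp only [Finset.mem_union, Finset.mem_Ico]; omega
  · rw [Finset.disjoint_left]; intro x; simp only [Finset.mem_Ico]; omega

theorem Icc_one_eq (m : ℕ) : Finset.Icc 1 m = Finset.Ioc 0 m := by
  ext x; simp only [Finset.mem_Icc, Finset.mem_Ioc]; omega

theorem sum_down {M : Type*} [AddCommGroup M] (P : ℤ → M) (X : ℤ) (v : ℕ) (hv : (v : ℤ) ≤ X) :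
    ∑ k ∈ Finset.Icc 1 v, P (X - k) + ∑ x ∈ Finset.Ico (0 : ℤ) (X - v), P x =
      ∑ x ∈ Finset.Ico (0 : ℤ) X, P x := by
  induction v with
  | zero => simp
  | succ v ih =>
    rw [← ih (by push_cast at hv; omega)]
    have e : Finset.Icc 1 (v + 1) = insert (v + 1) (Finset.Icc 1 v) := by
      ext x; simp only [Finset.mem_Icc, Finset.mem_insert]; omega
    rw [e, Finset.sum_insert (by simp)]
    have e2 : X - (v : ℤ) = X - (v + 1 : ℕ) + 1 := by push_cast; ring
    rw [e2, Ico_zero_succ _ _ (by omega)]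
    abel

namespace IsPart

variable {n : ℕ} {lam lamV : ℕ → ℕ}

theorem aa_nonneg (k : ℕ) (hkn : k ≤ n) : 0 ≤ aa n lam k := by
  simp only [aa]; omega

theorem bb_nonneg (h : IsPart n lam lamV) (j : ℕ) (hj : 1 ≤ j) : 0 ≤ bb n lamV j := by
  have := h.lamV_le j hj
  simp only [bb]; omega

theorem hooks (h : IsPart n lam lamV) {M : Type*} [AddCommGroup M] {F P : ℤ → M}
    (hP : ∀ m, F m = P m - P (m - 1)) :
    ∑ k ∈ Finset.Icc 1 n, ∑ j ∈ Finset.Icc 1 (lam k), F (aa n lam k - bb n lamV j) =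
      ∑ k ∈ Finset.Icc 1 n, (P (aa n lam k) - P 0) -
      ∑ k ∈ Finset.Icc 1 n, ∑ i ∈ Finset.Ioc k n, F (aa n lam k - aa n lam i) := by
  rw [← Finset.sum_sub_distrib]
  refine Finset.sum_congr rfl fun k hk => ?_
  rw [Finset.mem_Icc] at hk
  have := h.fill_row (fun x => F (aa n lam k - x)) k hk.1 hk.2
  rw [sum_tele_neg hP _ _ _ (aa_nonneg k hk.2)] at this
  rw [sub_zero, sub_self] at this
  rw [← this]; abel

theorem sum_mid (h : IsPart n lam lamV) {M : Type*} [AddCommGroup M] (φ : ℤ → M)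
    (j : ℕ) (hj : 1 ≤ j) (hjn : j ≤ n) (hjl : lam j < j) :
    ∑ i ∈ Finset.Ioo (lam j) j, φ (bb n lamV i) =
      ∑ x ∈ Finset.Ico (aa n lam j) (bb n lamV j), φ x
        - ∑ k ∈ Finset.Ioo (lamV j) j, φ (aa n lam k) - φ (aa n lam j) := by
  have hV : lamV j < j := by
    by_contra hc
    have := (h.conj j j hj hj).2 (by omega)
    omega
  have h1 := h.fill_row φ j hj hjn
  have h2 := h.fill_col φ j hj
  have e1 : Finset.Ico 1 j = Finset.Icc 1 (lam j) ∪ Finset.Ioo (lam j) j := by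
    ext x; simp only [Finset.mem_Ico, Finset.mem_union, Finset.mem_Icc, Finset.mem_Ioo]; omega
  have d1 : Disjoint (Finset.Icc 1 (lam j)) (Finset.Ioo (lam j) j) := by
    rw [Finset.disjoint_left]; intro x; simp only [Finset.mem_Icc, Finset.mem_Ioo]; omega
  have e2 : Finset.Ioc (lamV j) n = insert j (Finset.Ioo (lamV j) j) ∪ Finset.Ioc j n := by
    ext x
    simp only [Finset.mem_Ioc, Finset.mem_union, Finset.mem_insert, Finset.mem_Ioo]; omega
  have d2 : Disjoint (insert j (Finset.Ioo (lamV j) j)) (Finset.Ioc j n) := by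
    rw [Finset.disjoint_left]; intro x
    simp only [Finset.mem_Ioc, Finset.mem_insert, Finset.mem_Ioo]; omega
  rw [e1, e2, Finset.sum_union d1, Finset.sum_union d2, Finset.sum_insert (by simp),
    ← sum_Ico_add φ 0 (aa n lam j) (bb n lamV j) (aa_nonneg j hjn)
      (by simp only [aa, bb]; omega), ← h1] at h2
  have h3 : ∑ x ∈ Finset.Ico (aa n lam j) (bb n lamV j), φ x =
    ∑ i ∈ Finset.Ioo (lam j) j, φ (bb n lamV i) + φ (aa n lam j)
      + ∑ k ∈ Finset.Ioo (lamV j) j, φ (aa n lam k) := by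
    have := sub_eq_zero.2 h2
    rw [← sub_eq_zero, ← neg_eq_zero, ← this]
    abel
  rw [h3]; abel

theorem low (h : IsPart n lam lamV) {M : Type*} [AddCommGroup M] {F P : ℤ → M}
    (hP : ∀ m, F m = P m - P (m - 1)) (r : ℕ) (hrn : r ≤ n)
    (hr1 : ∀ i, 1 ≤ i → i ≤ r → r ≤ lam i) (hr2 : ∀ i, r < i → lam i ≤ r) :
    ∑ i ∈ Finset.Icc 1 n, ∑ j ∈ Finset.Icc 1 (min i (lam i)),
        F (bb n lamV i + bb n lamV j + 1) =
      ∑ i ∈ Finset.Icc 1 r, P (2 * bb n lamV i + 1) + ∑ i ∈ Finset.Ioc r n, P (2 * aa n lam i + 1)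
      - ∑ i ∈ Finset.Icc 1 n, P (bb n lamV i)
      + ∑ j ∈ Finset.Ioc r n, ∑ k ∈ Finset.Ioo (lamV j) j, F (aa n lam j + aa n lam k + 1) := by
  have hrow : ∀ i ∈ Finset.Ioc r n, ∑ j ∈ Finset.Icc 1 (min i (lam i)),
        F (bb n lamV i + bb n lamV j + 1) = (P (aa n lam i + bb n lamV i) - P (bb n lamV i)) -
        ∑ j ∈ Finset.Ioc i n, F (bb n lamV i + aa n lam j + 1) := by
    intro i hi
    rw [Finset.mem_Ioc] at hi
    have := hr2 i hi.1
    rw [min_eq_right (by omega)]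
    have h1 := h.fill_row (fun x => F (bb n lamV i + x + 1)) i (by omega) hi.2
    rw [sum_tele hP _ _ _ (aa_nonneg i hi.2), add_zero,
      add_comm (bb n lamV i) (aa n lam i)] at h1
    rw [← h1]; abel
  have hcol : ∀ i ∈ Finset.Icc 1 r, ∑ j ∈ Finset.Icc 1 (min i (lam i)),
        F (bb n lamV i + bb n lamV j + 1) = (P (2 * bb n lamV i + 1) - P (bb n lamV i)) -
        ∑ j ∈ Finset.Ioc (lamV i) n, F (bb n lamV i + aa n lam j + 1) := by
    intro i hi
    rw [Finset.mem_Icc] at hi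
    have := hr1 i hi.1 hi.2
    rw [min_eq_left (by omega)]
    have h1 := h.fill_col (fun x => F (bb n lamV i + x + 1)) i hi.1
    rw [sum_tele hP _ _ _ (h.bb_nonneg i hi.1), add_zero] at h1
    have e : Finset.Icc 1 i = insert i (Finset.Ico 1 i) := by
      ext x; simp only [Finset.mem_Icc, Finset.mem_Ico, Finset.mem_insert]; omega
    rw [e, Finset.sum_insert (by simp), ← two_mul, hP (2 * _ + 1), add_sub_cancel_right]
    rw [← two_mul] at h1
    rw [eq_sub_iff_add_eq, add_assoc, h1]; abel
  have hcross : ∑ i ∈ Finset.Icc 1 r, ∑ j ∈ Finset.Ioc (lamV i) n,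
        F (bb n lamV i + aa n lam j + 1) + ∑ i ∈ Finset.Ioc r n, ∑ j ∈ Finset.Ioc i n,
        F (bb n lamV i + aa n lam j + 1) =
      ∑ j ∈ Finset.Ioc r n, ∑ i ∈ Finset.Ioo (lam j) j, F (bb n lamV i + aa n lam j + 1) := by
    rw [Finset.sum_comm' (s := Finset.Ioc r n) (t := fun i => Finset.Ioc i n)
        (t' := Finset.Ioc r n) (s' := fun j => Finset.Ioo r j),
      Finset.sum_comm' (s := Finset.Icc 1 r) (t' := Finset.Ioc r n)
        (s' := fun j => Finset.Ioc (lam j) r), ← Finset.sum_add_distrib]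
    · refine Finset.sum_congr rfl fun j hj => ?_
      rw [Finset.mem_Ioc] at hj
      have := hr2 j hj.1
      rw [← Finset.sum_union]
      · congr 1; ext x; simp only [Finset.mem_union, Finset.mem_Ioc, Finset.mem_Ioo]; omega
      · rw [Finset.disjoint_left]; intro x; simp only [Finset.mem_Ioc, Finset.mem_Ioo]; omega
    · intro x y; simp only [Finset.mem_Ioc, Finset.mem_Icc]
      constructor
      · rintro ⟨⟨h1, h2⟩, h3, h4⟩
        have h5 : ¬ (x ≤ lam y) := fun hh => by
          have := (h.conj y x (by omega) h1).1 hh; omega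
        have h6 : r < y := by
          by_contra hc
          have := hr1 y (by omega) (by omega); omega
        omega
      · rintro ⟨⟨h1, h2⟩, h3, h4⟩
        have h5 : ¬ (y ≤ lamV x) := fun hh => by
          have := (h.conj y x (by omega) (by omega)).2 hh; omega
        omega
    · intro x y; simp only [Finset.mem_Ioc, Finset.mem_Ioo]; omega
  have hmid : ∀ j ∈ Finset.Ioc r n, ∑ i ∈ Finset.Ioo (lam j) j, F (bb n lamV i + aa n lam j + 1)
      = P (aa n lam j + bb n lamV j) - P (2 * aa n lam j + 1) -
      ∑ k ∈ Finset.Ioo (lamV j) j, F (aa n lam j + aa n lam k + 1) := by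
    intro j hj
    rw [Finset.mem_Ioc] at hj
    have hl := hr2 j hj.1
    have h1 := h.sum_mid (fun x => F (aa n lam j + x + 1)) j (by omega) hj.2 (by omega)
    have hV : lamV j < j := by
      by_contra hc
      have := (h.conj j j (by omega) (by omega)).2 (by omega)
      omega
    rw [sum_tele hP _ _ _ (by simp only [aa, bb]; omega), ← two_mul, hP (2 * _ + 1),
      add_sub_cancel_right] at h1
    rw [Finset.sum_congr rfl fun i _ => by rw [add_comm (bb n lamV i)], h1]
    abel
  have split : ∀ f : ℕ → M, ∑ i ∈ Finset.Icc 1 n, f i =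
      ∑ i ∈ Finset.Icc 1 r, f i + ∑ i ∈ Finset.Ioc r n, f i := fun f => by
    rw [Icc_one_eq, Icc_one_eq, sum_Ioc_add f 0 r n (by omega) hrn]
  rw [Finset.sum_congr rfl hmid] at hcross
  rw [split, Finset.sum_congr rfl hrow, Finset.sum_congr rfl hcol, split (fun i => P (bb n lamV i))]
  simp only [Finset.sum_sub_distrib] at hcross ⊢
  rw [← eq_sub_iff_add_eq] at hcross
  rw [hcross]
  abel

theorem up (h : IsPart n lam lamV) {M : Type*} [AddCommGroup M] {F P : ℤ → M}
    (hP : ∀ m, F m = P m - P (m - 1)) (r : ℕ)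
    (hr1 : ∀ i, 1 ≤ i → i ≤ r → r ≤ lam i) :
    ∑ k ∈ Finset.Icc 1 n, ∑ j ∈ Finset.Ioc k (lam k), F (aa n lam k + aa n lam j + 1) +
      ∑ j ∈ Finset.Ioc r n, ∑ k ∈ Finset.Ioo (lamV j) j, F (aa n lam j + aa n lam k + 1) =
    ∑ k ∈ Finset.Icc 1 n, ∑ j ∈ Finset.Ioc k n, F (aa n lam k + aa n lam j + 1) +
    ∑ k ∈ Finset.Icc 1 n, P (aa n lam k) + ∑ k ∈ Finset.Icc 1 n, P (bb n lamV k)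
    - ∑ x ∈ Finset.Ico (0 : ℤ) (2 * n), P x := by
  have hswap : ∑ j ∈ Finset.Ioc r n, ∑ k ∈ Finset.Ioo (lamV j) j, F (aa n lam j + aa n lam k + 1)
      = ∑ k ∈ Finset.Icc 1 n, ∑ j ∈ Finset.Ioc (max k (lam k)) n,
        F (aa n lam k + aa n lam j + 1) := by
    rw [Finset.sum_comm' (t' := Finset.Icc 1 n) (s' := fun k => Finset.Ioc (max k (lam k)) n)]
    · refine Finset.sum_congr rfl fun k _ => Finset.sum_congr rfl fun j _ => ?_
      rw [add_comm (aa n lam j)]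
    · intro x y; simp only [Finset.mem_Ioc, Finset.mem_Icc, Finset.mem_Ioo]
      constructor
      · rintro ⟨⟨h1, h2⟩, h3, h4⟩
        have h5 : ¬ (x ≤ lam y) := fun hh => by
          have := (h.conj y x (by omega) (by omega)).1 hh; omega
        omega
      · rintro ⟨⟨h1, h2⟩, h3, h4⟩
        have h5 : ¬ (y ≤ lamV x) := fun hh => by
          have := (h.conj y x (by omega) (by omega)).2 hh; omega
        have h6 : r < x := by
          by_contra hc
          have := hr1 y (by omega) (by omega); omega
        omega
  have hrow : ∀ k ∈ Finset.Icc 1 n, ∑ j ∈ Finset.Ioc k (lam k), F (aa n lam k + aa n lam j + 1) +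
      ∑ j ∈ Finset.Ioc (max k (lam k)) n, F (aa n lam k + aa n lam j + 1) =
      ∑ j ∈ Finset.Ioc k n, F (aa n lam k + aa n lam j + 1) +
      ∑ j ∈ Finset.Ioc n (lam k), F (aa n lam k + aa n lam j + 1) := by
    intro k hk
    rw [Finset.mem_Icc] at hk
    rcases le_total (lam k) k with h1 | h1
    · rw [max_eq_left h1, Finset.Ioc_eq_empty (by omega : ¬ k < lam k),
        Finset.Ioc_eq_empty (by omega : ¬ n < lam k)]
      simp
    · rw [max_eq_right h1]
      rcases le_total (lam k) n with h2 | h2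
      · rw [sum_Ioc_add _ _ _ _ h1 h2, Finset.Ioc_eq_empty (by omega : ¬ n < lam k)]
        simp
      · rw [sum_Ioc_add _ _ _ _ hk.2 h2, Finset.Ioc_eq_empty (by omega : ¬ lam k < n)]
        simp
  have hv := h.lamV_le (n + 1) (by omega)
  have hext : ∑ k ∈ Finset.Icc 1 n, ∑ j ∈ Finset.Ioc n (lam k), F (aa n lam k + aa n lam j + 1) =
      ∑ k ∈ Finset.Icc 1 (lamV (n + 1)), (P (aa n lam k) - P (2 * n - k)) := by
    rw [Icc_one_eq, ← sum_Ioc_add _ 0 (lamV (n + 1)) n (by omega) hv, ← Icc_one_eq]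
    rw [Finset.sum_eq_zero (s := Finset.Ioc (lamV (n + 1)) n), add_zero]
    · refine Finset.sum_congr rfl fun k hk => ?_
      rw [Finset.mem_Icc] at hk
      have h1 := (h.conj k (n + 1) hk.1 (by omega)).2 hk.2
      have h2 := sum_tele_neg hP (aa n lam k + n + 1) ((n + 1 : ℕ) : ℤ) ((lam k + 1 : ℕ) : ℤ)
        (by omega)
      have e1 : aa n lam k + n + 1 - ((n + 1 : ℕ) : ℤ) = aa n lam k := by push_cast; ring
      have e2 : aa n lam k + n + 1 - ((lam k + 1 : ℕ) : ℤ) = 2 * n - k := by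
        simp only [aa]; push_cast; ring
      rw [e1, e2] at h2
      rw [← h2]
      refine Finset.sum_bij (fun (x : ℕ) _ => (x : ℤ)) ?_ ?_ ?_ ?_
      · intro x; simp only [Finset.mem_Ioc, Finset.mem_Ico]; omega
      · intro x _ y _ hxy; exact_mod_cast hxy
      · intro x; simp only [Finset.mem_Ioc, Finset.mem_Ico]; intro hx
        exact ⟨x.toNat, by omega, by omega⟩
      · intro x hx
        rw [Finset.mem_Ioc] at hx
        have : aa n lam x = n - x := by simp only [aa, h.zero x hx.1]; push_cast; ring
        rw [this]; congr 1; ring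
    · intro k hk
      rw [Finset.mem_Ioc] at hk
      have h1 : ¬ (n + 1 ≤ lam k) := fun hh => by
        have := (h.conj k (n + 1) (by omega) (by omega)).1 hh; omega
      rw [Finset.Ioc_eq_empty (by omega), Finset.sum_empty]
  have hfill := h.fill_col P (n + 1) (by omega)
  have e0 : Finset.Ico 1 (n + 1) = Finset.Icc 1 n := by
    ext x; simp only [Finset.mem_Icc, Finset.mem_Ico]; omega
  have e1 : bb n lamV (n + 1) = 2 * n - (lamV (n + 1) : ℕ) := by
    simp only [bb]; push_cast; ring
  have hdown := sum_down P (2 * n) (lamV (n + 1)) (by omega)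
  rw [e0, e1] at hfill
  rw [hswap, ← Finset.sum_add_distrib, Finset.sum_congr rfl hrow, Finset.sum_add_distrib, hext,
    Finset.sum_sub_distrib, ← hdown, ← hfill]
  have hs : ∑ k ∈ Finset.Icc 1 n, P (aa n lam k) =
      ∑ k ∈ Finset.Icc 1 (lamV (n + 1)), P (aa n lam k) +
      ∑ k ∈ Finset.Ioc (lamV (n + 1)) n, P (aa n lam k) := by
    rw [Icc_one_eq, Icc_one_eq, sum_Ioc_add _ 0 _ n (by omega) hv]
  rw [hs]; abel

/-- The additive form of the full identity, up to a constant independent of the partition. -/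
theorem total (h : IsPart n lam lamV) {M : Type*} [AddCommGroup M] (F H P : ℤ → M)
    (hP : ∀ m, F m = P m - P (m - 1)) (r : ℕ) (hrn : r ≤ n)
    (hr1 : ∀ i, 1 ≤ i → i ≤ r → r ≤ lam i) (hr2 : ∀ i, r < i → lam i ≤ r) :
    ∑ i ∈ Finset.Icc 1 r, (H (2 * aa n lam i + 1) - H (2 * bb n lamV i + 1)) +
    ∑ i ∈ Finset.Icc 1 n, ∑ j ∈ Finset.Icc 1 (min i (lam i)),
        F (bb n lamV i + bb n lamV j + 1) +
    ∑ k ∈ Finset.Icc 1 n, ∑ j ∈ Finset.Ioc k (lam k), F (aa n lam k + aa n lam j + 1) -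
    ∑ k ∈ Finset.Icc 1 n, ∑ j ∈ Finset.Icc 1 (lam k), F (aa n lam k - bb n lamV j) =
    ∑ i ∈ Finset.Icc 1 n, H (2 * aa n lam i + 1) +
    ∑ k ∈ Finset.Icc 1 n, ∑ j ∈ Finset.Ioc k n,
      (F (aa n lam k + aa n lam j + 1) + F (aa n lam k - aa n lam j)) +
    (∑ x ∈ Finset.Ico (0 : ℤ) n, P (2 * x + 1) - ∑ x ∈ Finset.Ico (0 : ℤ) n, H (2 * x + 1)
      - ∑ x ∈ Finset.Ico (0 : ℤ) (2 * n), P x + ∑ _k ∈ Finset.Icc 1 n, P 0) := by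
  have e : (n : ℤ) - r + r = n := by ring
  have f1 := h.fill (fun x => P (2 * x + 1)) _ r r rfl hrn hr1 hr2
  have f2 := h.fill (fun x => H (2 * x + 1)) _ r r rfl hrn hr1 hr2
  rw [e] at f1 f2
  rw [h.low hP r hrn hr1 hr2, h.hooks hP, eq_sub_of_add_eq (h.up hP r hr1), ← f1, ← f2]
  simp only [Finset.sum_sub_distrib, Finset.sum_add_distrib]
  rw [Icc_one_eq n, ← sum_Ioc_add (fun i => H (2 * aa n lam i + 1)) 0 r n (by omega) hrn,
    ← Icc_one_eq, ← Icc_one_eq]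
  abel

end IsPart

theorem IsPart.total' {n : ℕ} {lam lamV : ℕ → ℕ} (h : IsPart n lam lamV) {M : Type*}
    [AddCommGroup M] (F H : ℤ → M) :
    ∑ i ∈ Finset.Icc 1 n, ∑ j ∈ Finset.Icc 1 (lam i),
      ((if i = j then H (2 * aa n lam i + 1) - H (2 * bb n lamV i + 1) else 0) +
        (if i < j then F (aa n lam i + aa n lam j + 1) else F (bb n lamV i + bb n lamV j + 1)) -
        F (aa n lam i - bb n lamV j)) =
    ∑ i ∈ Finset.Icc 1 n, (H (2 * aa n lam i + 1) - H (2 * ((n : ℤ) - i) + 1)) +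
    ∑ k ∈ Finset.Icc 1 n, ∑ j ∈ Finset.Ioc k n,
      ((F (aa n lam k + aa n lam j + 1) + F (aa n lam k - aa n lam j)) -
        (F (2 * n - (k : ℤ) - j + 1) + F ((j : ℤ) - k))) := by
  obtain ⟨P, hP⟩ := exists_antidiff F
  obtain ⟨r, hrn, hr1, hr2⟩ := h.durfee
  have h0 : IsPart n (fun _ => 0) (fun _ => 0) :=
    ⟨fun _ _ _ _ => le_rfl, fun _ _ => rfl, fun i j hi hj => by omega⟩
  have t0 := h0.total F H P hP 0 (by omega) (fun i _ _ => by omega) (fun i _ => le_rfl)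
  have t1 := h.total F H P hP r hrn hr1 hr2
  simp only [aa, Nat.cast_zero, add_zero, _root_.min_zero,
    Finset.Icc_eq_empty (show ¬ (1 : ℕ) ≤ 0 by omega)] at t0
  have hz : ∀ k : ℕ, ∑ j ∈ Finset.Ioc k 0, F ((n : ℤ) - k + ((n : ℤ) - j) + 1) = 0 := by
    intro k; rw [Finset.Ioc_eq_empty (by omega), Finset.sum_empty]
  simp only [hz] at t0
  simp only [Finset.sum_empty, Finset.sum_const_zero, add_zero, sub_zero] at t0
  have t2 := t1
  rw [eq_neg_of_add_eq_zero_right t0.symm] at t2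
  have e1 : ∀ k j : ℕ, (n : ℤ) - k + ((n : ℤ) - j) + 1 = 2 * n - (k : ℤ) - j + 1 := by
    intros; ring
  have e2 : ∀ k j : ℕ, (n : ℤ) - k - ((n : ℤ) - j) = (j : ℤ) - k := by
    intros; ring
  simp only [e1, e2] at t2
  have l1 : ∑ i ∈ Finset.Icc 1 r, (H (2 * aa n lam i + 1) - H (2 * bb n lamV i + 1)) =
      ∑ i ∈ Finset.Icc 1 n, ∑ j ∈ Finset.Icc 1 (lam i),
        (if i = j then H (2 * aa n lam i + 1) - H (2 * bb n lamV i + 1) else 0) := by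
    simp only [Finset.sum_ite_eq]
    rw [← Finset.sum_filter]
    congr 1
    ext i; simp only [Finset.mem_Icc, Finset.mem_filter]
    constructor
    · rintro ⟨h1, h2⟩
      have := hr1 i h1 h2; omega
    · rintro ⟨⟨h1, h2⟩, _, h3⟩
      refine ⟨h1, ?_⟩
      by_contra hc
      have := hr2 i (by omega); omega
  have l2 : ∑ i ∈ Finset.Icc 1 n, ∑ j ∈ Finset.Icc 1 (min i (lam i)),
        F (bb n lamV i + bb n lamV j + 1) +
    ∑ k ∈ Finset.Icc 1 n, ∑ j ∈ Finset.Ioc k (lam k), F (aa n lam k + aa n lam j + 1) =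
    ∑ i ∈ Finset.Icc 1 n, ∑ j ∈ Finset.Icc 1 (lam i),
      (if i < j then F (aa n lam i + aa n lam j + 1) else F (bb n lamV i + bb n lamV j + 1)) := by
    rw [← Finset.sum_add_distrib]
    refine Finset.sum_congr rfl fun i hi => ?_
    rw [Finset.mem_Icc] at hi
    rw [Finset.sum_ite, add_comm]
    congr 2
    · ext x; simp only [Finset.mem_Icc, Finset.mem_filter, Finset.mem_Ioc]; omega
    · ext x; simp only [Finset.mem_Icc, Finset.mem_filter]; omega
  simp only [Finset.sum_sub_distrib (ι := ℕ), Finset.sum_add_distrib (ι := ℕ)] at t2 l1 l2 ⊢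
  rw [← l1, ← l2, ← add_assoc, t2]
  abel

/-- The value of an element of `Additive ℂˣ`. -/
def uval (x : Additive ℂˣ) : ℂ := ((Additive.toMul x : ℂˣ) : ℂ)

theorem uval_add (x y : Additive ℂˣ) : uval (x + y) = uval x * uval y := by
  simp [uval]

theorem uval_sub (x y : Additive ℂˣ) : uval (x - y) = uval x / uval y := by
  simp [uval]

theorem uval_zero : uval 0 = 1 := by simp [uval]

theorem uval_sum {ι : Type*} (s : Finset ι) (f : ι → Additive ℂˣ) :
    uval (∑ i ∈ s, f i) = ∏ i ∈ s, uval (f i) := by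
  simp [uval, toMul_sum]

open Classical in
/-- Lift a function to units. -/
noncomputable def ulift (f : ℤ → ℂ) (m : ℤ) : Additive ℂˣ :=
  if hm : f m ≠ 0 then Additive.ofMul (Units.mk0 (f m) hm) else 0

theorem uval_ulift (f : ℤ → ℂ) (m : ℤ) (hm : f m ≠ 0) : uval (ulift f m) = f m := by
  simp [uval, ulift, hm]

/-- `t^m - t^{-m}`. -/
noncomputable def hh (t : ℂ) (m : ℤ) : ℂ := t ^ m - t ^ (-m)

theorem hh_ne {t : ℂ} (ht : t ≠ 0) (hroot : ∀ m : ℕ, 0 < m → t ^ m ≠ 1) (m : ℤ) (hm : m ≠ 0) :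
    hh t m ≠ 0 := by
  intro h0
  have h1 : t ^ m = t ^ (-m) := sub_eq_zero.1 h0
  have h2 : t ^ (m + m) = 1 := by
    rw [zpow_add₀ ht]; nth_rw 2 [h1]; rw [← zpow_add₀ ht]; simp
  have h3 : t ^ (2 * m.natAbs) = 1 := by
    rcases Int.natAbs_eq m with h | h
    · have : t ^ ((2 * m.natAbs : ℕ) : ℤ) = 1 := by
        rw [← h2]; congr 1; omega
      exact_mod_cast this
    · have : t ^ ((2 * m.natAbs : ℕ) : ℤ) = (t ^ (m + m))⁻¹ := by
        rw [← zpow_neg]; congr 1; omega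
      rw [h2, inv_one] at this
      exact_mod_cast this
  exact hroot _ (by omega) h3

theorem qint_eq (t : ℂ) (m : ℤ) : qint (t ^ 2) m = hh t (2 * m) / hh t 2 := by
  have e : ∀ k : ℤ, (t ^ 2) ^ k = t ^ (2 * k) := fun k => by
    rw [zpow_mul]; norm_cast
  simp only [qint, hh, e]
  rw [zpow_neg t 2, mul_neg]
  norm_cast

theorem qint_ne_s3 {t : ℂ} (ht : t ≠ 0) (hroot : ∀ m : ℕ, 0 < m → t ^ m ≠ 1) (m : ℤ) (hm : m ≠ 0) :
    qint (t ^ 2) m ≠ 0 := by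
  rw [qint_eq]
  exact div_ne_zero (hh_ne ht hroot _ (by omega)) (hh_ne ht hroot _ (by omega))

theorem qintA_eq_s3 {t : ℂ} (ht : t ≠ 0) (n : ℕ) (m : ℤ) :
    qintA (t ^ (4 * n)) (t ^ 2) m = qint (t ^ 2) (2 * n + m) := by
  have e : ∀ k : ℤ, (t ^ 2) ^ k = t ^ (2 * k) := fun k => by
    rw [zpow_mul]; norm_cast
  have e2 : t ^ (4 * n) = t ^ (4 * n : ℤ) := by norm_cast
  simp only [qint, qintA, e, e2, ← zpow_neg, ← zpow_add₀ ht]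
  congr 3 <;> ring

theorem diag_eq_s3 {t : ℂ} (ht : t ≠ 0) (hroot : ∀ m : ℕ, 0 < m → t ^ m ≠ 1) (a b : ℤ) :
    qint (t ^ 2) (a + b + 1) + qint (t ^ 2) (a - b) =
      hh t (2 * a + 1) / hh t (2 * b + 1) * qint (t ^ 2) (b + b + 1) := by
  have h1 := hh_ne ht hroot (2 * b + 1) (by omega)
  have h2 := hh_ne ht hroot 2 (by omega)
  have e : hh t (2 * (b + b + 1)) = hh t (2 * b + 1) * (t ^ (2 * b + 1) + t ^ (-(2 * b + 1))) := by
    simp only [hh, sub_mul, mul_add, ← zpow_add₀ ht]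
    ring_nf
  have e2 : hh t (2 * (a + b + 1)) + hh t (2 * (a - b)) =
      hh t (2 * a + 1) * (t ^ (2 * b + 1) + t ^ (-(2 * b + 1))) := by
    simp only [hh, sub_mul, mul_add, ← zpow_add₀ ht]
    ring_nf
  rw [qint_eq, qint_eq, qint_eq, ← add_div, e2, e]
  field_simp

theorem prod_cells {n : ℕ} {lam lamV : ℕ → ℕ} (h : IsPart n lam lamV) (f : ℕ × ℕ → ℂ) :
    ∏ p ∈ cells lam n, f p = ∏ i ∈ Finset.Icc 1 n, ∏ j ∈ Finset.Icc 1 (lam i), f (i, j) := by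
  rw [cells, Finset.prod_filter, Finset.prod_product]
  refine Finset.prod_congr rfl fun i hi => ?_
  rw [Finset.mem_Icc] at hi
  rw [← Finset.prod_filter]
  congr 1
  have := h.mono 1 i le_rfl hi.1
  ext x; simp only [Finset.mem_Icc, Finset.mem_filter]; omega


/-- The odd orthogonal specialization `α = s^{2n}` (with `s = t²`,
`α = t^{4n}`) of Wenzl's quantum dimension, for a partition with at most `n` parts.
The fractions in `t` are the quantum numbers `[n+λ_j-j+1/2]/[n-j+1/2]` at
half-integer arguments. -/
theorem wenzl_odd_orthogonal (n : ℕ) (hn : 1 ≤ n) (t : ℂ) (ht : t ≠ 0)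
    (hroot : ∀ m : ℕ, 0 < m → t ^ m ≠ 1)
    (lam lamV : ℕ → ℕ)
    (hmono : ∀ i j : ℕ, 1 ≤ i → i ≤ j → lam j ≤ lam i)
    (hN : ∀ i, n < i → lam i = 0)
    (hconj : ∀ i j : ℕ, 1 ≤ i → 1 ≤ j → (j ≤ lam i ↔ i ≤ lamV j)) :
    wenzl (t ^ (4 * n)) (t ^ 2) lam lamV n =
      (∏ j ∈ Finset.Icc 1 n,
        (t ^ (2 * ((n : ℤ) + (lam j : ℤ) - j) + 1) - t ^ (-(2 * ((n : ℤ) + (lam j : ℤ) - j) + 1))) /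
        (t ^ (2 * ((n : ℤ) - j) + 1) - t ^ (-(2 * ((n : ℤ) - j) + 1)))) *
      ∏ p ∈ (Finset.Icc 1 n ×ˢ Finset.Icc 1 n).filter (fun p => p.1 < p.2),
        qint (t ^ 2) (2 * n + (lam p.1 : ℤ) - p.1 + (lam p.2 : ℤ) - p.2 + 1) *
          qint (t ^ 2) ((lam p.1 : ℤ) - p.1 - (lam p.2 : ℤ) + p.2) /
        (qint (t ^ 2) (2 * n - (p.1 : ℤ) - p.2 + 1) * qint (t ^ 2) ((p.2 : ℤ) - p.1)) := by
  have h : IsPart n lam lamV := ⟨hmono, hN, hconj⟩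
  have key := congrArg uval (h.total' (ulift (qint (t ^ 2))) (ulift (hh t)))
  have uF : ∀ m : ℤ, m ≠ 0 → uval (ulift (qint (t ^ 2)) m) = qint (t ^ 2) m :=
    fun m hm => uval_ulift _ _ (qint_ne_s3 ht hroot m hm)
  have uH : ∀ m : ℤ, m ≠ 0 → uval (ulift (hh t) m) = hh t m :=
    fun m hm => uval_ulift _ _ (hh_ne ht hroot m hm)
  have left : wenzl (t ^ (4 * n)) (t ^ 2) lam lamV n =
      ∏ p ∈ cells lam n, (if p.1 = p.2 then
        (qintA (t ^ (4 * n)) (t ^ 2) ((lam p.1 : ℤ) - (lamV p.1 : ℤ)) +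
          qint (t ^ 2) (hookl lam lamV p)) / qint (t ^ 2) (hookl lam lamV p)
        else qintA (t ^ (4 * n)) (t ^ 2) (dcell lam lamV p) / qint (t ^ 2) (hookl lam lamV p)) := by
    rw [Finset.prod_ite]; rfl
  rw [left, prod_cells h]
  rw [uval_add, uval_sum, uval_sum, uval_sum] at key
  refine Eq.trans ?_ (key.trans ?_)
  · refine Finset.prod_congr rfl fun i hi => ?_
    rw [uval_sum]
    refine Finset.prod_congr rfl fun j hj => ?_
    rw [Finset.mem_Icc] at hi hj
    have hVi := h.lamV_le i hi.1
    have hVj := h.lamV_le j hj.1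
    have hc := (hconj i j hi.1 hj.1).1 hj.2
    have ehook : hookl lam lamV (i, j) = aa n lam i - bb n lamV j := by
      simp only [hookl, aa, bb]; ring
    have nhook : aa n lam i - bb n lamV j ≠ 0 := by
      simp only [aa, bb]; omega
    rw [uval_sub, uval_add, uF _ nhook, ehook]
    dsimp only
    by_cases hij : i = j
    · subst hij
      have nb : 2 * bb n lamV i + 1 ≠ 0 := by omega
      have na : 2 * aa n lam i + 1 ≠ 0 := by omega
      rw [if_pos rfl, if_pos rfl, if_neg (lt_irrefl i), uval_sub, uF _ (by omega), uH _ na,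
        uH _ nb, qintA_eq_s3 ht, ← diag_eq_s3 ht hroot]
      congr 3
      simp only [aa, bb]; ring_nf
    · rw [if_neg hij, if_neg hij, uval_zero, one_mul, qintA_eq_s3 ht]
      congr 1
      by_cases hlt : i < j
      · rw [if_pos hlt, uF _ (by simp only [aa]; omega)]
        simp only [dcell, if_pos hlt.le, aa]
        congr 1; ring
      · rw [if_neg hlt, uF _ (by simp only [bb]; omega)]
        simp only [dcell, if_neg (by omega : ¬ i ≤ j), bb]
        congr 1; ring
  · congr 1
    · refine Finset.prod_congr rfl fun j hj => ?_
      rw [Finset.mem_Icc] at hj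
      rw [uval_sub, uH _ (by omega), uH _ (by omega)]
      rfl
    · rw [Finset.prod_filter, Finset.prod_product]
      refine Finset.prod_congr rfl fun i hi => ?_
      rw [Finset.mem_Icc] at hi
      rw [uval_sum, ← Finset.prod_filter]
      refine Finset.prod_congr ?_ fun j hj => ?_
      · ext x; simp only [Finset.mem_Icc, Finset.mem_filter, Finset.mem_Ioc]; omega
      · simp only [Finset.mem_filter, Finset.mem_Icc] at hj
        have hm := hmono i j hi.1 hj.2.le
        rw [uval_sub, uval_add, uval_add, uF _ (by simp only [aa]; omega),
          uF _ (by simp only [aa]; omega), uF _ (by omega), uF _ (by omega)]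
        simp only [aa]
        congr 3 <;> ring
end

section
/- Let n ≥ 1, let s be a complex number that is not a root of unity, set α = s^{2n−1}, and let λ = (λ_1, …, λ_n) be a partition with at most n parts. Then Wenzl's quantum dimension satisfies: if λ_n = 0 then ⟨λ⟩_{α,s} = ∏_{1≤i<j≤n} [2n+λ_i−i+λ_j−j]·[λ_i−i−λ_j+j] / ([2n−i−j]·[j−i]), and if λ_n ≠ 0 then ⟨λ⟩_{α,s} = 2·∏_{1≤i<j≤n} [2n+λ_i−i+λ_j−j]·[λ_i−i−λ_j+j] / ([2n−i−j]·[j−i]). -/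
open Finset

namespace WenzlAux

/-- `s^x + s^{-x}`. -/
noncomputable def tt (s : ℂ) (x : ℤ) : ℂ := s ^ x + s ^ (-x)

def NR (s : ℂ) : Prop := s ≠ 0 ∧ ∀ m : ℕ, 0 < m → s ^ m ≠ 1

lemma zpow_ne {s : ℂ} (h : NR s) {m : ℤ} (hm : m ≠ 0) : s ^ m ≠ 1 := by
  rcases lt_or_gt_of_ne hm with h1 | h1
  · obtain ⟨k, rfl⟩ : ∃ k : ℕ, m = -(k : ℤ) := ⟨m.natAbs, by omega⟩
    have := h.2 k (by omega)
    simpa using this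
  · obtain ⟨k, rfl⟩ : ∃ k : ℕ, m = (k : ℤ) := ⟨m.natAbs, by omega⟩
    have := h.2 k (by omega)
    simpa using this

lemma sub_ne {s : ℂ} (h : NR s) {m : ℤ} (hm : m ≠ 0) : s ^ m - s ^ (-m) ≠ 0 := by
  intro h0
  apply zpow_ne h (m := m + m) (by omega)
  have h1 : s ^ m = s ^ (-m) := sub_eq_zero.mp h0
  rw [zpow_add₀ h.1]
  nth_rewrite 1 [h1]
  rw [← zpow_add₀ h.1]; simp

lemma den_ne {s : ℂ} (h : NR s) : s - s⁻¹ ≠ 0 := by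
  have := sub_ne h (m := 1) (by norm_num)
  simpa using this

lemma br_ne {s : ℂ} (h : NR s) {m : ℤ} (hm : m ≠ 0) : qint s m ≠ 0 :=
  div_ne_zero (sub_ne h hm) (den_ne h)

lemma br_one {s : ℂ} (h : NR s) : qint s 1 = 1 := by
  have := den_ne h
  simp [qint, this]

lemma br_neg (s : ℂ) (m : ℤ) : qint s (-m) = - qint s m := by
  simp only [qint, neg_neg]; ring

lemma br_two {s : ℂ} (h : NR s) (x : ℤ) : qint s (x + x) = qint s x * tt s x := by
  have := den_ne h
  simp only [qint, tt, neg_add, zpow_add₀ h.1]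
  field_simp
  ring

lemma tt_ne {s : ℂ} (h : NR s) {x : ℤ} (hx : x ≠ 0) : tt s x ≠ 0 := by
  intro h0
  have := br_two h x
  rw [h0, mul_zero] at this
  exact br_ne h (by omega) this

lemma tt_zero (s : ℂ) : tt s 0 = 2 := by simp [tt]; norm_num

lemma br_add {s : ℂ} (h : NR s) (a b : ℤ) :
    qint s (a + b) + qint s (a - b) = qint s a * tt s b := by
  have := den_ne h
  simp only [qint, tt, neg_add, sub_eq_add_neg, zpow_add₀ h.1, neg_neg]
  field_simp
  ring

lemma qintA_eq {s : ℂ} (h : NR s) (k m : ℤ) : qintA (s ^ k) s m = qint s (k + m) := by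
  simp only [qintA, qint, neg_add, zpow_add₀ h.1, zpow_neg]

def ll (n : ℕ) (lam : ℕ → ℕ) (i : ℕ) : ℤ := (lam i : ℤ) + n - i
def cc (n : ℕ) (lamV : ℕ → ℕ) (j : ℕ) : ℤ := (n : ℤ) - 1 + j - lamV j

structure Part (n : ℕ) (lam lamV : ℕ → ℕ) : Prop where
  mono : ∀ i j : ℕ, 1 ≤ i → i ≤ j → lam j ≤ lam i
  hN : ∀ i, n < i → lam i = 0
  conj : ∀ i j : ℕ, 1 ≤ i → 1 ≤ j → (j ≤ lam i ↔ i ≤ lamV j)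

section part
variable {n : ℕ} {lam lamV : ℕ → ℕ} (P : Part n lam lamV)
include P

lemma Part.monoV (i j : ℕ) (hi : 1 ≤ i) (hij : i ≤ j) : lamV j ≤ lamV i := by
  by_contra hc
  push Not at hc
  have h1 := (P.conj (lamV j) j (by omega) (by omega)).2 le_rfl
  have h2 := (P.conj (lamV j) i (by omega) hi).1 (by omega)
  omega

lemma Part.V_le (j : ℕ) (hj : 1 ≤ j) : lamV j ≤ n := by
  by_contra hc
  push Not at hc
  have h1 := (P.conj (lamV j) j (by omega) (by omega)).2 le_rfl
  have := P.hN _ hc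
  omega

lemma Part.ll_lt {i j : ℕ} (hi : 1 ≤ i) (hij : i < j) : ll n lam j < ll n lam i := by
  have := P.mono i j hi hij.le
  simp only [ll]; omega

lemma Part.ll_lt_iff {i j : ℕ} (hi : 1 ≤ i) (hj : 1 ≤ j) : ll n lam j < ll n lam i ↔ i < j := by
  constructor
  · intro h
    by_contra hc
    rcases Nat.lt_or_ge j i with h1 | h1
    · have := P.ll_lt hj h1; omega
    · have : i = j := by omega
      subst this; omega
  · exact P.ll_lt hi

lemma Part.cc_lt {i j : ℕ} (hi : 1 ≤ i) (hij : i < j) : cc n lamV i < cc n lamV j := by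
  have := P.monoV i j hi hij.le
  simp only [cc]; omega

lemma Part.cc_lt_iff {i j : ℕ} (hi : 1 ≤ i) (hj : 1 ≤ j) :
    cc n lamV i < cc n lamV j ↔ i < j := by
  constructor
  · intro h
    by_contra hc
    rcases Nat.lt_or_ge j i with h1 | h1
    · have := P.cc_lt hj h1; omega
    · have : i = j := by omega
      subst this; omega
  · exact P.cc_lt hi

lemma Part.cc_lt_ll {i j : ℕ} (hi : 1 ≤ i) (hj : 1 ≤ j) :
    cc n lamV j < ll n lam i ↔ j ≤ lam i := by
  have := P.conj i j hi hj
  simp only [cc, ll]; omega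

lemma Part.ll_lt_cc {i j : ℕ} (hi : 1 ≤ i) (hj : 1 ≤ j) :
    ll n lam i < cc n lamV j ↔ lam i < j := by
  have := P.conj i j hi hj
  simp only [cc, ll]; omega

lemma Part.cc_nonneg {j : ℕ} (hj : 1 ≤ j) : 0 ≤ cc n lamV j := by
  have := P.V_le j hj
  simp only [cc]; omega

omit P in
lemma ll_nonneg {j : ℕ} (hj : j ≤ n) : 0 ≤ ll n lam j := by
  simp only [ll]; omega

lemma Part.univ_eq (M : ℕ) (hM : ∀ i, 1 ≤ i → lam i ≤ M) :
    (Icc 1 n).image (ll n lam) ∪ (Icc 1 M).image (cc n lamV) = Ico (0 : ℤ) (n + M) := by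
  have hl : Set.InjOn (ll n lam) (Icc 1 n : Finset ℕ) := by
    intro a ha b hb hab
    simp only [coe_Icc, Set.mem_Icc] at ha hb
    have h1 := P.ll_lt_iff ha.1 hb.1
    have h2 := P.ll_lt_iff hb.1 ha.1
    omega
  have hc : Set.InjOn (cc n lamV) (Icc 1 M : Finset ℕ) := by
    intro a ha b hb hab
    simp only [coe_Icc, Set.mem_Icc] at ha hb
    have h1 := P.cc_lt_iff ha.1 hb.1
    have h2 := P.cc_lt_iff hb.1 ha.1
    omega
  apply Finset.eq_of_subset_of_card_le
  · intro x hx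
    simp only [mem_union, mem_image, mem_Icc, mem_Ico] at hx ⊢
    rcases hx with ⟨a, ha, rfl⟩ | ⟨a, ha, rfl⟩
    · refine ⟨ll_nonneg ha.2, ?_⟩
      have := hM a ha.1
      simp only [ll]; omega
    · refine ⟨P.cc_nonneg ha.1, ?_⟩
      simp only [cc]; omega
  · rw [card_union_of_disjoint, card_image_of_injOn hl, card_image_of_injOn hc]
    · simp
    · rw [Finset.disjoint_left]
      intro x hx hy
      simp only [mem_image, mem_Icc] at hx hy
      obtain ⟨a, ha, rfl⟩ := hx
      obtain ⟨b, hb, hab⟩ := hy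
      have h1 := P.cc_lt_ll ha.1 hb.1
      have h2 := P.ll_lt_cc ha.1 hb.1
      omega

lemma Part.prod_lt (M : ℕ) (hM : ∀ i, 1 ≤ i → lam i ≤ M) (R : ℤ → ℂ) (v : ℕ) (hv : v ≤ n + M) :
    (∏ j ∈ (Icc 1 n).filter (fun j => ll n lam j < v), R (ll n lam j)) *
    (∏ j ∈ (Icc 1 M).filter (fun j => cc n lamV j < v), R (cc n lamV j)) =
    ∏ x ∈ range v, R x := by
  have h := P.univ_eq M hM
  have e : ∏ x ∈ range v, R x = ∏ x ∈ (Ico (0 : ℤ) (n + M)).filter (fun x : ℤ => x < (v : ℤ)), R x := by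
    apply Finset.prod_bij (fun (x : ℕ) _ => (x : ℤ))
    · intro a ha; simp at ha ⊢; omega
    · intro a _ b _ hab; simpa using hab
    · intro b hb; simp at hb
      exact ⟨b.toNat, by simp; omega, by omega⟩
    · intros; rfl
  rw [e, ← h, filter_union, prod_union, filter_image, filter_image, prod_image, prod_image]
  · intro a ha b hb hab
    simp only [coe_filter, mem_Icc, Set.mem_setOf_eq] at ha hb
    have h1 := P.cc_lt_iff ha.1.1 hb.1.1
    have h2 := P.cc_lt_iff hb.1.1 ha.1.1
    omega
  · intro a ha b hb hab
    simp only [coe_filter, mem_Icc, Set.mem_setOf_eq] at ha hb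
    have h1 := P.ll_lt_iff ha.1.1 hb.1.1
    have h2 := P.ll_lt_iff hb.1.1 ha.1.1
    omega
  · rw [Finset.disjoint_left]
    intro x hx hy
    simp only [mem_filter, mem_image, mem_Icc] at hx hy
    obtain ⟨⟨a, ha, rfl⟩, _⟩ := hx
    obtain ⟨⟨b, hb, hab⟩, _⟩ := hy
    have h1 := P.cc_lt_ll ha.1 hb.1
    have h2 := P.ll_lt_cc ha.1 hb.1
    omega

end part

lemma pair_split (I : Finset ℕ) (p q : ℕ) (hp : p ∈ I) (hq : q ∈ I) (F : ℕ → ℕ → ℂ) :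
    ∏ i ∈ I, ∏ j ∈ I, F i j = (∏ i ∈ I.erase p, ∏ j ∈ I.erase q, F i j) *
      (∏ j ∈ I.erase q, F p j) * (∏ i ∈ I.erase p, F i q) * F p q := by
  rw [← mul_prod_erase I _ hp, ← mul_prod_erase I (F p) hq]
  rw [Finset.prod_congr rfl (fun i _ => (mul_prod_erase I (F i) hq).symm), prod_mul_distrib]
  ring

lemma pair_ratio (I : Finset ℕ) (p : ℕ) (hp : p ∈ I) (F F' : ℕ → ℕ → ℂ) (G : ℕ → ℂ)
    (h0 : ∀ i ∈ I, ∀ j ∈ I, i ≠ p → j ≠ p → F' i j = F i j)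
    (h1 : ∀ j ∈ I, j ≠ p → F' p j * F' j p = F p j * F j p * G j)
    (h2 : F' p p = F p p) :
    ∏ i ∈ I, ∏ j ∈ I, F' i j = (∏ i ∈ I, ∏ j ∈ I, F i j) * ∏ j ∈ I.erase p, G j := by
  rw [pair_split I p p hp hp F, pair_split I p p hp hp F']
  have e0 : ∏ i ∈ I.erase p, ∏ j ∈ I.erase p, F' i j = ∏ i ∈ I.erase p, ∏ j ∈ I.erase p, F i j := by
    refine prod_congr rfl fun i hi => prod_congr rfl fun j hj => ?_
    rw [mem_erase] at hi hj
    exact h0 i hi.2 j hj.2 hi.1 hj.1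
  have e1 : (∏ j ∈ I.erase p, F' p j) * (∏ j ∈ I.erase p, F' j p) =
      (∏ j ∈ I.erase p, F p j) * (∏ j ∈ I.erase p, F j p) * ∏ j ∈ I.erase p, G j := by
    rw [← prod_mul_distrib, ← prod_mul_distrib, ← prod_mul_distrib]
    refine prod_congr rfl fun j hj => ?_
    rw [mem_erase] at hj
    exact h1 j hj.2 hj.1
  rw [e0, h2]
  linear_combination (∏ i ∈ I.erase p, ∏ j ∈ I.erase p, F i j) * F p p * e1

lemma pair_ratio2 (I : Finset ℕ) (p q : ℕ) (hp : p ∈ I) (hq : q ∈ I) (F F' : ℕ → ℕ → ℂ)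
    (G G2 : ℕ → ℂ)
    (h0 : ∀ i ∈ I, ∀ j ∈ I, i ≠ p → j ≠ q → F' i j = F i j)
    (h1 : ∀ j ∈ I, j ≠ q → F' p j = F p j * G j)
    (h1' : ∀ i ∈ I, i ≠ p → F' i q = F i q * G2 i)
    (h2 : F' p q = F p q) :
    ∏ i ∈ I, ∏ j ∈ I, F' i j = (∏ i ∈ I, ∏ j ∈ I, F i j) *
      ((∏ j ∈ I.erase q, G j) * ∏ j ∈ I.erase p, G2 j) := by
  rw [pair_split I p q hp hq F, pair_split I p q hp hq F']
  have e0 : ∏ i ∈ I.erase p, ∏ j ∈ I.erase q, F' i j = ∏ i ∈ I.erase p, ∏ j ∈ I.erase q, F i j := by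
    refine prod_congr rfl fun i hi => prod_congr rfl fun j hj => ?_
    rw [mem_erase] at hi hj
    exact h0 i hi.2 j hj.2 hi.1 hj.1
  have e1 : (∏ j ∈ I.erase q, F' p j) = (∏ j ∈ I.erase q, F p j) * ∏ j ∈ I.erase q, G j := by
    rw [← prod_mul_distrib]
    refine prod_congr rfl fun j hj => ?_
    rw [mem_erase] at hj
    exact h1 j hj.2 hj.1
  have e2 : (∏ j ∈ I.erase p, F' j q) = (∏ j ∈ I.erase p, F j q) * ∏ j ∈ I.erase p, G2 j := by
    rw [← prod_mul_distrib]
    refine prod_congr rfl fun j hj => ?_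
    rw [mem_erase] at hj
    exact h1' j hj.2 hj.1
  rw [e0, h2, e1, e2]
  ring

noncomputable def Dp (s : ℂ) (n M : ℕ) (lam lamV : ℕ → ℕ) : ℂ :=
  ∏ i ∈ Icc 1 M, if i ≤ lam i then qint s (ll n lam i) * tt s (cc n lamV i) else 1

noncomputable def Ap (s : ℂ) (n M : ℕ) (lam : ℕ → ℕ) : ℂ :=
  ∏ i ∈ Icc 1 M, ∏ j ∈ Icc 1 M,
    if i < j ∧ j ≤ lam i then qint s (ll n lam i + ll n lam j) else 1

noncomputable def Bp (s : ℂ) (n M : ℕ) (lam lamV : ℕ → ℕ) : ℂ :=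
  ∏ i ∈ Icc 1 M, ∏ j ∈ Icc 1 M,
    if j < i ∧ j ≤ lam i then qint s (cc n lamV i + cc n lamV j) else 1

noncomputable def Hp (s : ℂ) (n M : ℕ) (lam lamV : ℕ → ℕ) : ℂ :=
  ∏ i ∈ Icc 1 M, ∏ j ∈ Icc 1 M,
    if j ≤ lam i then qint s (ll n lam i - cc n lamV j) else 1

noncomputable def Tp (s : ℂ) (n : ℕ) (lam : ℕ → ℕ) : ℂ :=
  ∏ i ∈ Icc 1 n, ∏ j ∈ Icc 1 n, if i < j then qint s (ll n lam i + ll n lam j) else 1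

noncomputable def Tm (s : ℂ) (n : ℕ) (lam : ℕ → ℕ) : ℂ :=
  ∏ i ∈ Icc 1 n, ∏ j ∈ Icc 1 n, if i < j then qint s (ll n lam i - ll n lam j) else 1

/-- Adding the box `(p,q)`. -/
structure Step (n M p q : ℕ) (lam lamV lam' lamV' : ℕ → ℕ) : Prop where
  P : Part n lam lamV
  P' : Part n lam' lamV'
  hp : 1 ≤ p
  hpn : p ≤ n
  hnM : n ≤ M
  hqM : q ≤ M
  hM : ∀ i, 1 ≤ i → lam i ≤ M
  lp : lam p + 1 = q
  lp' : lam' p = q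
  vq : lamV q + 1 = p
  vq' : lamV' q = p
  lo : ∀ i, i ≠ p → lam' i = lam i
  vo : ∀ j, j ≠ q → lamV' j = lamV j

noncomputable def Rr (s : ℂ) (L x : ℤ) : ℂ := qint s (L + 1 + x) / qint s (L + x)
noncomputable def Vr (s : ℂ) (L x : ℤ) : ℂ := qint s (L + 1 - x) / qint s (L - x)

section step
variable {s : ℂ} (h : NR s) {n M p q : ℕ} {lam lamV lam' lamV' : ℕ → ℕ}
  (S : Step n M p q lam lamV lam' lamV')
include S

lemma Step.ll'p : ll n lam' p = ll n lam p + 1 := by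
  have := S.lp; have := S.lp'
  simp only [ll]; omega

lemma Step.cc'q : cc n lamV' q = ll n lam p := by
  have := S.lp; have := S.vq'
  simp only [ll, cc]; omega

lemma Step.ccq : cc n lamV q = ll n lam p + 1 := by
  have := S.lp; have := S.vq
  simp only [ll, cc]; omega

lemma Step.ll'o {i : ℕ} (hi : i ≠ p) : ll n lam' i = ll n lam i := by
  simp only [ll, S.lo i hi]

lemma Step.cc'o {i : ℕ} (hi : i ≠ q) : cc n lamV' i = cc n lamV i := by
  simp only [cc, S.vo i hi]

lemma Step.Lnn : 0 ≤ ll n lam p := ll_nonneg S.hpn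

lemma Step.add_ne {j : ℕ} (hj : 1 ≤ j) (hjp : j ≠ p) (hj' : j ≤ n ∨ j < q) :
    ll n lam p + ll n lam j ≠ 0 := by
  have h1 := S.P.ll_lt_iff hj S.hp
  have h2 := S.P.ll_lt_iff S.hp hj
  have := S.lp
  have := S.hpn
  have := S.hp
  have h0 := S.Lnn
  by_cases hjn : j ≤ n
  · have : 0 ≤ ll n lam j := ll_nonneg hjn
    omega
  · simp only [ll] at *
    omega

include h

lemma Step.ratA : Ap s n M lam' = Ap s n M lam *
    ((∏ j ∈ (Icc 1 M).filter (fun j => j < p ∧ p ≤ lam j ∨ p < j ∧ j < q),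
        Rr s (ll n lam p) (ll n lam j)) *
      (if p < q then qint s (ll n lam p + 1 + ll n lam q) else 1)) := by
  have hq : 1 ≤ q := by have := S.lp; omega
  unfold Ap
  rw [pair_ratio (Icc 1 M) p (by have := S.hp; have := S.hpn; have := S.hnM; simp; omega)
    (fun i j => if i < j ∧ j ≤ lam i then qint s (ll n lam i + ll n lam j) else 1)
    (fun i j => if i < j ∧ j ≤ lam' i then qint s (ll n lam' i + ll n lam' j) else 1)
    (fun j => (if j < p ∧ p ≤ lam j ∨ p < j ∧ j < q then Rr s (ll n lam p) (ll n lam j) else 1) *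
      (if j = q then (if p < q then qint s (ll n lam p + 1 + ll n lam q) else 1) else 1))]
  · congr 1
    rw [prod_mul_distrib, ← prod_filter]
    congr 1
    · apply prod_congr _ (fun _ _ => rfl)
      ext j
      simp only [mem_filter, mem_erase]
      constructor
      · tauto
      · rintro ⟨h1, h2⟩
        exact ⟨⟨by omega, h1⟩, h2⟩
    · rw [prod_ite_eq']
      have := S.hqM
      simp only [mem_erase, mem_Icc]
      split_ifs <;> first | rfl | (exfalso; omega)
  · intro i _ j _ hi hj
    simp only [S.lo i hi, S.ll'o hi, S.ll'o hj]
  · intro j hj hjp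
    simp only [mem_Icc] at hj
    simp only [S.lo j hjp, S.ll'o hjp, S.ll'p, S.lp']
    have hlp := S.lp
    have key : (j ≤ n ∨ j < q) → qint s (ll n lam p + ll n lam j) ≠ 0 := fun hh =>
      br_ne h (S.add_ne hj.1 hjp hh)
    have hpn := S.hpn
    rcases lt_or_gt_of_ne hjp with hlt | hgt
    · have e1 : ¬ (p < j ∧ j ≤ q) := by omega
      have e2 : ¬ (p < j ∧ j ≤ lam p) := by omega
      have e3 : (j < p ∧ p ≤ lam j ∨ p < j ∧ j < q) ↔ (j < p ∧ p ≤ lam j) := by omega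
      simp only [e1, e2, e3, if_false, one_mul]
      have e4 : (if j = q then (if p < q then qint s (ll n lam p + 1 + ll n lam q) else 1) else 1) = 1 := by
        split_ifs <;> first | rfl | (exfalso; omega)
      rw [e4]
      have := key (by omega)
      split_ifs
      · unfold Rr
        rw [add_comm (ll n lam j) (ll n lam p), add_comm (ll n lam j) (ll n lam p + 1)]
        field_simp
      · simp
    · have e1 : ¬ (j < p ∧ p ≤ lam j) := by omega
      simp only [e1, if_false, mul_one, false_or]
      by_cases hjq : j = q
      · subst hjq
        have e2 : ¬ (j ≤ lam p) := by omega
        simp [hgt, e2]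
      · by_cases hjq' : j < q
        · have e2 : j ≤ q := by omega
          have e3 : j ≤ lam p := by omega
          simp only [hgt, hjq, hjq', e2, e3, if_true, if_false, and_self, mul_one, Rr]
          have := key (by omega)
          field_simp
        · have e2 : ¬ (j ≤ q) := by omega
          have e3 : ¬ (j ≤ lam p) := by omega
          simp [hjq, hjq', e2, e3]
  · simp

lemma Step.ratB : Bp s n M lam' lamV' = Bp s n M lam lamV *
    ((∏ j ∈ (Icc 1 M).filter (fun j => j < q ∧ j ≤ lam q ∨ q < j ∧ j < p),
        (Rr s (ll n lam p) (cc n lamV j))⁻¹) *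
      (if q < p then qint s (ll n lam p + cc n lamV p) else 1)) := by
  have hq : 1 ≤ q := by have := S.lp; omega
  have hlp := S.lp
  have hvq := S.vq
  have hqM := S.hqM
  have hnM := S.hnM
  have hp := S.hp
  have hpn := S.hpn
  unfold Bp
  rw [pair_ratio (Icc 1 M) q (by simp; omega)
    (fun i j => if j < i ∧ j ≤ lam i then qint s (cc n lamV i + cc n lamV j) else 1)
    (fun i j => if j < i ∧ j ≤ lam' i then qint s (cc n lamV' i + cc n lamV' j) else 1)
    (fun j => (if j < q ∧ j ≤ lam q ∨ q < j ∧ j < p then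
        (Rr s (ll n lam p) (cc n lamV j))⁻¹ else 1) *
      (if j = p then (if q < p then qint s (ll n lam p + cc n lamV p) else 1) else 1))]
  · congr 1
    rw [prod_mul_distrib, ← prod_filter]
    congr 1
    · apply prod_congr _ (fun _ _ => rfl)
      ext j
      simp only [mem_filter, mem_erase]
      constructor
      · tauto
      · rintro ⟨h1, h2⟩
        exact ⟨⟨by omega, h1⟩, h2⟩
    · rw [prod_ite_eq']
      simp only [mem_erase, mem_Icc]
      split_ifs <;> first | rfl | (exfalso; omega)
  · intro i _ j _ hi hj
    simp only [S.cc'o hi, S.cc'o hj]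
    by_cases hip : i = p
    · subst hip
      have : j ≤ lam' i ↔ j ≤ lam i := by rw [S.lp']; omega
      simp only [this]
    · simp only [S.lo i hip]
  · intro j hj hjq
    simp only [mem_Icc] at hj
    simp only [S.cc'o hjq, S.cc'q, S.ccq]
    have key : qint s (ll n lam p + 1 + cc n lamV j) ≠ 0 := by
      apply br_ne h
      have := S.Lnn
      have := S.P.cc_nonneg hj.1
      omega
    rw [add_comm (cc n lamV j) (ll n lam p), add_comm (cc n lamV j) (ll n lam p + 1)]
    unfold Rr
    rcases lt_or_gt_of_ne hjq with hlt | hgt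
    · have e1 : ¬ (q < j ∧ q ≤ lam' j) := by omega
      have e2 : ¬ (q < j ∧ q ≤ lam j) := by omega
      have e3 : (j < q ∧ j ≤ lam q ∨ q < j ∧ j < p) ↔ (j < q ∧ j ≤ lam q) := by omega
      have e5 : (j < q ∧ j ≤ lam' q) ↔ (j < q ∧ j ≤ lam q) := by
        by_cases hqp : q = p
        · subst hqp
          rw [S.lp']; omega
        · rw [S.lo q hqp]
      have e4 : (if j = p then (if q < p then qint s (ll n lam p + cc n lamV p) else 1) else 1) = 1 := by
        split_ifs <;> first | rfl | (exfalso; omega)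
      simp only [e1, e2, e3, e5, e4, if_false, mul_one]
      split_ifs
      · rw [inv_div]
        field_simp
      · simp
    · have e1 : ¬ (j < q ∧ j ≤ lam q) := by omega
      have e2 : ¬ (j < q ∧ j ≤ lam' q) := by omega
      simp only [e1, e2, if_false, one_mul, false_or]
      have hc := S.P.conj j q hj.1 hq
      by_cases hjp : j = p
      · subst hjp
        have e2 : ¬ (q ≤ lam j) := by omega
        have e3 : q ≤ lam' j := by rw [S.lp']
        simp [hgt, e2, e3]
      · rw [S.lo j hjp]
        by_cases hjp' : j < p
        · have e3 : q ≤ lam j := by omega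
          simp only [hgt, hjp, hjp', e3, if_true, if_false, and_self, mul_one]
          rw [inv_div]
          field_simp
        · have e3 : ¬ (q ≤ lam j) := by omega
          simp [hjp, hjp', e3]
  · simp

lemma Step.V_ne {i : ℕ} (hi : 1 ≤ i) (hip : i < p) : Vr s (ll n lam p) (ll n lam i) ≠ 0 := by
  have hq : 1 ≤ q := by have := S.lp; omega
  have h1 := S.P.ll_lt_iff hi S.hp
  have h2 := S.P.cc_lt_ll hi hq
  have h3 := S.P.ll_lt_cc hi hq
  have h4 := S.ccq
  exact div_ne_zero (br_ne h (by omega)) (br_ne h (by omega))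

lemma Step.ratH : Hp s n M lam' lamV' * (∏ i ∈ Ico 1 p, Vr s (ll n lam p) (ll n lam i)) =
    Hp s n M lam lamV * (∏ j ∈ Ico 1 q, Vr s (ll n lam p) (cc n lamV j)) := by
  have hq : 1 ≤ q := by have := S.lp; omega
  have hlp := S.lp
  have hvq := S.vq
  have hqM := S.hqM
  have hnM := S.hnM
  have hp := S.hp
  have hpn := S.hpn
  have hne : (∏ i ∈ Ico 1 p, Vr s (ll n lam p) (ll n lam i)) ≠ 0 := by
    rw [prod_ne_zero_iff]
    intro i hi
    rw [mem_Ico] at hi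
    exact S.V_ne h hi.1 hi.2
  rw [← eq_mul_inv_iff_mul_eq₀ hne, mul_assoc, ← prod_inv_distrib]
  unfold Hp
  rw [pair_ratio2 (Icc 1 M) p q (by simp; omega) (by simp; omega)
    (fun i j => if j ≤ lam i then qint s (ll n lam i - cc n lamV j) else 1)
    (fun i j => if j ≤ lam' i then qint s (ll n lam' i - cc n lamV' j) else 1)
    (fun j => if j < q then Vr s (ll n lam p) (cc n lamV j) else 1)
    (fun i => if i < p then (Vr s (ll n lam p) (ll n lam i))⁻¹ else 1)]
  · congr 1
    rw [← prod_filter, ← prod_filter]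
    congr 1
    · apply prod_congr _ (fun _ _ => rfl)
      ext j
      simp only [mem_filter, mem_erase, mem_Icc, mem_Ico]
      omega
    · apply prod_congr _ (fun _ _ => rfl)
      ext j
      simp only [mem_filter, mem_erase, mem_Icc, mem_Ico]
      omega
  · intro i _ j _ hi hj
    simp only [S.lo i hi, S.ll'o hi, S.cc'o hj]
  · intro j hj hjq
    simp only [mem_Icc] at hj
    simp only [S.cc'o hjq, S.ll'p, S.lp']
    have hc := S.P.cc_lt_ll hp hj.1
    by_cases hlt : j < q
    · have e1 : j ≤ q := by omega
      have e2 : j ≤ lam p := by omega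
      simp only [e1, e2, hlt, if_true, Vr]
      have : qint s (ll n lam p - cc n lamV j) ≠ 0 := br_ne h (by omega)
      field_simp
    · have e1 : ¬ j ≤ q := by omega
      have e2 : ¬ j ≤ lam p := by omega
      simp [e1, e2, hlt]
  · intro i hi hip
    simp only [mem_Icc] at hi
    simp only [S.ll'o hip, S.lo i hip, S.cc'q, S.ccq]
    have hc := S.P.conj i q hi.1 hq
    have hcl := S.P.cc_lt_ll hi.1 hq
    rw [S.ccq] at hcl
    by_cases hlt : i < p
    · have e1 : q ≤ lam i := by omega
      simp only [e1, hlt, if_true, Vr]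
      rw [inv_div, ← neg_sub _ (ll n lam i), ← neg_sub _ (ll n lam i), br_neg, br_neg]
      have : qint s (ll n lam p + 1 - ll n lam i) ≠ 0 := br_ne h (by omega)
      field_simp
    · have e1 : ¬ q ≤ lam i := by omega
      simp [e1, hlt]
  · have e1 : ¬ q ≤ lam p := by omega
    simp only [S.lp', le_refl, if_true, e1, if_false, S.ll'p, S.cc'q]
    rw [add_sub_cancel_left, br_one h]

lemma Step.ratTp : Tp s n lam' = Tp s n lam *
    ∏ j ∈ (Icc 1 n).erase p, Rr s (ll n lam p) (ll n lam j) := by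
  unfold Tp
  apply pair_ratio _ _ (by simp [S.hp, S.hpn])
  · intro i _ j _ hi hj
    simp only [S.ll'o hi, S.ll'o hj]
  · intro j hj hjp
    simp only [mem_Icc] at hj
    simp only [S.ll'o hjp, S.ll'p]
    have := br_ne h (S.add_ne hj.1 hjp (by omega))
    rw [add_comm (ll n lam j) (ll n lam p), add_comm (ll n lam j) (ll n lam p + 1)]
    unfold Rr
    rcases lt_or_gt_of_ne hjp with hlt | hgt
    · have : ¬ p < j := by omega
      simp only [hlt, this, if_true, if_false]
      field_simp
    · have : ¬ j < p := by omega
      simp only [hgt, this, if_true, if_false]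
      field_simp
  · simp

lemma Step.ratTm : Tm s n lam' = Tm s n lam *
    ∏ j ∈ (Icc 1 n).erase p, Vr s (ll n lam p) (ll n lam j) := by
  unfold Tm
  apply pair_ratio _ _ (by simp [S.hp, S.hpn])
  · intro i _ j _ hi hj
    simp only [S.ll'o hi, S.ll'o hj]
  · intro j hj hjp
    simp only [mem_Icc] at hj
    simp only [S.ll'o hjp, S.ll'p]
    have hne : qint s (ll n lam p - ll n lam j) ≠ 0 := by
      apply br_ne h
      have h1 := S.P.ll_lt_iff hj.1 S.hp
      have h2 := S.P.ll_lt_iff S.hp hj.1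
      omega
    unfold Vr
    rcases lt_or_gt_of_ne hjp with hlt | hgt
    · have : ¬ p < j := by omega
      simp only [hlt, this, if_true, if_false]
      rw [← neg_sub (ll n lam p), ← neg_sub (ll n lam p + 1), br_neg, br_neg]
      field_simp
    · have : ¬ j < p := by omega
      simp only [hgt, this, if_true, if_false]
      field_simp
  · simp

end step

lemma telR {s : ℂ} (h : NR s) (L : ℤ) (hL : 0 < L) (k : ℕ) :
    ∏ x ∈ range k, Rr s L x = qint s (L + k) / qint s L := by
  induction k with
  | zero => have := br_ne h hL.ne'; simp [this]
  | succ k ih =>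
    rw [prod_range_succ, ih, Rr]
    have h1 : qint s L ≠ 0 := br_ne h (by omega)
    have h2 : qint s (L + k) ≠ 0 := br_ne h (by omega)
    have e : L + ((k + 1 : ℕ) : ℤ) = L + 1 + k := by push_cast; ring
    rw [e]
    field_simp

lemma telV {s : ℂ} (h : NR s) (L k : ℕ) (hk : k ≤ L) :
    ∏ x ∈ range k, Vr s L x = qint s (L + 1) / qint s (L + 1 - k) := by
  induction k with
  | zero =>
    have : qint s ((L : ℤ) + 1) ≠ 0 := br_ne h (by omega)
    simp [this]
  | succ k ih =>
    rw [prod_range_succ, ih (by omega), Vr]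
    have h1 : qint s ((L : ℤ) + 1 - k) ≠ 0 := br_ne h (by omega)
    have h2 : qint s ((L : ℤ) - k) ≠ 0 := br_ne h (by omega)
    have e : (L : ℤ) + 1 - ((k + 1 : ℕ) : ℤ) = L - k := by push_cast; ring
    rw [e]
    field_simp

lemma telN {s : ℂ} (h : NR s) (L : ℤ) (n k : ℕ) (hk : (k : ℤ) < L) :
    ∏ j ∈ Ico (n + 1) (n + 1 + k), Rr s L ((n : ℤ) - j) = qint s L / qint s (L - k) := by
  induction k with
  | zero => have : qint s L ≠ 0 := br_ne h (by simp at hk; omega)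
            simp [this]
  | succ k ih =>
    rw [← add_assoc, prod_Ico_succ_top (by omega), ih (by push_cast at hk; omega), Rr]
    push_cast at hk
    have h1 : qint s (L - k) ≠ 0 := br_ne h (by omega)
    have h2 : qint s (L - (k + 1)) ≠ 0 := br_ne h (by omega)
    have e1 : L + 1 + ((n : ℤ) - ((n + 1 + k : ℕ) : ℤ)) = L - k := by push_cast; ring
    have e2 : L + ((n : ℤ) - ((n + 1 + k : ℕ) : ℤ)) = L - (k + 1) := by push_cast; ring
    have e3 : L - ((k + 1 : ℕ) : ℤ) = L - (k + 1) := by push_cast; ring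
    rw [e1, e2, e3]
    field_simp

/-- modified `Rr`, skipping `L` and `L+1`. -/
noncomputable def Rm (s : ℂ) (L x : ℤ) : ℂ := if x = L ∨ x = L + 1 then 1 else Rr s L x

lemma telRm {s : ℂ} (h : NR s) (L k : ℕ) (hL : 0 < L) (hk : L + 2 ≤ k) :
    (∏ x ∈ range k, Rm s L x) * (qint s (L + 1) * tt s (L + 1)) =
      tt s L * qint s (L + k) := by
  have e := telR h L (by omega) k
  have e2 : ∏ x ∈ range k, Rr s L x = (∏ x ∈ range k, Rm s L x) *
      (Rr s L L * Rr s L (L + 1)) := by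
    have : ∀ x ∈ range k, Rr s L x = Rm s L x * ((if x = L then Rr s L L else 1) *
        (if x = L + 1 then Rr s L (L + 1) else 1)) := by
      intro x _
      unfold Rm
      by_cases h1 : x = L
      · subst h1; simp
      · by_cases h2 : x = L + 1
        · subst h2; simp
        · have : ¬ ((x : ℤ) = L ∨ (x : ℤ) = L + 1) := by omega
          simp only [this, h1, h2, if_false, mul_one]
    rw [prod_congr rfl this, prod_mul_distrib, prod_mul_distrib, prod_ite_eq', prod_ite_eq']
    simp only [mem_range, show L < k by omega, show L + 1 < k by omega, if_true]
  rw [e2] at e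
  have b1 := br_two h (L : ℤ)
  have b2 := br_two h ((L : ℤ) + 1)
  have n1 : qint s (L : ℤ) ≠ 0 := br_ne h (by omega)
  have n2 : qint s ((L : ℤ) + L) ≠ 0 := br_ne h (by omega)
  have n3 : qint s ((L : ℤ) + 1 + L) ≠ 0 := br_ne h (by omega)
  have e3 : (Rr s L L * Rr s L (L + 1)) = qint s ((L : ℤ) + 1 + (L + 1)) / qint s ((L : ℤ) + L) := by
    unfold Rr
    rw [show (L : ℤ) + (L + 1) = L + 1 + L by ring]
    field_simp
  rw [e3, b2, b1, ] at e
  have n4 : tt s (L : ℤ) ≠ 0 := tt_ne h (by omega)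
  field_simp at e
  linear_combination e

lemma telRm0 {s : ℂ} (h : NR s) (k : ℕ) :
    (∏ x ∈ range (k + 2), Rm s 0 x) * qint s 2 = qint s (k + 2) := by
  induction k with
  | zero => simp [prod_range_succ, Rm]
  | succ k ih =>
    rw [prod_range_succ, mul_right_comm, ih]
    have : ¬ (((k + 2 : ℕ) : ℤ) = 0 ∨ ((k + 2 : ℕ) : ℤ) = 0 + 1) := by omega
    simp only [Rm, this, if_false, Rr]
    have n1 : qint s ((k : ℤ) + 2) ≠ 0 := br_ne h (by omega)
    have e1 : (0 : ℤ) + 1 + ((k + 2 : ℕ) : ℤ) = ((k + 1 : ℕ) : ℤ) + 2 := by push_cast; ring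
    have e2 : (0 : ℤ) + ((k + 2 : ℕ) : ℤ) = k + 2 := by push_cast; ring
    rw [e1, e2]
    field_simp

noncomputable def ep (n : ℕ) (lam : ℕ → ℕ) : ℂ := if lam n = 0 then 1 else 2

lemma ep_ne (n : ℕ) (lam : ℕ → ℕ) : ep n lam ≠ 0 := by
  unfold ep; split_ifs <;> norm_num

section step
variable {s : ℂ} (h : NR s) {n M p q : ℕ} {lam lamV lam' lamV' : ℕ → ℕ}
  (S : Step n M p q lam lamV lam' lamV')
include S

lemma Step.ep_eq (hL : 0 < ll n lam p) : ep n lam' = ep n lam := by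
  have h1 := S.lp
  have h2 := S.lp'
  unfold ep
  by_cases hnp : n = p
  · subst hnp
    simp only [ll] at hL
    have a1 : lam' n ≠ 0 := by omega
    have a2 : lam n ≠ 0 := by omega
    simp [a1, a2]
  · rw [S.lo n hnp]

lemma Step.ep_zero (hL : ll n lam p = 0) : ep n lam = 1 ∧ ep n lam' = 2 := by
  have h1 := S.lp
  have h2 := S.lp'
  have h3 := S.hpn
  unfold ep
  simp only [ll] at hL
  have hnp : n = p := by omega
  subst hnp
  have a1 : lam' n ≠ 0 := by omega
  have a2 : lam n = 0 := by omega
  simp [a1, a2]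

include h

lemma Step.Vid : (∏ j ∈ Ioc p n, Vr s (ll n lam p) (ll n lam j)) *
    (∏ j ∈ Ico 1 q, Vr s (ll n lam p) (cc n lamV j)) = qint s (ll n lam p + 1) := by
  obtain ⟨L, hL⟩ := Int.eq_ofNat_of_zero_le S.Lnn
  have hp := S.hp
  have hlp := S.lp
  have hqM := S.hqM
  have e := S.P.prod_lt M S.hM (Vr s (ll n lam p)) L (by simp only [ll] at hL; omega)
  have f1 : (Icc 1 n).filter (fun j => ll n lam j < (L : ℤ)) = Ioc p n := by
    ext j
    simp only [mem_filter, mem_Icc, mem_Ioc, ← hL]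
    constructor
    · rintro ⟨a, b⟩
      exact ⟨(S.P.ll_lt_iff hp a.1).1 b, a.2⟩
    · rintro ⟨a, b⟩
      exact ⟨⟨by omega, b⟩, S.P.ll_lt hp a⟩
  have f2 : (Icc 1 M).filter (fun j => cc n lamV j < (L : ℤ)) = Ico 1 q := by
    ext j
    simp only [mem_filter, mem_Icc, mem_Ico, ← hL]
    constructor
    · rintro ⟨a, b⟩
      have := (S.P.cc_lt_ll hp a.1).1 b
      omega
    · rintro ⟨a, b⟩
      exact ⟨⟨a, by omega⟩, (S.P.cc_lt_ll hp a).2 (by omega)⟩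
  rw [f1, f2] at e
  rw [e, hL, telV h L L le_rfl, show (L : ℤ) + 1 - L = 1 by ring, br_one h, div_one]

lemma Step.ratHT : Tm s n lam' * Hp s n M lam' lamV' =
    Tm s n lam * Hp s n M lam lamV * qint s (ll n lam p + 1) := by
  rw [S.ratTm h, ← S.Vid h]
  have e := S.ratH h
  have e2 : ∏ j ∈ (Icc 1 n).erase p, Vr s (ll n lam p) (ll n lam j) =
      (∏ i ∈ Ico 1 p, Vr s (ll n lam p) (ll n lam i)) *
      (∏ j ∈ Ioc p n, Vr s (ll n lam p) (ll n lam j)) := by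
    rw [← prod_union]
    · apply prod_congr _ (fun _ _ => rfl)
      have := S.hp
      have := S.hpn
      ext j
      simp only [mem_erase, mem_Icc, mem_union, mem_Ico, mem_Ioc]
      omega
    · rw [Finset.disjoint_left]
      intro j
      simp only [mem_Ico, mem_Ioc]
      omega
  rw [e2]
  linear_combination (Tm s n lam * (∏ j ∈ Ioc p n, Vr s (ll n lam p) (ll n lam j))) * e

lemma Step.Rc_ne {j : ℕ} (hj : 1 ≤ j) (hL : 0 < ll n lam p ∨ cc n lamV j ≠ 0) :
    Rr s (ll n lam p) (cc n lamV j) ≠ 0 := by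
  have := S.P.cc_nonneg hj
  have := S.Lnn
  exact div_ne_zero (br_ne h (by omega)) (br_ne h (by omega))

/-- case `p < q` -/
lemma Step.case1 (hpq : p < q) :
    (∏ j ∈ (Ico 1 q).erase p, Rr s (ll n lam p) (ll n lam j)) *
      qint s (ll n lam p + 1 + ll n lam q) =
    (∏ j ∈ (Icc 1 n).erase p, Rr s (ll n lam p) (ll n lam j)) *
      (∏ j ∈ Icc 1 (lam q), Rr s (ll n lam p) (cc n lamV j)) * qint s (ll n lam p) := by
  have hp := S.hp
  have hpn := S.hpn
  have hlp := S.lp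
  have hqM := S.hqM
  have hLpos : 0 < ll n lam p := by simp only [ll]; omega
  have hL0 : qint s (ll n lam p) ≠ 0 := br_ne h hLpos.ne'
  by_cases hqn : q ≤ n
  · obtain ⟨v, hv⟩ := Int.eq_ofNat_of_zero_le (ll_nonneg (lam := lam) hqn)
    have hMq := S.hM q (by omega)
    have e := S.P.prod_lt M S.hM (Rr s (ll n lam p)) (v + 1) (by simp only [ll] at hv; omega)
    have f1 : (Icc 1 n).filter (fun j => ll n lam j < ((v + 1 : ℕ) : ℤ)) = Icc q n := by
      ext j
      simp only [mem_filter, mem_Icc]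
      push_cast
      rw [← hv]
      constructor
      · rintro ⟨a, b⟩
        have := S.P.ll_lt_iff (i := j) (j := q) a.1 (by omega)
        omega
      · rintro ⟨a, b⟩
        have := S.P.ll_lt_iff (i := j) (j := q) (by omega) (by omega)
        omega
    have f2 : (Icc 1 M).filter (fun j => cc n lamV j < ((v + 1 : ℕ) : ℤ)) = Icc 1 (lam q) := by
      ext j
      simp only [mem_filter, mem_Icc]
      push_cast
      rw [← hv]
      constructor
      · rintro ⟨a, b⟩
        have := S.P.cc_lt_ll (i := q) (j := j) (by omega) a.1
        have := S.P.ll_lt_cc (i := q) (j := j) (by omega) a.1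
        omega
      · rintro ⟨a, b⟩
        have := S.P.cc_lt_ll (i := q) (j := j) (by omega) a
        omega
    rw [f1, f2, telR h _ hLpos] at e
    have e2 : ∏ j ∈ (Icc 1 n).erase p, Rr s (ll n lam p) (ll n lam j) =
        (∏ i ∈ (Ico 1 q).erase p, Rr s (ll n lam p) (ll n lam i)) *
        (∏ j ∈ Icc q n, Rr s (ll n lam p) (ll n lam j)) := by
      rw [← prod_union]
      · apply prod_congr _ (fun _ _ => rfl)
        ext j
        simp only [mem_erase, mem_Icc, mem_union, mem_Ico]
        omega
      · rw [Finset.disjoint_left]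
        intro j
        simp only [mem_erase, mem_Ico, mem_Icc]
        omega
    rw [e2, mul_assoc (∏ i ∈ (Ico 1 q).erase p, Rr s (ll n lam p) (ll n lam i)), e, mul_assoc,
      div_mul_cancel₀ _ hL0, hv]
    congr 2
    push_cast; ring
  · have hlq := S.P.hN q (by omega)
    have e2 : (∏ i ∈ (Ico 1 q).erase p, Rr s (ll n lam p) (ll n lam i)) =
        (∏ j ∈ (Icc 1 n).erase p, Rr s (ll n lam p) (ll n lam j)) *
        (∏ j ∈ Ico (n + 1) q, Rr s (ll n lam p) (ll n lam j)) := by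
      rw [← prod_union]
      · apply prod_congr _ (fun _ _ => rfl)
        ext j
        simp only [mem_erase, mem_Icc, mem_union, mem_Ico]
        omega
      · rw [Finset.disjoint_left]
        intro j
        simp only [mem_erase, mem_Ico, mem_Icc]
        omega
    obtain ⟨k, rfl⟩ : ∃ k, q = n + 1 + k := ⟨q - (n + 1), by omega⟩
    have e3 : ∏ j ∈ Ico (n + 1) (n + 1 + k), Rr s (ll n lam p) (ll n lam j) =
        ∏ j ∈ Ico (n + 1) (n + 1 + k), Rr s (ll n lam p) ((n : ℤ) - j) := by
      apply prod_congr rfl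
      intro j hj
      rw [mem_Ico] at hj
      have := S.P.hN j (by omega)
      simp only [ll, this]
      simp
    have hk : (k : ℤ) < ll n lam p := by simp only [ll]; omega
    rw [e2, e3, telN h _ n k hk, hlq]
    have e4 : ll n lam p + 1 + ll n lam (n + 1 + k) = ll n lam p - k := by
      simp only [ll, hlq]; push_cast; ring
    rw [e4]
    have : qint s (ll n lam p - k) ≠ 0 := br_ne h (by omega)
    simp
    field_simp

/-- case `p = q` -/
lemma Step.case2 (hpq : p = q) :
    ep n lam * tt s (ll n lam p) = ep n lam' * ((∏ j ∈ Ioc p n, Rr s (ll n lam p) (ll n lam j)) *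
      (∏ j ∈ Ico 1 p, Rr s (ll n lam p) (cc n lamV j))) := by
  obtain ⟨L, hL⟩ := Int.eq_ofNat_of_zero_le S.Lnn
  have hp := S.hp
  have hlp := S.lp
  have hqM := S.hqM
  have e := S.P.prod_lt M S.hM (Rr s (ll n lam p)) L (by simp only [ll] at hL; omega)
  have f1 : (Icc 1 n).filter (fun j => ll n lam j < (L : ℤ)) = Ioc p n := by
    ext j
    simp only [mem_filter, mem_Icc, mem_Ioc, ← hL]
    constructor
    · rintro ⟨a, b⟩
      exact ⟨(S.P.ll_lt_iff hp a.1).1 b, a.2⟩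
    · rintro ⟨a, b⟩
      exact ⟨⟨by omega, b⟩, S.P.ll_lt hp a⟩
  have f2 : (Icc 1 M).filter (fun j => cc n lamV j < (L : ℤ)) = Ico 1 p := by
    ext j
    simp only [mem_filter, mem_Icc, mem_Ico, ← hL]
    constructor
    · rintro ⟨a, b⟩
      have := (S.P.cc_lt_ll hp a.1).1 b
      omega
    · rintro ⟨a, b⟩
      exact ⟨⟨a, by omega⟩, (S.P.cc_lt_ll hp a).2 (by omega)⟩
  rw [f1, f2] at e
  rw [e]
  rcases Nat.eq_zero_or_pos L with h0 | h0
  · subst h0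
    obtain ⟨a, b⟩ := S.ep_zero (by simpa using hL)
    rw [a, b, hL]
    simp [tt_zero]
  · rw [S.ep_eq (by omega), hL, telR h _ (by omega), br_two h]
    have : qint s (L : ℤ) ≠ 0 := br_ne h (by omega)
    field_simp

/-- case `q < p` -/
lemma Step.case3 (hpq : q < p) :
    ep n lam * (tt s (ll n lam p) * qint s (ll n lam p + cc n lamV p)) =
    ep n lam' * ((∏ j ∈ (Ioc (lamV p) n).erase p, Rr s (ll n lam p) (ll n lam j)) *
      (∏ j ∈ (Ico 1 p).erase q, Rr s (ll n lam p) (cc n lamV j)) *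
      (qint s (ll n lam p + 1) * tt s (ll n lam p + 1))) := by
  obtain ⟨L, hL⟩ := Int.eq_ofNat_of_zero_le S.Lnn
  have hp := S.hp
  have hpn := S.hpn
  have hnM := S.hnM
  have hlp := S.lp
  have hqM := S.hqM
  have hq : 1 ≤ q := by omega
  have hccq := S.ccq
  obtain ⟨v, hv⟩ := Int.eq_ofNat_of_zero_le (S.P.cc_nonneg hp)
  have hvL : L + 2 ≤ v := by
    have := S.P.cc_lt hq hpq
    omega
  have e := S.P.prod_lt M S.hM (Rm s (ll n lam p)) v (by simp only [cc] at hv; omega)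
  have f1 : (Icc 1 n).filter (fun j => ll n lam j < (v : ℤ)) = Ioc (lamV p) n := by
    ext j
    simp only [mem_filter, mem_Icc, mem_Ioc, ← hv]
    constructor
    · rintro ⟨a, b⟩
      have := S.P.ll_lt_cc (i := j) (j := p) a.1 hp
      have := S.P.conj j p a.1 hp
      omega
    · rintro ⟨a, b⟩
      have := S.P.ll_lt_cc (i := j) (j := p) (by omega) hp
      have := S.P.conj j p (by omega) hp
      omega
  have f2 : (Icc 1 M).filter (fun j => cc n lamV j < (v : ℤ)) = Ico 1 p := by
    ext j
    simp only [mem_filter, mem_Icc, mem_Ico, ← hv]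
    constructor
    · rintro ⟨a, b⟩
      exact ⟨a.1, (S.P.cc_lt_iff a.1 hp).1 b⟩
    · rintro ⟨a, b⟩
      exact ⟨⟨a, by omega⟩, S.P.cc_lt a b⟩
  have hVp : lamV p < p := by
    have := S.P.monoV q p hq hpq.le
    have := S.vq
    omega
  have g1 : ∏ j ∈ Ioc (lamV p) n, Rm s (ll n lam p) (ll n lam j) =
      ∏ j ∈ (Ioc (lamV p) n).erase p, Rr s (ll n lam p) (ll n lam j) := by
    rw [← mul_prod_erase _ _ (show p ∈ Ioc (lamV p) n by simp [hVp, hpn])]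
    rw [show Rm s (ll n lam p) (ll n lam p) = 1 by simp [Rm], one_mul]
    apply prod_congr rfl
    intro j hj
    simp only [mem_erase, mem_Ioc] at hj
    unfold Rm
    rw [if_neg]
    have h1 := S.P.ll_lt_iff (i := j) (j := p) (by omega) hp
    have h2 := S.P.ll_lt_iff (i := p) (j := j) hp (by omega)
    have h3 := S.P.ll_lt_cc (i := j) (j := q) (by omega) hq
    have h4 := S.P.cc_lt_ll (i := j) (j := q) (by omega) hq
    omega
  have g2 : ∏ j ∈ Ico 1 p, Rm s (ll n lam p) (cc n lamV j) =
      ∏ j ∈ (Ico 1 p).erase q, Rr s (ll n lam p) (cc n lamV j) := by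
    rw [← mul_prod_erase _ _ (show q ∈ Ico 1 p by simp [hq, hpq])]
    rw [show Rm s (ll n lam p) (cc n lamV q) = 1 by simp [Rm, hccq], one_mul]
    apply prod_congr rfl
    intro j hj
    simp only [mem_erase, mem_Ico] at hj
    unfold Rm
    rw [if_neg]
    have h1 := S.P.cc_lt_iff (i := j) (j := q) (by omega) hq
    have h2 := S.P.cc_lt_iff (i := q) (j := j) hq (by omega)
    have h3 := S.P.ll_lt_cc (i := p) (j := j) (by omega) (by omega)
    have h4 := S.P.cc_lt_ll (i := p) (j := j) (by omega) (by omega)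
    omega
  rw [f1, f2, g1, g2] at e
  rw [e, hL, hv]
  rcases Nat.eq_zero_or_pos L with h0 | h0
  · subst h0
    obtain ⟨a, b⟩ := S.ep_zero (by simpa using hL)
    obtain ⟨k, rfl⟩ : ∃ k, v = k + 2 := ⟨v - 2, by omega⟩
    have e5 := telRm0 h k
    have e6 := br_two h 1
    rw [br_one h, one_mul, one_add_one_eq_two] at e6
    rw [a, b]
    simp only [Nat.cast_zero, zero_add, tt_zero, br_one h, one_mul, ← e6]
    rw [e5]
    push_cast; ring
  · rw [S.ep_eq (by omega), telRm h L v h0 hvL]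

end step

section step
variable {s : ℂ} (h : NR s) {n M p q : ℕ} {lam lamV lam' lamV' : ℕ → ℕ}
  (S : Step n M p q lam lamV lam' lamV')
include S

lemma Step.D1 (hpq : p < q) : Dp s n M lam' lamV' * qint s (ll n lam p) =
    Dp s n M lam lamV * qint s (ll n lam p + 1) := by
  have hp := S.hp
  have hpn := S.hpn
  have hnM := S.hnM
  have hlp := S.lp
  have hpI : p ∈ Icc 1 M := by simp; omega
  unfold Dp
  rw [← mul_prod_erase _ _ hpI, ← mul_prod_erase (Icc 1 M)
    (fun i => if i ≤ lam i then qint s (ll n lam i) * tt s (cc n lamV i) else 1) hpI]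
  have e : ∏ i ∈ (Icc 1 M).erase p,
      (if i ≤ lam' i then qint s (ll n lam' i) * tt s (cc n lamV' i) else 1) =
      ∏ i ∈ (Icc 1 M).erase p,
      (if i ≤ lam i then qint s (ll n lam i) * tt s (cc n lamV i) else 1) := by
    apply prod_congr rfl
    intro i hi
    simp only [mem_erase, mem_Icc] at hi
    rw [S.lo i hi.1, S.ll'o hi.1]
    by_cases hiq : i = q
    · subst hiq
      have := S.P.mono p i hp hpq.le
      have e2 : ¬ i ≤ lam i := by omega
      simp [e2]
    · rw [S.cc'o hiq]
  rw [e, S.lp', S.ll'p, S.cc'o hpq.ne, if_pos hpq.le, if_pos (show p ≤ lam p by omega)]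
  ring

lemma Step.D2 (hpq : p = q) : Dp s n M lam' lamV' =
    Dp s n M lam lamV * (qint s (ll n lam p + 1) * tt s (ll n lam p)) := by
  have hp := S.hp
  have hpn := S.hpn
  have hnM := S.hnM
  have hlp := S.lp
  have hpI : p ∈ Icc 1 M := by simp; omega
  unfold Dp
  rw [← mul_prod_erase _ _ hpI, ← mul_prod_erase (Icc 1 M)
    (fun i => if i ≤ lam i then qint s (ll n lam i) * tt s (cc n lamV i) else 1) hpI]
  have e : ∏ i ∈ (Icc 1 M).erase p,
      (if i ≤ lam' i then qint s (ll n lam' i) * tt s (cc n lamV' i) else 1) =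
      ∏ i ∈ (Icc 1 M).erase p,
      (if i ≤ lam i then qint s (ll n lam i) * tt s (cc n lamV i) else 1) := by
    apply prod_congr rfl
    intro i hi
    simp only [mem_erase, mem_Icc] at hi
    rw [S.lo i hi.1, S.ll'o hi.1, S.cc'o (by omega)]
  have e3 : cc n lamV' p = ll n lam p := by
    have := S.cc'q
    rw [← hpq] at this
    exact this
  rw [e, S.lp', S.ll'p, e3, if_pos hpq.le, if_neg (show ¬ p ≤ lam p by omega)]
  ring

lemma Step.D3 (hpq : q < p) : Dp s n M lam' lamV' * tt s (ll n lam p + 1) =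
    Dp s n M lam lamV * tt s (ll n lam p) := by
  have hp := S.hp
  have hpn := S.hpn
  have hnM := S.hnM
  have hlp := S.lp
  have hqI : q ∈ Icc 1 M := by simp; omega
  unfold Dp
  rw [← mul_prod_erase _ _ hqI, ← mul_prod_erase (Icc 1 M)
    (fun i => if i ≤ lam i then qint s (ll n lam i) * tt s (cc n lamV i) else 1) hqI]
  have e : ∏ i ∈ (Icc 1 M).erase q,
      (if i ≤ lam' i then qint s (ll n lam' i) * tt s (cc n lamV' i) else 1) =
      ∏ i ∈ (Icc 1 M).erase q,
      (if i ≤ lam i then qint s (ll n lam i) * tt s (cc n lamV i) else 1) := by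
    apply prod_congr rfl
    intro i hi
    simp only [mem_erase, mem_Icc] at hi
    rw [S.cc'o hi.1]
    by_cases hip : i = p
    · subst hip
      have e1 : ¬ i ≤ lam i := by omega
      have e2 : ¬ i ≤ lam' i := by rw [S.lp']; omega
      simp [e1, e2]
    · rw [S.lo i hip, S.ll'o hip]
  have hc := S.P.conj q q (by omega) (by omega)
  have hvq := S.vq
  have e1 : q ≤ lam q := by omega
  rw [e, S.lo q hpq.ne, S.ll'o hpq.ne, S.cc'q, S.ccq, if_pos e1, if_pos e1]
  ring

include h

/-- The combined ratio identity. -/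
lemma Step.ratio : Dp s n M lam' lamV' *
    ((∏ j ∈ (Icc 1 M).filter (fun j => j < p ∧ p ≤ lam j ∨ p < j ∧ j < q),
        Rr s (ll n lam p) (ll n lam j)) *
      (if p < q then qint s (ll n lam p + 1 + ll n lam q) else 1)) *
    ((∏ j ∈ (Icc 1 M).filter (fun j => j < q ∧ j ≤ lam q ∨ q < j ∧ j < p),
        (Rr s (ll n lam p) (cc n lamV j))⁻¹) *
      (if q < p then qint s (ll n lam p + cc n lamV p) else 1)) * ep n lam =
    Dp s n M lam lamV * ep n lam' *
      (∏ j ∈ (Icc 1 n).erase p, Rr s (ll n lam p) (ll n lam j)) * qint s (ll n lam p + 1) := by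
  have hp := S.hp
  have hpn := S.hpn
  have hnM := S.hnM
  have hqM := S.hqM
  have hlp := S.lp
  have hvq := S.vq
  rcases lt_trichotomy p q with hpq | hpq | hpq
  · have f1 : (Icc 1 M).filter (fun j => j < p ∧ p ≤ lam j ∨ p < j ∧ j < q) =
        (Ico 1 q).erase p := by
      ext j
      simp only [mem_filter, mem_Icc, mem_erase, mem_Ico]
      constructor
      · omega
      · rintro ⟨a, b⟩
        have : j < p → lam p ≤ lam j := fun hh => S.P.mono j p b.1 hh.le
        omega
    have f2 : (Icc 1 M).filter (fun j => j < q ∧ j ≤ lam q ∨ q < j ∧ j < p) =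
        Icc 1 (lam q) := by
      ext j
      have := S.P.mono p q hp hpq.le
      simp only [mem_filter, mem_Icc]
      omega
    have hLpos : 0 < ll n lam p := by simp only [ll]; omega
    have hL0 : qint s (ll n lam p) ≠ 0 := br_ne h hLpos.ne'
    have hY : ∏ j ∈ Icc 1 (lam q), Rr s (ll n lam p) (cc n lamV j) ≠ 0 := by
      rw [prod_ne_zero_iff]
      intro j hj
      rw [mem_Icc] at hj
      exact S.Rc_ne h hj.1 (Or.inl hLpos)
    rw [f1, f2, if_pos hpq, if_neg (by omega), S.case1 h hpq, S.ep_eq hLpos, prod_inv_distrib]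
    have e := S.D1 (s := s) hpq
    field_simp
    linear_combination (∏ j ∈ (Icc 1 n).erase p, Rr s (ll n lam p) (ll n lam j)) * ep n lam * e
  · have f1 : (Icc 1 M).filter (fun j => j < p ∧ p ≤ lam j ∨ p < j ∧ j < q) =
        Ico 1 p := by
      ext j
      simp only [mem_filter, mem_Icc, mem_Ico]
      constructor
      · omega
      · rintro ⟨a, b⟩
        have := S.P.conj j q a (by omega)
        omega
    have f2 : (Icc 1 M).filter (fun j => j < q ∧ j ≤ lam q ∨ q < j ∧ j < p) =
        Ico 1 p := by
      ext j
      have : lam q = lam p := by rw [hpq]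
      simp only [mem_filter, mem_Icc, mem_Ico]
      omega
    have hY : ∏ j ∈ Ico 1 p, Rr s (ll n lam p) (cc n lamV j) ≠ 0 := by
      rw [prod_ne_zero_iff]
      intro j hj
      rw [mem_Ico] at hj
      refine S.Rc_ne h hj.1 (Or.inl ?_)
      simp only [ll]; omega
    have e2 : ∏ j ∈ (Icc 1 n).erase p, Rr s (ll n lam p) (ll n lam j) =
        (∏ i ∈ Ico 1 p, Rr s (ll n lam p) (ll n lam i)) *
        (∏ j ∈ Ioc p n, Rr s (ll n lam p) (ll n lam j)) := by
      rw [← prod_union]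
      · apply prod_congr _ (fun _ _ => rfl)
        ext j
        simp only [mem_erase, mem_Icc, mem_union, mem_Ico, mem_Ioc]
        omega
      · rw [Finset.disjoint_left]
        intro j
        simp only [mem_Ico, mem_Ioc]
        omega
    rw [f1, f2, if_neg (by omega), if_neg (by omega), e2, S.D2 hpq, prod_inv_distrib]
    have e := S.case2 h hpq
    field_simp
    linear_combination Dp s n M lam lamV * qint s (ll n lam p + 1) *
      (∏ i ∈ Ico 1 p, Rr s (ll n lam p) (ll n lam i)) * e
  · have hVp : lamV p < p := by
      have := S.P.monoV q p (by omega) hpq.le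
      omega
    have f1 : (Icc 1 M).filter (fun j => j < p ∧ p ≤ lam j ∨ p < j ∧ j < q) =
        Icc 1 (lamV p) := by
      ext j
      simp only [mem_filter, mem_Icc]
      constructor
      · rintro ⟨a, b⟩
        have := S.P.conj j p a.1 hp
        omega
      · rintro ⟨a, b⟩
        have := S.P.conj j p a hp
        omega
    have f2 : (Icc 1 M).filter (fun j => j < q ∧ j ≤ lam q ∨ q < j ∧ j < p) =
        (Ico 1 p).erase q := by
      ext j
      have := S.P.conj q q (by omega) (by omega)
      simp only [mem_filter, mem_Icc, mem_Ico, mem_erase]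
      omega
    have hY : ∏ j ∈ (Ico 1 p).erase q, Rr s (ll n lam p) (cc n lamV j) ≠ 0 := by
      rw [prod_ne_zero_iff]
      intro j hj
      rw [mem_erase, mem_Ico] at hj
      refine S.Rc_ne h hj.2.1 ?_
      by_contra hc
      push Not at hc
      have h1 := S.Lnn
      have h2 := S.P.cc_lt_iff (i := j) (j := q) hj.2.1 (by omega)
      have h3 := S.ccq
      simp only [ll] at hc
      omega
    have e2 : ∏ j ∈ (Icc 1 n).erase p, Rr s (ll n lam p) (ll n lam j) =
        (∏ i ∈ Icc 1 (lamV p), Rr s (ll n lam p) (ll n lam i)) *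
        (∏ j ∈ (Ioc (lamV p) n).erase p, Rr s (ll n lam p) (ll n lam j)) := by
      rw [← prod_union]
      · apply prod_congr _ (fun _ _ => rfl)
        ext j
        simp only [mem_erase, mem_Icc, mem_union, mem_Ioc]
        omega
      · rw [Finset.disjoint_left]
        intro j
        simp only [mem_Icc, mem_erase, mem_Ioc]
        omega
    have e := S.case3 h hpq
    have e3 := S.D3 (s := s) hpq
    have ht : tt s (ll n lam p + 1) ≠ 0 := tt_ne h (by have := S.Lnn; omega)
    rw [f1, f2, if_neg (by omega), if_pos hpq, e2, prod_inv_distrib]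
    field_simp
    apply mul_right_cancel₀ ht
    linear_combination (∏ i ∈ Icc 1 (lamV p), Rr s (ll n lam p) (ll n lam i)) *
      qint s (ll n lam p + cc n lamV p) * ep n lam * e3 +
      (∏ i ∈ Icc 1 (lamV p), Rr s (ll n lam p) (ll n lam i)) * Dp s n M lam lamV * e

lemma Step.main (K : ℂ)
    (hI : Dp s n M lam lamV * Ap s n M lam * Bp s n M lam lamV * K =
      ep n lam * Tp s n lam * (Tm s n lam * Hp s n M lam lamV)) :
    Dp s n M lam' lamV' * Ap s n M lam' * Bp s n M lam' lamV' * K =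
      ep n lam' * Tp s n lam' * (Tm s n lam' * Hp s n M lam' lamV') := by
  have e := S.ratio h
  rw [S.ratHT h, S.ratTp h, S.ratA h, S.ratB h]
  have h0 := ep_ne n lam
  rw [← mul_left_inj' h0]
  generalize (∏ j ∈ (Icc 1 M).filter (fun j => j < p ∧ p ≤ lam j ∨ p < j ∧ j < q),
        Rr s (ll n lam p) (ll n lam j)) *
      (if p < q then qint s (ll n lam p + 1 + ll n lam q) else 1) = X at *
  generalize ((∏ j ∈ (Icc 1 M).filter (fun j => j < q ∧ j ≤ lam q ∨ q < j ∧ j < p),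
        (Rr s (ll n lam p) (cc n lamV j))⁻¹) *
      (if q < p then qint s (ll n lam p + cc n lamV p) else 1)) = Y at *
  generalize (∏ j ∈ (Icc 1 n).erase p, Rr s (ll n lam p) (ll n lam j)) = Z at *
  linear_combination Ap s n M lam * Bp s n M lam lamV * K * e +
    ep n lam' * Z * qint s (ll n lam p + 1) * hI

end step

lemma invariant {s : ℂ} (h : NR s) (n M : ℕ) (hn : 1 ≤ n) (hnM : n ≤ M) (N : ℕ) :
    ∀ lam lamV : ℕ → ℕ, Part n lam lamV → (∀ i, 1 ≤ i → lam i ≤ M) →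
    ∑ i ∈ Icc 1 n, lam i = N →
    Dp s n M lam lamV * Ap s n M lam * Bp s n M lam lamV *
      (Tp s n (fun _ => 0) * Tm s n (fun _ => 0)) =
      ep n lam * Tp s n lam * (Tm s n lam * Hp s n M lam lamV) := by
  induction N with
  | zero =>
    intro lam lamV P hM hs
    have hz : ∀ i, 1 ≤ i → lam i = 0 := by
      intro i hi
      by_cases hin : i ≤ n
      · exact (sum_eq_zero_iff.1 hs) i (by simp [hi, hin])
      · exact P.hN i (by omega)
    have d : Dp s n M lam lamV = 1 := by
      apply prod_eq_one
      intro i hi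
      rw [mem_Icc] at hi
      rw [if_neg]; have := hz i hi.1; omega
    have a : Ap s n M lam = 1 := by
      apply prod_eq_one
      intro i hi
      apply prod_eq_one
      intro j hj
      rw [mem_Icc] at hi hj
      rw [if_neg]; have := hz i hi.1; omega
    have b : Bp s n M lam lamV = 1 := by
      apply prod_eq_one
      intro i hi
      apply prod_eq_one
      intro j hj
      rw [mem_Icc] at hi hj
      rw [if_neg]; have := hz i hi.1; omega
    have c : Hp s n M lam lamV = 1 := by
      apply prod_eq_one
      intro i hi
      apply prod_eq_one
      intro j hj
      rw [mem_Icc] at hi hj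
      rw [if_neg]; have := hz i hi.1; omega
    have t1 : Tp s n lam = Tp s n (fun _ => 0) := by
      refine prod_congr rfl fun i hi => prod_congr rfl fun j hj => ?_
      rw [mem_Icc] at hi hj
      simp only [ll, hz i hi.1, hz j hj.1]
    have t2 : Tm s n lam = Tm s n (fun _ => 0) := by
      refine prod_congr rfl fun i hi => prod_congr rfl fun j hj => ?_
      rw [mem_Icc] at hi hj
      simp only [ll, hz i hi.1, hz j hj.1]
    rw [d, a, b, c, t1, t2, ep, if_pos (hz n hn)]
    ring
  | succ N ih =>
    intro lam' lamV' P' hM hs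
    obtain ⟨p, hp1, hpn, hpne, hmax⟩ : ∃ p, 1 ≤ p ∧ p ≤ n ∧ lam' p ≠ 0 ∧ ∀ i, p < i → lam' i = 0 := by
      have hex : ((Icc 1 n).filter (fun i => lam' i ≠ 0)).Nonempty := by
        by_contra hc
        rw [Finset.not_nonempty_iff_eq_empty, filter_eq_empty_iff] at hc
        rw [sum_eq_zero (fun i hi => by simpa using hc hi)] at hs
        omega
      refine ⟨((Icc 1 n).filter (fun i => lam' i ≠ 0)).max' hex, ?_, ?_, ?_, fun i hi => ?_⟩
      · have := Finset.max'_mem _ hex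
        simp only [mem_filter, mem_Icc] at this
        exact this.1.1
      · have := Finset.max'_mem _ hex
        simp only [mem_filter, mem_Icc] at this
        exact this.1.2
      · have := Finset.max'_mem _ hex
        simp only [mem_filter, mem_Icc] at this
        exact this.2
      · by_contra hc
        by_cases hin : i ≤ n
        · have := Finset.le_max' ((Icc 1 n).filter (fun i => lam' i ≠ 0)) i
            (by simp only [mem_filter, mem_Icc]; omega)
          omega
        · exact hc (P'.hN i (by omega))
    obtain ⟨q, hq⟩ : ∃ q, q = lam' p := ⟨_, rfl⟩
    have hq1 : 1 ≤ q := by omega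
    have hvq : lamV' q = p := by
      have h1 := P'.conj p q hp1 hq1
      have h2 := P'.conj (p + 1) q (by omega) hq1
      have h3 := hmax (p + 1) (by omega)
      omega
    have P : Part n (Function.update lam' p (q - 1)) (Function.update lamV' q (p - 1)) := by
      refine ⟨?_, ?_, ?_⟩
      · intro i j hi hij
        have h1 := P'.mono i j hi hij
        simp only [Function.update_apply]
        split_ifs with a b b
        · omega
        · subst a; omega
        · subst b
          have := hmax j (by omega)
          omega
        · exact h1
      · intro i hi
        rw [Function.update_of_ne (by omega)]
        exact P'.hN i hi
      · intro i j hi hj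
        have h1 := P'.conj i j hi hj
        simp only [Function.update_apply]
        split_ifs with a b b
        · omega
        · subst a; omega
        · subst b; omega
        · exact h1
    have S : Step n M p q (Function.update lam' p (q - 1)) (Function.update lamV' q (p - 1))
        lam' lamV' :=
      { P := P
        P' := P'
        hp := hp1
        hpn := hpn
        hnM := hnM
        hqM := by rw [hq]; exact hM p hp1
        hM := by
          intro i hi
          have := hM i hi
          have := hM p hp1
          simp only [Function.update_apply]
          split_ifs <;> omega
        lp := by simp; omega
        lp' := hq.symm
        vq := by simp; omega
        vq' := hvq
        lo := fun i hi => by rw [Function.update_of_ne hi]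
        vo := fun i hi => by rw [Function.update_of_ne hi] }
    apply S.main h
    apply ih _ _ P S.hM
    have hpI : p ∈ Icc 1 n := by simp [hp1, hpn]
    rw [← add_sum_erase _ _ hpI] at hs ⊢
    have : ∑ x ∈ (Icc 1 n).erase p, Function.update lam' p (q - 1) x =
        ∑ x ∈ (Icc 1 n).erase p, lam' x := by
      apply sum_congr rfl
      intro i hi
      rw [mem_erase] at hi
      rw [Function.update_of_ne hi.1]
    rw [this]
    simp
    omega

lemma Hp_ne {s : ℂ} (h : NR s) {n M : ℕ} {lam lamV : ℕ → ℕ} (P : Part n lam lamV) :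
    Hp s n M lam lamV ≠ 0 := by
  unfold Hp
  rw [prod_ne_zero_iff]
  intro i hi
  rw [prod_ne_zero_iff]
  intro j hj
  rw [mem_Icc] at hi hj
  split_ifs with hc
  · have := (P.cc_lt_ll hi.1 hj.1).2 hc
    exact br_ne h (by omega)
  · exact one_ne_zero

lemma T0_ne {s : ℂ} (h : NR s) {n : ℕ} : Tp s n (fun _ => 0) * Tm s n (fun _ => 0) ≠ 0 := by
  apply mul_ne_zero
  all_goals
    first | unfold Tp | unfold Tm
    rw [prod_ne_zero_iff]
    intro i hi
    rw [prod_ne_zero_iff]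
    intro j hj
    rw [mem_Icc] at hi hj
    split_ifs with hc
    · simp only [ll]
      exact br_ne h (by push_cast; omega)
    · exact one_ne_zero

lemma rhs_eq (s : ℂ) (n : ℕ) (lam : ℕ → ℕ) :
    ∏ p ∈ (Finset.Icc 1 n ×ˢ Finset.Icc 1 n).filter (fun p => p.1 < p.2),
          qint s (2 * n + (lam p.1 : ℤ) - p.1 + (lam p.2 : ℤ) - p.2) *
            qint s ((lam p.1 : ℤ) - p.1 - (lam p.2 : ℤ) + p.2) /
          (qint s (2 * n - (p.1 : ℤ) - p.2) * qint s ((p.2 : ℤ) - p.1)) =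
    Tp s n lam * Tm s n lam / (Tp s n (fun _ => 0) * Tm s n (fun _ => 0)) := by
  unfold Tp Tm
  simp only [← prod_mul_distrib, ← prod_div_distrib]
  rw [prod_filter, prod_product]
  refine prod_congr rfl fun i hi => prod_congr rfl fun j hj => ?_
  simp only [ll]
  split_ifs with hc
  · congr 2
    · congr 1; ring
    · congr 1; ring
    · congr 1; push_cast; ring
    · congr 1; push_cast; ring
  · simp

lemma wenzl_eq {s : ℂ} (h : NR s) {n M : ℕ} {lam lamV : ℕ → ℕ} (P : Part n lam lamV)
    (hnM : n ≤ M) (hM : ∀ i, 1 ≤ i → lam i ≤ M) :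
    wenzl (s ^ (2 * (n : ℤ) - 1)) s lam lamV n =
      Dp s n M lam lamV * (Ap s n M lam * Bp s n M lam lamV) / Hp s n M lam lamV := by
  have hcells : cells lam n = (Icc 1 M ×ˢ Icc 1 M).filter (fun p => p.2 ≤ lam p.1) := by
    ext ⟨i, j⟩
    simp only [cells, mem_filter, mem_product, mem_Icc]
    constructor
    · rintro ⟨⟨a, b⟩, c⟩
      have := hM i a.1
      omega
    · rintro ⟨⟨a, b⟩, c⟩
      have := P.mono 1 i le_rfl a.1
      have := P.hN i
      omega
  have hH : ∏ p ∈ cells lam n, qint s (hookl lam lamV p) = Hp s n M lam lamV := by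
    rw [hcells, prod_filter, prod_product]
    refine prod_congr rfl fun i hi => prod_congr rfl fun j hj => ?_
    simp only [hookl, ll, cc]
    split_ifs
    · congr 1; ring
    · rfl
  have hD : ∏ p ∈ (cells lam n).filter (fun p => p.1 = p.2),
      (qintA (s ^ (2 * (n : ℤ) - 1)) s ((lam p.1 : ℤ) - (lamV p.1 : ℤ)) +
        qint s (hookl lam lamV p)) = Dp s n M lam lamV := by
    rw [hcells, prod_filter, prod_filter, prod_product]
    refine prod_congr rfl fun i hi => ?_
    rw [prod_eq_single i]
    · simp only [if_true]
      split_ifs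
      · rw [qintA_eq h, ← br_add h]
        simp only [hookl, ll, cc]
        congr 1
        · congr 1; ring
        · congr 1; ring
      · rfl
    · intro j _ hji
      rw [if_neg (show ¬ i = j from fun hh => hji hh.symm)]
      simp
    · intro hh; exact absurd hi hh
  have hN : ∏ p ∈ (cells lam n).filter (fun p => p.1 ≠ p.2),
      qintA (s ^ (2 * (n : ℤ) - 1)) s (dcell lam lamV p) = Ap s n M lam * Bp s n M lam lamV := by
    unfold Ap Bp
    simp only [← prod_mul_distrib]
    rw [hcells, prod_filter, prod_filter, prod_product]
    refine prod_congr rfl fun i hi => prod_congr rfl fun j hj => ?_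
    by_cases hc : j ≤ lam i
    · simp only [hc, if_true, and_true, qintA_eq h, dcell]
      rcases lt_trichotomy i j with hij | hij | hij
      · simp only [hij.ne, hij, hij.le, hij.not_gt, ne_eq, not_false_eq_true, if_true, if_false,
          mul_one, ll]
        congr 1; ring
      · simp [hij]
      · simp only [hij.ne', hij, hij.not_ge, hij.not_gt, ne_eq, not_false_eq_true, if_true, if_false,
          one_mul, cc]
        congr 1; ring
    · simp [hc]
  unfold wenzl
  rw [prod_div_distrib, prod_div_distrib, hD, hN, ← hH,
    ← prod_filter_mul_prod_filter_not (cells lam n) (fun p => p.1 = p.2)]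
  rw [div_mul_div_comm]

lemma final {s : ℂ} (h : NR s) {n : ℕ} (hn : 1 ≤ n) {lam lamV : ℕ → ℕ} (P : Part n lam lamV) :
    wenzl (s ^ (2 * (n : ℤ) - 1)) s lam lamV n = ep n lam *
      (Tp s n lam * Tm s n lam / (Tp s n (fun _ => 0) * Tm s n (fun _ => 0))) := by
  have hM : ∀ i, 1 ≤ i → lam i ≤ n + lam 1 := fun i hi => by
    have := P.mono 1 i le_rfl hi
    omega
  have e := invariant h n (n + lam 1) hn (by omega) _ lam lamV P hM rfl
  rw [wenzl_eq h P (M := n + lam 1) (by omega) hM]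
  have h1 := Hp_ne h (M := n + lam 1) P
  have h2 := T0_ne h (n := n)
  rw [← mul_div_assoc, div_eq_div_iff h1 h2]
  linear_combination e

end WenzlAux
/-- The even orthogonal specialization `α = s^{2n-1}` of
Wenzl's quantum dimension, for a partition with at most `n` parts: it equals the
product over pairs if `λ_n = 0`, and twice that product if `λ_n ≠ 0`. -/
theorem wenzl_even_orthogonal (n : ℕ) (hn : 1 ≤ n) (s : ℂ) (hs : s ≠ 0)
    (hroot : ∀ m : ℕ, 0 < m → s ^ m ≠ 1)
    (lam lamV : ℕ → ℕ)
    (hmono : ∀ i j : ℕ, 1 ≤ i → i ≤ j → lam j ≤ lam i)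
    (hN : ∀ i, n < i → lam i = 0)
    (hconj : ∀ i j : ℕ, 1 ≤ i → 1 ≤ j → (j ≤ lam i ↔ i ≤ lamV j)) :
    (lam n = 0 →
      wenzl (s ^ (2 * (n : ℤ) - 1)) s lam lamV n =
        ∏ p ∈ (Finset.Icc 1 n ×ˢ Finset.Icc 1 n).filter (fun p => p.1 < p.2),
          qint s (2 * n + (lam p.1 : ℤ) - p.1 + (lam p.2 : ℤ) - p.2) *
            qint s ((lam p.1 : ℤ) - p.1 - (lam p.2 : ℤ) + p.2) /
          (qint s (2 * n - (p.1 : ℤ) - p.2) * qint s ((p.2 : ℤ) - p.1))) ∧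
    (lam n ≠ 0 →
      wenzl (s ^ (2 * (n : ℤ) - 1)) s lam lamV n =
        2 * ∏ p ∈ (Finset.Icc 1 n ×ˢ Finset.Icc 1 n).filter (fun p => p.1 < p.2),
          qint s (2 * n + (lam p.1 : ℤ) - p.1 + (lam p.2 : ℤ) - p.2) *
            qint s ((lam p.1 : ℤ) - p.1 - (lam p.2 : ℤ) + p.2) /
          (qint s (2 * n - (p.1 : ℤ) - p.2) * qint s ((p.2 : ℤ) - p.1))) := by
  have h : WenzlAux.NR s := ⟨hs, hroot⟩
  have P : WenzlAux.Part n lam lamV := ⟨hmono, hN, hconj⟩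
  have e := WenzlAux.final h hn P
  have r := WenzlAux.rhs_eq s n lam
  constructor
  · intro h0
    rw [r, e, WenzlAux.ep, if_pos h0, one_mul]
  · intro h0
    rw [r, e, WenzlAux.ep, if_neg h0]
end
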